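/- Let n ≥ 2. If φ is a partial proper edge coloring of at most n edges of the complete graph K_{2n} (on 2n vertices) that is not a matching consisting of n−1 edges all colored by one fixed color c and one edge colored by a different color c', then φ is extendable to a proper (2n−1)-edge coloring of K_{2n}. -/

import Mathlib

open SimpleGraph

variable {V : Type*}

/-- Two edges of `G` are adjacent if both are edges, they are distinct,
and they share a vertex. -/
def EdgeAdj (G : SimpleGraph V) (e f : Sym2 V) : Prop :=
  e ∈ G.edgeSet ∧ f ∈ G.edgeSet ∧ e ≠ f ∧ ∃ v, v ∈ e ∧ v ∈ f

/-- A proper edge coloring (with natural-number colors). -/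
def IsProperEdgeColoring (G : SimpleGraph V) (C : Sym2 V → ℕ) : Prop :=
  ∀ ⦃e f⦄, EdgeAdj G e f → C e ≠ C f

/-- A partial proper edge coloring: colored edges are edges of `G`, and
adjacent colored edges receive distinct colors. -/
def IsPartialProperEdgeColoring (G : SimpleGraph V) (φ : Sym2 V → Option ℕ) : Prop :=
  (∀ e, φ e ≠ none → e ∈ G.edgeSet) ∧
  ∀ ⦃e f⦄, EdgeAdj G e f → φ e ≠ none → φ e ≠ φ f

/-- The partial coloring uses colors from `{0, ..., t-1}`. -/
def UsesColors (φ : Sym2 V → Option ℕ) (t : ℕ) : Prop :=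
  ∀ e a, φ e = some a → a < t

/-- The (total) coloring uses colors from `{0, ..., t-1}` on all edges of `G`. -/
def ColorsBelow (G : SimpleGraph V) (C : Sym2 V → ℕ) (t : ℕ) : Prop :=
  ∀ e ∈ G.edgeSet, C e < t

/-- `C` agrees with the partial coloring `φ` on all precolored edges. -/
def ExtendsColoring (C : Sym2 V → ℕ) (φ : Sym2 V → Option ℕ) : Prop :=
  ∀ e a, φ e = some a → C e = a

/-- `φ` extends to a proper edge coloring of `G` with `t` colors. -/
def Extendable (G : SimpleGraph V) (φ : Sym2 V → Option ℕ) (t : ℕ) : Prop :=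
  ∃ C, IsProperEdgeColoring G C ∧ ColorsBelow G C t ∧ ExtendsColoring C φ

/-- The set of precolored edges of `φ`. -/
def Precolored (φ : Sym2 V → Option ℕ) : Set (Sym2 V) := {e | φ e ≠ none}

/-- The chromatic index: least `t` admitting a proper edge coloring with `t` colors. -/
noncomputable def chromaticIndex (G : SimpleGraph V) : ℕ :=
  sInf {t | ∃ C, IsProperEdgeColoring G C ∧ ColorsBelow G C t}

/-- A set of edges is independent (a matching) if no two distinct members share a vertex. -/
def IndependentEdges (S : Set (Sym2 V)) : Prop :=
  ∀ e ∈ S, ∀ f ∈ S, e ≠ f → ∀ v, v ∈ e → v ∉ f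

set_option linter.unusedSectionVars false

/-- A doubly stochastic matrix supports a permutation on which a given linear functional
is at least its value on the matrix. -/
theorem exists_perm_of_doublyStochastic {C : Type} [Fintype C] [DecidableEq C]
    (M : Matrix C C ℝ) (hM : M ∈ doublyStochastic ℝ C) (L : C → C → ℝ) :
    ∃ σ : Equiv.Perm C, (∀ i, 0 < M i (σ i)) ∧
      ∑ i, ∑ j, L i j * M i j ≤ ∑ i, L i (σ i) := by
  obtain ⟨w, hw0, hw1, hwM⟩ := exists_eq_sum_perm_of_mem_doublyStochastic hM
  have hent : ∀ i j, M i j = ∑ σ : Equiv.Perm C, w σ * (if σ i = j then 1 else 0) := by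
    intro i j
    rw [← hwM, Matrix.sum_apply]
    refine Finset.sum_congr rfl fun σ _ => ?_
    simp [Equiv.Perm.permMatrix, PEquiv.toMatrix_apply, Equiv.toPEquiv_apply, eq_comm]
  have hpos : ∀ σ, 0 < w σ → ∀ i, 0 < M i (σ i) := by
    intro σ hσ i
    rw [hent]
    refine lt_of_lt_of_le hσ ?_
    refine le_trans (by simp) (Finset.single_le_sum
      (f := fun τ : Equiv.Perm C => w τ * (if τ i = σ i then (1 : ℝ) else 0)) ?_
      (Finset.mem_univ σ))
    intro τ _
    have := hw0 τ
    split_ifs <;> simp [this]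
  have hsum : ∑ i, ∑ j, L i j * M i j = ∑ σ : Equiv.Perm C, w σ * ∑ i, L i (σ i) := by
    simp_rw [hent, Finset.mul_sum]
    rw [Finset.sum_congr rfl fun i _ => Finset.sum_comm, Finset.sum_comm]
    refine Finset.sum_congr rfl fun σ _ => Finset.sum_congr rfl fun i _ => ?_
    simp [mul_comm]
  by_contra hcon
  push Not at hcon
  set A := ∑ i, ∑ j, L i j * M i j with hA
  have hlt : ∑ σ : Equiv.Perm C, w σ * ∑ i, L i (σ i) < ∑ σ : Equiv.Perm C, w σ * A := by
    obtain ⟨σ, -, hσ⟩ := Finset.exists_ne_zero_of_sum_ne_zero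
      (show ∑ σ : Equiv.Perm C, w σ ≠ 0 by rw [hw1]; exact one_ne_zero)
    refine Finset.sum_lt_sum (fun τ _ => ?_) ⟨σ, Finset.mem_univ _, ?_⟩
    · rcases (hw0 τ).eq_or_lt with h | h
      · simp [← h]
      · exact (mul_lt_mul_of_pos_left (hcon τ (hpos τ h)) h).le
    · have h := (hw0 σ).lt_of_ne' hσ
      exact mul_lt_mul_of_pos_left (hcon σ (hpos σ h)) h
  rw [← hsum, ← Finset.sum_mul, hw1, one_mul] at hlt
  exact lt_irrefl _ hlt

/-- A fractional matching saturating `T` can be replaced by an integral one in its support that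
saturates `T` and all tight columns and does not decrease a given linear functional. -/
theorem exists_matching_of_weights {V C : Type} [Fintype C] [DecidableEq V] [DecidableEq C]
    [Nonempty C] (T : Finset V) (w : V → C → ℝ) (hw : ∀ u ∈ T, ∀ c, 0 ≤ w u c)
    (hrow : ∀ u ∈ T, ∑ c, w u c = 1) (hcol : ∀ c, ∑ u ∈ T, w u c ≤ 1) (L : V → C → ℝ) :
    ∃ m : V → C, Set.InjOn m T ∧ (∀ u ∈ T, 0 < w u (m u)) ∧
      (∀ c, ∑ u ∈ T, w u c = 1 → ∃ u ∈ T, m u = c) ∧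
      ∑ u ∈ T, ∑ c, L u c * w u c ≤ ∑ u ∈ T, L u (m u) := by
  have htot : (T.card : ℝ) = ∑ c, ∑ u ∈ T, w u c := by
    rw [Finset.sum_comm, Finset.sum_congr rfl hrow]; simp
  have hle : T.card ≤ Fintype.card C := by
    have : (T.card : ℝ) ≤ Fintype.card C := by
      rw [htot]
      refine (Finset.sum_le_sum fun c _ => hcol c).trans (by simp)
    exact_mod_cast this
  obtain ⟨k, hk⟩ := Nat.exists_eq_add_of_le hle
  have e : (T ⊕ Fin k) ≃ C := Fintype.equivOfCardEq (by simp [hk])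
  let M' : T ⊕ Fin k → C → ℝ := fun i c =>
    Sum.elim (fun u : T => w u c) (fun _ => (1 - ∑ u ∈ T, w u c) / k) i
  let M : Matrix C C ℝ := fun i c => M' (e.symm i) c
  have hkM : ∀ c, (∑ _x : Fin k, (1 - ∑ u ∈ T, w u c) / k) = 1 - ∑ u ∈ T, w u c := by
    intro c
    rcases Nat.eq_zero_or_pos k with h0 | h0
    · have hz : ∑ c, (1 - ∑ u ∈ T, w u c) = 0 := by
        rw [Finset.sum_sub_distrib, ← htot]; simp [hk, h0]
      have := (Finset.sum_eq_zero_iff_of_nonneg (fun c _ => sub_nonneg.2 (hcol c))).1 hz c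
        (Finset.mem_univ c)
      rw [this]; simp
    · have : (k : ℝ) ≠ 0 := by positivity
      simp; field_simp
  have hM : M ∈ doublyStochastic ℝ C := by
    rw [mem_doublyStochastic_iff_sum]
    refine ⟨fun i c => ?_, fun i => ?_, fun c => ?_⟩
    · show 0 ≤ M' (e.symm i) c
      rcases e.symm i with u | j
      · exact hw u u.2 c
      · exact div_nonneg (sub_nonneg.2 (hcol c)) (Nat.cast_nonneg k)
    · show ∑ c, M' (e.symm i) c = 1
      rcases e.symm i with u | j
      · exact hrow u u.2
      · have hk0 : (k : ℝ) ≠ 0 := by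
          have := j.pos
          positivity
        show ∑ c, (1 - ∑ u ∈ T, w u c) / k = 1
        rw [← Finset.sum_div, Finset.sum_sub_distrib, ← htot]
        simp [hk, hk0]
    · show ∑ i, M' (e.symm i) c = 1
      rw [Equiv.sum_comp e.symm (fun i => M' i c), Fintype.sum_sum_type]
      show ∑ u : T, w u c + ∑ _x : Fin k, (1 - ∑ u ∈ T, w u c) / k = 1
      rw [hkM, Finset.sum_coe_sort T (fun u => w u c)]
      ring
  obtain ⟨σ, hσ, hσL⟩ := exists_perm_of_doublyStochastic M hM
    (fun i c => Sum.elim (fun u : T => L u c) (fun _ => 0) (e.symm i))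
  refine ⟨fun u => if h : u ∈ T then σ (e (Sum.inl ⟨u, h⟩)) else Classical.arbitrary C,
    ?_, ?_, ?_, ?_⟩
  · intro u hu v hv huv
    simp only [Finset.mem_coe] at hu hv
    simpa [hu, hv] using huv
  · intro u hu
    have := hσ (e (Sum.inl ⟨u, hu⟩))
    simpa [hu, M, M'] using this
  · intro c hc
    have := hσ (σ.symm c)
    rcases h : e.symm (σ.symm c) with u | j
    · refine ⟨u, u.2, ?_⟩
      rw [Equiv.symm_apply_eq] at h
      simp [← h]
    · simp [M, M', h, hc] at this
  · have h1 : ∑ i, ∑ c, Sum.elim (fun u : T => L u c) (fun _ => 0) (e.symm i) * M i c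
        = ∑ u ∈ T, ∑ c, L u c * w u c := by
      show ∑ i, ∑ c, Sum.elim (fun u : T => L u c) (fun _ => 0) (e.symm i) * M' (e.symm i) c = _
      rw [Equiv.sum_comp e.symm (fun i => ∑ c, Sum.elim (fun u : T => L u c) (fun _ => 0) i *
        M' i c), Fintype.sum_sum_type]
      simp only [Sum.elim_inl, Sum.elim_inr, zero_mul, Finset.sum_const_zero, add_zero, M']
      exact Finset.sum_coe_sort T (fun u => ∑ c, L u c * w u c)
    rw [h1] at hσL
    refine hσL.trans (le_of_eq ?_)
    rw [← Equiv.sum_comp e, Fintype.sum_sum_type]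
    simp only [Equiv.symm_apply_apply, Sum.elim_inl, Sum.elim_inr, Finset.sum_const_zero, add_zero]
    rw [← Finset.sum_coe_sort T]
    refine Finset.sum_congr rfl fun u _ => ?_
    simp

/-- `f` is symmetric and restricts to a proper edge coloring of the complete graph on `T`.
Values on the diagonal are irrelevant. -/
def IsProper {V C : Type} (T : Finset V) (f : V → V → C) : Prop :=
  (∀ u v, f u v = f v u) ∧
    ∀ u ∈ T, ∀ v ∈ T, ∀ w ∈ T, u ≠ v → u ≠ w → f u v = f u w → v = w

/-- The vertices of `T` that see no edge of color `c` inside `T`. -/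
def miss {V C : Type} [DecidableEq V] [DecidableEq C] (T : Finset V) (f : V → V → C) (c : C) :
    Finset V :=
  T.filter fun u => ∀ v ∈ T, v ≠ u → f u v ≠ c

/-- Coloring of the edges at a new vertex `x` by `m`. -/
def extendAt {V C : Type} [DecidableEq V] (f : V → V → C) (x : V) (m : V → C) (u v : V) : C :=
  if u = x then m v else if v = x then m u else f u v

theorem even_card_of_involution {α : Type} (s : Finset α) (g : α → α)
    (hs : ∀ a ∈ s, g a ∈ s) (hg : ∀ a ∈ s, g (g a) = a) (hne : ∀ a ∈ s, g a ≠ a) :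
    Even s.card := by
  have h : ∑ a ∈ s, (1 : ZMod 2) = 0 :=
    Finset.sum_involution (fun a _ => g a) (fun a _ => by decide) (fun a ha _ => hne a ha)
      (fun a ha => hs a ha) (fun a ha => hg a ha)
  rw [Finset.sum_const, nsmul_eq_mul, mul_one] at h
  exact (ZMod.natCast_eq_zero_iff_even).1 h

section

variable {V C : Type} {T : Finset V} {f : V → V → C}

theorem IsProper.symm (hf : IsProper T f) (u v : V) : f u v = f v u := hf.1 u v

theorem IsProper.mono {S : Finset V} (hf : IsProper T f) (h : S ⊆ T) : IsProper S f :=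
  ⟨hf.1, fun u hu v hv w hw => hf.2 u (h hu) v (h hv) w (h hw)⟩

theorem extendAt_of_ne [DecidableEq V] {x : V} {m : V → C} {u v : V} (hu : u ≠ x) (hv : v ≠ x) :
    extendAt f x m u v = f u v := by simp [extendAt, hu, hv]

theorem extendAt_left [DecidableEq V] {x : V} {m : V → C} {v : V} : extendAt f x m x v = m v := by
  simp [extendAt]

theorem extendAt_right [DecidableEq V] {x : V} {m : V → C} {u : V} : extendAt f x m u x = m u := by
  by_cases h : u = x <;> simp [extendAt, h]

variable [DecidableEq V] [DecidableEq C]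

theorem mem_miss {c : C} {u : V} :
    u ∈ miss T f c ↔ u ∈ T ∧ ∀ v ∈ T, v ≠ u → f u v ≠ c := by
  simp [miss]

theorem miss_subset (c : C) : miss T f c ⊆ T := Finset.filter_subset _ _

theorem IsProper.exists_of_notMem_miss {c : C} {u : V} (hu : u ∈ T)
    (h : u ∉ miss T f c) : ∃ v ∈ T, v ≠ u ∧ f u v = c := by
  simpa [mem_miss, hu] using h

/-- The number of vertices of `T` seeing a given color is even. -/
theorem IsProper.even_card_sdiff_miss (hf : IsProper T f) (c : C) :
    Even (T \ miss T f c).card := by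
  have h : ∀ u, ∃ v, u ∈ T \ miss T f c → v ∈ T ∧ v ≠ u ∧ f u v = c := by
    intro u
    by_cases hu : u ∈ T \ miss T f c
    · obtain ⟨v, h1, h2, h3⟩ := IsProper.exists_of_notMem_miss (Finset.mem_sdiff.1 hu).1
        (Finset.mem_sdiff.1 hu).2
      exact ⟨v, fun _ => ⟨h1, h2, h3⟩⟩
    · exact ⟨u, fun h => absurd h hu⟩
  choose g hg using h
  have hmem : ∀ a ∈ T \ miss T f c, g a ∈ T \ miss T f c := by
    intro a ha
    obtain ⟨h1, h2, h3⟩ := hg a ha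
    refine Finset.mem_sdiff.2 ⟨h1, fun h => ?_⟩
    exact (mem_miss.1 h).2 a (Finset.mem_sdiff.1 ha).1 h2.symm (by rw [hf.1, h3])
  refine even_card_of_involution _ g hmem ?_ fun a ha => (hg a ha).2.1
  intro a ha
  obtain ⟨h1, h2, h3⟩ := hg a ha
  obtain ⟨h4, h5, h6⟩ := hg (g a) (hmem a ha)
  exact hf.2 (g a) h1 _ h4 _ (Finset.mem_sdiff.1 ha).1 h5.symm h2 (by rw [h6, hf.1, h3])

theorem IsProper.even_card_miss_add (hf : IsProper T f) (c : C) :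
    Even ((miss T f c).card + T.card) := by
  have h1 := hf.even_card_sdiff_miss c
  have h2 := Finset.card_sdiff_add_card_eq_card (miss_subset (T := T) (f := f) c)
  rw [Nat.even_iff] at *
  omega

/-- Every vertex of `T` misses the same number of colors. -/
theorem IsProper.card_missing_colors [Fintype C] (hf : IsProper T f) {u : V} (hu : u ∈ T) :
    (Finset.univ.filter fun c => u ∈ miss T f c).card + T.card = Fintype.card C + 1 := by
  have h1 : (Finset.univ.filter fun c => u ∈ miss T f c) = ((T.erase u).image (f u))ᶜ := by
    ext c
    simp only [Finset.mem_filter, Finset.mem_univ, true_and, mem_miss, hu, Finset.mem_compl,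
      Finset.mem_image, Finset.mem_erase, not_exists, not_and]
    exact ⟨fun h v hv => h v hv.2 hv.1, fun h v hv hvu => h v ⟨hvu, hv⟩⟩
  have h2 : ((T.erase u).image (f u)).card = T.card - 1 := by
    rw [Finset.card_image_of_injOn, Finset.card_erase_of_mem hu]
    intro v hv w hw hvw
    simp only [Finset.coe_erase, Set.mem_sdiff, Finset.mem_coe, Set.mem_singleton_iff] at hv hw
    exact hf.2 u hu v hv.1 w hw.1 (Ne.symm hv.2) (Ne.symm hw.2) hvw
  have h3 := Finset.card_compl_add_card ((T.erase u).image (f u))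
  have h4 : 0 < T.card := Finset.card_pos.2 ⟨u, hu⟩
  rw [h1]
  omega

theorem IsProper.exists_color_eq [Fintype V] [Fintype C] (hf : IsProper Finset.univ f)
    (hC : Fintype.card C + 1 = Fintype.card V) (u : V) (c : C) : ∃ v, v ≠ u ∧ f u v = c := by
  have h := hf.card_missing_colors (Finset.mem_univ u)
  rw [Finset.card_univ, hC] at h
  have h' : u ∉ miss Finset.univ f c := by
    intro hu
    have : c ∈ Finset.univ.filter fun c => u ∈ miss Finset.univ f c := by simpa using hu
    rw [Finset.card_eq_zero.1 (by omega : (Finset.univ.filter fun c =>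
      u ∈ miss Finset.univ f c).card = 0)] at this
    simp at this
  obtain ⟨v, -, hv⟩ := IsProper.exists_of_notMem_miss (Finset.mem_univ u) h'
  exact ⟨v, hv⟩

/-- Cruse's necessary condition. -/
theorem IsProper.card_miss_add_le [Fintype V] [Fintype C] (hf : IsProper Finset.univ f)
    (hC : Fintype.card C + 1 = Fintype.card V) (T : Finset V) (c : C) :
    (miss T f c).card + T.card ≤ Fintype.card V := by
  choose g hg using fun u => hf.exists_color_eq hC u c
  have hle : (miss T f c).card ≤ Tᶜ.card := by
    refine Finset.card_le_card_of_injOn g ?_ ?_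
    · intro u hu
      simp only [Finset.mem_coe, Finset.mem_compl]
      intro hgu
      exact (mem_miss.1 hu).2 _ hgu (hg u).1 (hg u).2
    · intro u hu v hv huv
      have h1 := hg u
      have h2 := hg v
      rw [← huv] at h2
      exact hf.2 (g u) (Finset.mem_univ _) u (Finset.mem_univ _) v (Finset.mem_univ _) h1.1 h2.1
        (by rw [hf.1, h1.2, hf.1, h2.2])
  have := Finset.card_compl_add_card T
  omega

theorem IsProper.insert_extendAt (hf : IsProper T f) {x : V} (hx : x ∉ T) {m : V → C}
    (hinj : Set.InjOn m T) (hm : ∀ u ∈ T, u ∈ miss T f (m u)) :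
    IsProper (insert x T) (extendAt f x m) := by
  have hne : ∀ u ∈ T, u ≠ x := fun u hu h => hx (h ▸ hu)
  refine ⟨fun u v => ?_, ?_⟩
  · by_cases hu : u = x
    · subst hu; rw [extendAt_left, extendAt_right]
    · by_cases hv : v = x
      · subst hv; rw [extendAt_left, extendAt_right]
      · rw [extendAt_of_ne hu hv, extendAt_of_ne hv hu, hf.1]
  · intro u hu v hv w hw huv huw h
    rcases Finset.mem_insert.1 hu with rfl | huT
    · rw [extendAt_left, extendAt_left] at h
      exact hinj ((Finset.mem_insert.1 hv).resolve_left huv.symm)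
        ((Finset.mem_insert.1 hw).resolve_left huw.symm) h
    · rcases Finset.mem_insert.1 hv with rfl | hvT <;> rcases Finset.mem_insert.1 hw with rfl | hwT
      · rfl
      · rw [extendAt_right, extendAt_of_ne (hne u huT) (hne w hwT)] at h
        exact absurd h.symm ((mem_miss.1 (hm u huT)).2 w hwT huw.symm)
      · rw [extendAt_right, extendAt_of_ne (hne u huT) (hne v hvT)] at h
        exact absurd h ((mem_miss.1 (hm u huT)).2 v hvT huv.symm)
      · rw [extendAt_of_ne (hne u huT) (hne v hvT), extendAt_of_ne (hne u huT) (hne w hwT)] at h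
        exact hf.2 u huT v hvT w hwT huv huw h

theorem miss_extendAt_subset {x : V} (hx : x ∉ T) {m : V → C} (c : C) :
    miss (insert x T) (extendAt f x m) c ⊆ insert x ((miss T f c).filter fun u => m u ≠ c) := by
  have hne : ∀ u ∈ T, u ≠ x := fun u hu h => hx (h ▸ hu)
  intro u hu
  rw [mem_miss] at hu
  rcases Finset.mem_insert.1 hu.1 with rfl | huT
  · exact Finset.mem_insert_self _ _
  · refine Finset.mem_insert_of_mem (Finset.mem_filter.2 ⟨mem_miss.2 ⟨huT, fun v hv hvu => ?_⟩, ?_⟩)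
    · rw [← extendAt_of_ne (f := f) (m := m) (hne u huT) (hne v hv)]
      exact hu.2 v (Finset.mem_insert_of_mem hv) hvu
    · have := hu.2 x (Finset.mem_insert_self _ _) (hne u huT).symm
      rwa [extendAt_right] at this

theorem notMem_miss_extendAt {x : V} (hx : x ∉ T) {m : V → C} {u : V} (hu : u ∈ T) :
    x ∉ miss (insert x T) (extendAt f x m) (m u) := by
  intro h
  refine (mem_miss.1 h).2 u (Finset.mem_insert_of_mem hu) (fun h => hx (h ▸ hu)) ?_
  rw [extendAt_left]

/-- Cruse's condition persists when a vertex is added so that all tight colors are used. -/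
theorem IsProper.card_miss_extendAt_add_le (hf : IsProper T f) {x : V} (hx : x ∉ T) {m : V → C}
    (hm : ∀ u ∈ T, u ∈ miss T f (m u)) {N : ℕ} (hN : Even N)
    (hle : ∀ c, (miss T f c).card + T.card ≤ N)
    (htight : ∀ c, (miss T f c).card + T.card = N → ∃ u ∈ T, m u = c) (c : C) :
    (miss (insert x T) (extendAt f x m) c).card + (insert x T).card ≤ N := by
  rw [Finset.card_insert_of_notMem hx]
  have hsub := miss_extendAt_subset (f := f) hx (m := m) c
  by_cases hc : ∃ u ∈ T, m u = c
  · obtain ⟨u, hu, rfl⟩ := hc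
    have h1 : miss (insert x T) (extendAt f x m) (m u) ⊆ (miss T f (m u)).erase u := by
      intro v hv
      rcases Finset.mem_insert.1 (hsub hv) with rfl | h
      · exact absurd hv (notMem_miss_extendAt hx hu)
      · rw [Finset.mem_filter] at h
        exact Finset.mem_erase.2 ⟨fun h' => h.2 (by rw [h']), h.1⟩
    have h2 := Finset.card_le_card h1
    rw [Finset.card_erase_of_mem (hm u hu)] at h2
    have h3 := hle (m u)
    have h4 : 0 < (miss T f (m u)).card := Finset.card_pos.2 ⟨u, hm u hu⟩
    omega
  · have h1 := (Finset.card_le_card hsub).trans (Finset.card_insert_le _ _)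
    have h2 := Finset.card_filter_le (miss T f c) fun u => m u ≠ c
    have h3 := hle c
    have h4 := hf.even_card_miss_add c
    have h5 : (miss T f c).card + T.card ≠ N := fun h => hc (htight c h)
    rw [Nat.even_iff] at h4 hN
    omega

theorem sum_ite_miss (T : Finset V) (f : V → V → C) (c : C) (r : ℝ) :
    ∑ u ∈ T, (if u ∈ miss T f c then r else 0) = (miss T f c).card * r := by
  rw [← Finset.sum_filter, Finset.sum_const, nsmul_eq_mul]
  congr 3
  ext u
  simp only [Finset.mem_filter]
  exact ⟨fun h => h.2, fun h => ⟨miss_subset c h, h⟩⟩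

variable [Fintype V] [Fintype C]

/-- Cruse's theorem for even order. -/
theorem IsProper.exists_extension (hC : Fintype.card C + 1 = Fintype.card V)
    (hV : Even (Fintype.card V)) (hf : IsProper T f)
    (hle : ∀ c, (miss T f c).card + T.card ≤ Fintype.card V) :
    ∃ g : V → V → C, IsProper Finset.univ g ∧ ∀ u ∈ T, ∀ v ∈ T, g u v = f u v := by
  induction hk : Tᶜ.card generalizing T f with
  | zero =>
    rw [Finset.card_eq_zero, Finset.compl_eq_empty_iff] at hk
    subst hk
    exact ⟨f, hf, fun _ _ _ _ => rfl⟩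
  | succ k ih =>
    obtain ⟨x, hx⟩ := Finset.card_pos.1 (by omega : 0 < Tᶜ.card)
    rw [Finset.mem_compl] at hx
    have hcT := Finset.card_compl_add_card T
    have : Nonempty C := by
      rw [← Fintype.card_pos_iff]
      rcases Nat.eq_zero_or_pos (Fintype.card C) with h | h
      · rw [← hC, h] at hV
        exact absurd hV (by decide)
      · exact h
    have hk0 : ((k + 1 : ℕ) : ℝ) ≠ 0 := by positivity
    obtain ⟨m, hinj, hm, ht, -⟩ := exists_matching_of_weights T
      (fun u c => if u ∈ miss T f c then ((k + 1 : ℕ) : ℝ)⁻¹ else 0)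
      (fun u _ c => by split_ifs <;> positivity)
      (fun u hu => by
        rw [← Finset.sum_filter, Finset.sum_const, nsmul_eq_mul]
        have := hf.card_missing_colors hu
        rw [show (Finset.univ.filter fun c => u ∈ miss T f c).card = k + 1 by omega]
        exact mul_inv_cancel₀ hk0)
      (fun c => by
        rw [sum_ite_miss, ← div_eq_mul_inv, div_le_one (by positivity)]
        have := hle c
        exact_mod_cast (by omega : (miss T f c).card ≤ k + 1))
      (fun _ _ => 0)
    have hm' : ∀ u ∈ T, u ∈ miss T f (m u) := by
      intro u hu
      have := hm u hu
      by_contra h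
      simp [h] at this
    have ht' : ∀ c, (miss T f c).card + T.card = Fintype.card V → ∃ u ∈ T, m u = c := by
      intro c hc
      apply ht
      rw [sum_ite_miss, show (miss T f c).card = k + 1 by omega]
      exact mul_inv_cancel₀ hk0
    obtain ⟨g, hg, hgf⟩ := ih (hf.insert_extendAt hx hinj hm')
      (hf.card_miss_extendAt_add_le hx hm' hV hle ht') (by
        have := Finset.card_compl_add_card (insert x T)
        rw [Finset.card_insert_of_notMem hx] at this
        omega)
    refine ⟨g, hg, fun u hu v hv => ?_⟩
    rw [hgf u (Finset.mem_insert_of_mem hu) v (Finset.mem_insert_of_mem hv),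
      extendAt_of_ne (by rintro rfl; exact hx hu) (by rintro rfl; exact hx hv)]

end

/-- The combinatorial features of the family of sets `miss T f c` that are used when a single
vertex is added: every vertex of `T` misses exactly `d` colors, and every color is missed by at
most `d` vertices. -/
structure MissSystem {V C : Type} [Fintype C] [DecidableEq V] [DecidableEq C] (T : Finset V)
    (M : C → Finset V) (d : ℕ) : Prop where
  sub : ∀ k, M k ⊆ T
  row : ∀ u ∈ T, (Finset.univ.filter fun k => u ∈ M k).card = d
  col : ∀ k, (M k).card ≤ d

/-- An obstruction to using the missing pair `(u, c)` without using `(u', c')`. -/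
structure IsObstruction {V C : Type} (T : Finset V) (M : C → Finset V) (d : ℕ)
    (u : V) (c : C) (u' : V) (c' : C) (A : Finset V) (Q : Finset C) : Prop where
  sub : A ⊆ T
  tight : ∀ k ∈ Q, (M k).card = d
  mem_left : u' ∈ A
  notMem_left : u ∉ A
  mem_right : c ∈ Q
  notMem_right : c' ∉ Q
  out : ∀ a ∈ A, ∀ k, a ∈ M k → k ∈ Q ∨ (a = u' ∧ k = c')
  inn : ∀ k ∈ Q, ∀ r ∈ M k, r ∈ A ∨ (r = u ∧ k = c)

section

variable {V C : Type} [Fintype C] [DecidableEq V] [DecidableEq C]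

/-- Missing pairs leaving the block `A × Q` through a row. -/
def outPairs (T : Finset V) (M : C → Finset V) (A : Finset V) (Q : Finset C) : Finset (V × C) :=
  (T ×ˢ Finset.univ).filter fun p => p.1 ∈ M p.2 ∧ p.1 ∈ A ∧ p.2 ∉ Q

/-- Missing pairs leaving the block `A × Q` through a column. -/
def innPairs (T : Finset V) (M : C → Finset V) (A : Finset V) (Q : Finset C) : Finset (V × C) :=
  (T ×ˢ Finset.univ).filter fun p => p.1 ∈ M p.2 ∧ p.1 ∉ A ∧ p.2 ∈ Q

variable {T : Finset V} {M : C → Finset V} {d : ℕ} {A : Finset V} {Q : Finset C}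

theorem MissSystem.mem_outPairs (hM : MissSystem T M d) {p : V × C} :
    p ∈ outPairs T M A Q ↔ p.1 ∈ M p.2 ∧ p.1 ∈ A ∧ p.2 ∉ Q := by
  simp only [outPairs, Finset.mem_filter, Finset.mem_product, Finset.mem_univ, and_true]
  exact ⟨fun h => h.2, fun h => ⟨hM.sub _ h.1, h⟩⟩

theorem MissSystem.mem_innPairs (hM : MissSystem T M d) {p : V × C} :
    p ∈ innPairs T M A Q ↔ p.1 ∈ M p.2 ∧ p.1 ∉ A ∧ p.2 ∈ Q := by
  simp only [innPairs, Finset.mem_filter, Finset.mem_product, Finset.mem_univ, and_true]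
  exact ⟨fun h => h.2, fun h => ⟨hM.sub _ h.1, h⟩⟩

theorem MissSystem.balance (hM : MissSystem T M d) (hA : A ⊆ T)
    (hQ : ∀ k ∈ Q, (M k).card = d) :
    d * A.card + (innPairs T M A Q).card = d * Q.card + (outPairs T M A Q).card := by
  set P := (T ×ˢ (Finset.univ : Finset C)).filter fun p => p.1 ∈ M p.2 with hP
  have h1 : (P.filter fun p => p.1 ∈ A).card = d * A.card := by
    have : (P.filter fun p => p.1 ∈ A).card =
        ∑ a ∈ A, ((P.filter fun p => p.1 ∈ A).filter fun p => p.1 = a).card :=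
      Finset.card_eq_sum_card_fiberwise fun p hp => (Finset.mem_filter.1 hp).2
    rw [this, Finset.sum_congr rfl (g := fun _ => d), Finset.sum_const, smul_eq_mul, mul_comm]
    intro a ha
    rw [← hM.row a (hA ha)]
    refine Finset.card_bij (fun p _ => p.2) ?_ ?_ ?_
    · intro p hp
      simp only [hP, Finset.mem_filter] at hp
      simp only [Finset.mem_filter, Finset.mem_univ, true_and]
      rw [← hp.2]; exact hp.1.1.2
    · intro p hp q hq h
      simp only [Finset.mem_filter] at hp hq
      exact Prod.ext (hp.2.trans hq.2.symm) h
    · intro k hk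
      simp only [Finset.mem_filter, Finset.mem_univ, true_and] at hk
      exact ⟨(a, k), by simp [hP, hk, ha, hA ha], rfl⟩
  have h2 : (P.filter fun p => p.2 ∈ Q).card = d * Q.card := by
    have : (P.filter fun p => p.2 ∈ Q).card =
        ∑ k ∈ Q, ((P.filter fun p => p.2 ∈ Q).filter fun p => p.2 = k).card :=
      Finset.card_eq_sum_card_fiberwise fun p hp => (Finset.mem_filter.1 hp).2
    rw [this, Finset.sum_congr rfl (g := fun _ => d), Finset.sum_const, smul_eq_mul, mul_comm]
    intro k hk
    rw [← hQ k hk]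
    refine Finset.card_bij (fun p _ => p.1) ?_ ?_ ?_
    · intro p hp
      simp only [hP, Finset.mem_filter] at hp
      rw [← hp.2]; exact hp.1.1.2
    · intro p hp q hq h
      simp only [Finset.mem_filter] at hp hq
      exact Prod.ext h (hp.2.trans hq.2.symm)
    · intro a ha
      exact ⟨(a, k), by simp [hP, hk, ha, hM.sub k ha], rfl⟩
  have h3 := Finset.card_filter_add_card_filter_not (s := P.filter fun p => p.1 ∈ A)
    (fun p => p.2 ∈ Q)
  have h4 := Finset.card_filter_add_card_filter_not (s := P.filter fun p => p.2 ∈ Q)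
    (fun p => p.1 ∈ A)
  have h5 : (P.filter fun p => p.1 ∈ A).filter (fun p => p.2 ∉ Q) = outPairs T M A Q := by
    rw [hP, Finset.filter_filter, Finset.filter_filter]; rfl
  have h6 : (P.filter fun p => p.2 ∈ Q).filter (fun p => p.1 ∉ A) = innPairs T M A Q := by
    rw [hP, Finset.filter_filter, Finset.filter_filter]
    exact Finset.filter_congr fun p _ => and_congr_right fun _ => and_comm
  have h7 : (P.filter fun p => p.2 ∈ Q).filter (fun p => p.1 ∈ A) =
      (P.filter fun p => p.1 ∈ A).filter (fun p => p.2 ∈ Q) := Finset.filter_comm _ _ _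
  rw [h5] at h3
  rw [h6, h7] at h4
  omega

theorem MissSystem.balance_eq (hM : MissSystem T M d) (hA : A ⊆ T)
    (hQ : ∀ k ∈ Q, (M k).card = d)
    (h1 : (outPairs T M A Q).card < (innPairs T M A Q).card + d)
    (h2 : (innPairs T M A Q).card < (outPairs T M A Q).card + d) :
    (outPairs T M A Q).card = (innPairs T M A Q).card := by
  have h := hM.balance hA hQ
  rcases lt_trichotomy A.card Q.card with h3 | h3 | h3
  · nlinarith [Nat.mul_le_mul_left d (Nat.succ_le_of_lt h3)]
  · rw [h3] at h; omega
  · nlinarith [Nat.mul_le_mul_left d (Nat.succ_le_of_lt h3)]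

/-- Adjacency of rows and columns through missing pairs other than two given ones. -/
def pairAdj (M : C → Finset V) (u : V) (c : C) (u' : V) (c' : C) : V ⊕ C → V ⊕ C → Prop
  | .inl r, .inr k => r ∈ M k ∧ (r, k) ≠ (u, c) ∧ (r, k) ≠ (u', c')
  | .inr k, .inl r => r ∈ M k ∧ (r, k) ≠ (u, c) ∧ (r, k) ≠ (u', c')
  | _, _ => False

/-- The boundary of a weighting of missing pairs. -/
def boundary (T : Finset V) (E : V → C → ℝ) : V ⊕ C → ℝ
  | .inl r => ∑ k, E r k
  | .inr k => -∑ r ∈ T, E r k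

theorem boundary_add (E F : V → C → ℝ) (x : V ⊕ C) :
    boundary T (fun r k => E r k + F r k) x = boundary T E x + boundary T F x := by
  rcases x with r | k <;> simp [boundary, Finset.sum_add_distrib]; ring

theorem boundary_neg (E : V → C → ℝ) (x : V ⊕ C) :
    boundary T (fun r k => - E r k) x = - boundary T E x := by
  rcases x with r | k <;> simp [boundary]

/-- The weighting concentrated at one pair. -/
def unitAt (u : V) (c : C) (r : V) (k : C) : ℝ := if r = u ∧ k = c then 1 else 0

theorem boundary_unitAt {u : V} (hu : u ∈ T) (c : C) (x : V ⊕ C) :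
    boundary T (unitAt u c) x =
      (if x = .inl u then 1 else 0) - (if x = .inr c then 1 else 0) := by
  rcases x with r | k
  · by_cases h : r = u <;> simp [boundary, unitAt, h]
  · by_cases h : k = c <;> simp [boundary, unitAt, h, hu]

theorem exists_flow_of_reachable (hM : MissSystem T M d) {u u' : V} {c c' : C} {x y : V ⊕ C}
    (h : Relation.ReflTransGen (pairAdj M u c u' c') x y) :
    ∃ E : V → C → ℝ, (∀ r k, E r k ≠ 0 → r ∈ M k ∧ (r, k) ≠ (u, c) ∧ (r, k) ≠ (u', c')) ∧
      ∀ z, boundary T E z = (if z = y then 1 else 0) - (if z = x then 1 else 0) := by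
  induction h with
  | refl =>
    refine ⟨fun _ _ => 0, fun _ _ h => absurd rfl h, fun z => ?_⟩
    rcases z with r | k <;> simp [boundary]
  | @tail y z _ hyz ih =>
    obtain ⟨E, hE, hb⟩ := ih
    rcases y with r | k <;> rcases z with r' | k' <;> try exact absurd hyz id
    · refine ⟨fun a b => E a b + - unitAt r k' a b, fun a b hab => ?_, fun z => ?_⟩
      · by_cases h : a = r ∧ b = k'
        · rw [h.1, h.2]; exact hyz
        · exact hE a b (by simpa [unitAt, h] using hab)
      · rw [boundary_add E (fun a b => - unitAt r k' a b), boundary_neg, hb,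
          boundary_unitAt (hM.sub _ hyz.1)]
        ring
    · refine ⟨fun a b => E a b + unitAt r' k a b, fun a b hab => ?_, fun z => ?_⟩
      · by_cases h : a = r' ∧ b = k
        · rw [h.1, h.2]; exact hyz
        · exact hE a b (by simpa [unitAt, h] using hab)
      · rw [boundary_add E (unitAt r' k), hb, boundary_unitAt (hM.sub _ hyz.1)]
        ring

theorem pair_card_le_two (p q : V × C) {s : Finset (V × C)} (h : s ⊆ {p, q}) : s.card ≤ 2 :=
  (Finset.card_le_card h).trans Finset.card_le_two

/-- If there is no obstruction, there is a perturbation of the uniform weighting of missing pairs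
that separates `(u, c)` from `(u', c')`. -/
theorem MissSystem.exists_perturbation (hM : MissSystem T M d) (hd : 3 ≤ d) {u u' : V} {c c' : C}
    (hu : u ∈ M c) (huu : u ≠ u')
    (h1 : ∀ A Q, ¬ IsObstruction T M d u c u' c' A Q)
    (h2 : ∀ A Q, ¬ IsObstruction T M d u' c' u c A Q) :
    ∃ E : V → C → ℝ, (∀ r k, E r k ≠ 0 → r ∈ M k) ∧ (∀ r ∈ T, ∑ k, E r k = 0) ∧
      (∀ k, (M k).card = d → ∑ r ∈ T, E r k = 0) ∧ E u' c' < E u c := by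
  classical
  set R := Relation.ReflTransGen (pairAdj M u c u' c')
  have huT := hM.sub _ hu
  have main : ∀ E : V → C → ℝ, (∀ r k, E r k ≠ 0 → r ∈ M k ∧ (r, k) ≠ (u, c) ∧
      (r, k) ≠ (u', c')) → (∀ r, boundary T (fun a b => unitAt u c a b + E a b) (.inl r) = 0) →
      (∀ k, (M k).card = d → boundary T (fun a b => unitAt u c a b + E a b) (.inr k) = 0) →
      ∃ E : V → C → ℝ, (∀ r k, E r k ≠ 0 → r ∈ M k) ∧ (∀ r ∈ T, ∑ k, E r k = 0) ∧
      (∀ k, (M k).card = d → ∑ r ∈ T, E r k = 0) ∧ E u' c' < E u c := by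
    intro E hE hr hk
    refine ⟨fun a b => unitAt u c a b + E a b, fun r k h => ?_, fun r _ => hr r, fun k h => ?_, ?_⟩
    · by_cases hrk : r = u ∧ k = c
      · rw [hrk.1, hrk.2]; exact hu
      · exact (hE r k (by simpa [unitAt, hrk] using h)).1
    · have := hk k h
      simpa [boundary] using this
    · have e1 : E u c = 0 := by
        by_contra h; exact (hE _ _ h).2.1 rfl
      have e2 : E u' c' = 0 := by
        by_contra h; exact (hE _ _ h).2.2 rfl
      simp [e1, e2, unitAt, huu.symm]
  by_cases huc : R (.inl u) (.inr c)
  · obtain ⟨E, hE, hb⟩ := exists_flow_of_reachable hM huc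
    refine main E hE (fun r => ?_) (fun k _ => ?_) <;>
    · rw [boundary_add (unitAt u c) E, boundary_unitAt huT, hb]; ring
  by_cases hcu : R (.inr c) (.inl u)
  · obtain ⟨E, hE, hb⟩ := exists_flow_of_reachable hM hcu
    refine main (fun a b => - E a b) (fun r k h => hE r k (by simpa using h))
      (fun r => ?_) (fun k _ => ?_) <;>
    · rw [boundary_add (unitAt u c) (fun a b => - E a b), boundary_neg, boundary_unitAt huT, hb]
      simp
  have step : ∀ {x y z}, R x y → pairAdj M u c u' c' y z → R x z := fun h h' => h.tail h'
  by_cases hk1 : ∃ k, R (.inl u) (.inr k) ∧ (M k).card ≠ d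
  · by_cases hk2 : ∃ k, R (.inr c) (.inr k) ∧ (M k).card ≠ d
    · obtain ⟨k1, hr1, ht1⟩ := hk1
      obtain ⟨k2, hr2, ht2⟩ := hk2
      obtain ⟨E, hE, hb⟩ := exists_flow_of_reachable hM hr1
      obtain ⟨F, hF, hb'⟩ := exists_flow_of_reachable hM hr2
      refine main (fun a b => E a b + - F a b) (fun r k h => ?_) (fun r => ?_) (fun k hk => ?_)
      · by_cases h' : E r k = 0
        · exact hF r k (fun h'' => h (by simp [h', h'']))
        · exact hE r k h'
      · rw [boundary_add (unitAt u c) (fun a b => E a b + - F a b),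
          boundary_add E (fun a b => - F a b), boundary_neg, boundary_unitAt huT, hb, hb']
        simp
      · rw [boundary_add (unitAt u c) (fun a b => E a b + - F a b),
          boundary_add E (fun a b => - F a b), boundary_neg, boundary_unitAt huT, hb, hb']
        have n1 : k ≠ k1 := by rintro rfl; exact ht1 hk
        have n2 : k ≠ k2 := by rintro rfl; exact ht2 hk
        simp [n1, n2]
    · push Not at hk2
      exfalso
      set A := T.filter fun r => R (.inr c) (.inl r) with hA
      set Q := Finset.univ.filter fun k => R (.inr c) (.inr k) with hQ
      have hout : ∀ a ∈ A, ∀ k, a ∈ M k → k ∉ Q → a = u' ∧ k = c' := by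
        intro a ha k hak hk
        by_contra hne
        refine hk (Finset.mem_filter.2 ⟨Finset.mem_univ _, step (Finset.mem_filter.1 ha).2 ?_⟩)
        refine ⟨hak, fun h => ?_, fun h => hne (by simpa using h)⟩
        rw [Prod.mk.injEq] at h
        exact hcu (h.1 ▸ (Finset.mem_filter.1 ha).2)
      have hinn : ∀ k ∈ Q, ∀ r ∈ M k, r ∉ A → (r = u ∧ k = c) ∨ (r = u' ∧ k = c') := by
        intro k hk r hrk hr
        by_contra! hne
        refine hr (Finset.mem_filter.2 ⟨hM.sub _ hrk, step (Finset.mem_filter.1 hk).2 ?_⟩)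
        exact ⟨hrk, fun h => by simp at h; exact hne.1 h.1 h.2,
          fun h => by simp at h; exact hne.2 h.1 h.2⟩
      have hcQ : c ∈ Q := Finset.mem_filter.2 ⟨Finset.mem_univ _, Relation.ReflTransGen.refl⟩
      have huA : u ∉ A := fun h => hcu (Finset.mem_filter.1 h).2
      have hout' : outPairs T M A Q ⊆ {(u', c')} := by
        intro p hp
        rw [hM.mem_outPairs] at hp
        have := hout _ hp.2.1 _ hp.1 hp.2.2
        simp [Prod.ext_iff, this]
      have hinn' : innPairs T M A Q ⊆ {(u, c), (u', c')} := by
        intro p hp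
        rw [hM.mem_innPairs] at hp
        have := hinn _ hp.2.2 _ hp.1 hp.2.1
        simpa [Prod.ext_iff] using this
      have hj : (u, c) ∈ innPairs T M A Q := hM.mem_innPairs.2 ⟨hu, huA, hcQ⟩
      have c1 := Finset.card_le_card hout'
      have c2 := pair_card_le_two _ _ hinn'
      have c3 : 0 < (innPairs T M A Q).card := Finset.card_pos.2 ⟨_, hj⟩
      rw [Finset.card_singleton] at c1
      have heq := hM.balance_eq (A := A) (Q := Q) (Finset.filter_subset _ _)
        (fun k hk => hk2 k (Finset.mem_filter.1 hk).2) (by omega) (by omega)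
      obtain ⟨p, hp⟩ := Finset.card_pos.1 (heq ▸ c3)
      have hp' := Finset.mem_singleton.1 (hout' hp)
      subst hp'
      rw [hM.mem_outPairs] at hp
      refine h1 A Q ⟨Finset.filter_subset _ _, fun k hk => hk2 k (Finset.mem_filter.1 hk).2,
        hp.2.1, huA, hcQ, hp.2.2, fun a ha k hak => ?_, fun k hk r hr => ?_⟩
      · by_cases hk : k ∈ Q
        · exact Or.inl hk
        · exact Or.inr (hout a ha k hak hk)
      · by_cases hrA : r ∈ A
        · exact Or.inl hrA
        · refine Or.inr ((hinn k hk r hr hrA).resolve_right fun h => hp.2.2 (h.2 ▸ hk))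
  · push Not at hk1
    exfalso
    set A := T.filter fun r => R (.inl u) (.inl r) with hA
    set Q := Finset.univ.filter fun k => R (.inl u) (.inr k) with hQ
    have huA : u ∈ A := Finset.mem_filter.2 ⟨huT, Relation.ReflTransGen.refl⟩
    have hcQ : c ∉ Q := fun h => huc (Finset.mem_filter.1 h).2
    have hout : ∀ a ∈ A, ∀ k, a ∈ M k → k ∉ Q → (a = u ∧ k = c) ∨ (a = u' ∧ k = c') := by
      intro a ha k hak hk
      by_contra! hne
      refine hk (Finset.mem_filter.2 ⟨Finset.mem_univ _, step (Finset.mem_filter.1 ha).2 ?_⟩)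
      exact ⟨hak, fun h => by simp at h; exact hne.1 h.1 h.2,
        fun h => by simp at h; exact hne.2 h.1 h.2⟩
    have hinn : ∀ k ∈ Q, ∀ r ∈ M k, r ∉ A → r = u' ∧ k = c' := by
      intro k hk r hrk hr
      by_contra hne
      refine hr (Finset.mem_filter.2 ⟨hM.sub _ hrk, step (Finset.mem_filter.1 hk).2 ?_⟩)
      refine ⟨hrk, fun h => ?_, fun h => hne (by simpa using h)⟩
      rw [Prod.mk.injEq] at h
      exact hr (h.1 ▸ huA)
    have hout' : outPairs T M A Q ⊆ {(u, c), (u', c')} := by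
      intro p hp
      rw [hM.mem_outPairs] at hp
      have := hout _ hp.2.1 _ hp.1 hp.2.2
      simpa [Prod.ext_iff] using this
    have hinn' : innPairs T M A Q ⊆ {(u', c')} := by
      intro p hp
      rw [hM.mem_innPairs] at hp
      have := hinn _ hp.2.2 _ hp.1 hp.2.1
      simp [Prod.ext_iff, this]
    have hj : (u, c) ∈ outPairs T M A Q := hM.mem_outPairs.2 ⟨hu, huA, hcQ⟩
    have c1 := pair_card_le_two _ _ hout'
    have c2 := Finset.card_le_card hinn'
    have c3 : 0 < (outPairs T M A Q).card := Finset.card_pos.2 ⟨_, hj⟩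
    rw [Finset.card_singleton] at c2
    have heq := hM.balance_eq (A := A) (Q := Q) (Finset.filter_subset _ _)
      (fun k hk => hk1 k (Finset.mem_filter.1 hk).2) (by omega) (by omega)
    obtain ⟨p, hp⟩ := Finset.card_pos.1 (heq ▸ c3)
    have hp' := Finset.mem_singleton.1 (hinn' hp)
    subst hp'
    rw [hM.mem_innPairs] at hp
    refine h2 A Q ⟨Finset.filter_subset _ _, fun k hk => hk1 k (Finset.mem_filter.1 hk).2,
      huA, hp.2.1, hp.2.2, hcQ, fun a ha k hak => ?_, fun k hk r hr => ?_⟩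
    · by_cases hk : k ∈ Q
      · exact Or.inl hk
      · exact Or.inr ((hout a ha k hak hk).resolve_right fun h => hp.2.1 (h.1 ▸ ha))
    · by_cases hrA : r ∈ A
      · exact Or.inl hrA
      · exact Or.inr (hinn k hk r hr hrA)

/-- Without obstructions, a vertex can be added so that `u` uses `c` and `u'` avoids `c'`. -/
theorem MissSystem.exists_separating_matching [Nonempty C] (hM : MissSystem T M d) (hd : 3 ≤ d)
    {u u' : V} {c c' : C} (hu : u ∈ M c) (hu' : u' ∈ M c') (huu : u ≠ u')
    (h1 : ∀ A Q, ¬ IsObstruction T M d u c u' c' A Q)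
    (h2 : ∀ A Q, ¬ IsObstruction T M d u' c' u c A Q) :
    ∃ m : V → C, Set.InjOn m T ∧ (∀ r ∈ T, r ∈ M (m r)) ∧
      (∀ k, (M k).card = d → ∃ r ∈ T, m r = k) ∧ m u = c ∧ m u' ≠ c' := by
  obtain ⟨E, hE, hr, hk, hlt⟩ := hM.exists_perturbation hd hu huu h1 h2
  have huT := hM.sub _ hu
  have huT' := hM.sub _ hu'
  have hd0 : (0 : ℝ) < d := by exact_mod_cast (by omega : 0 < d)
  set B : ℝ := 1 + ∑ r ∈ T, ∑ k, |E r k| with hB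
  have hB0 : 0 < B := by positivity
  have hEB : ∀ r ∈ T, ∀ k, |E r k| ≤ B := by
    intro r hrT k
    have e1 : |E r k| ≤ ∑ k, |E r k| :=
      Finset.single_le_sum (f := fun k => |E r k|) (fun _ _ => abs_nonneg _) (Finset.mem_univ k)
    have e2 : ∑ k, |E r k| ≤ ∑ r ∈ T, ∑ k, |E r k| :=
      Finset.single_le_sum (f := fun r => ∑ k, |E r k|)
        (fun _ _ => Finset.sum_nonneg fun _ _ => abs_nonneg _) hrT
    linarith
  have hEk : ∀ k, |∑ r ∈ T, E r k| ≤ B := by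
    intro k
    have e1 : |∑ r ∈ T, E r k| ≤ ∑ r ∈ T, |E r k| := Finset.abs_sum_le_sum_abs _ _
    have e2 : ∑ r ∈ T, |E r k| ≤ ∑ r ∈ T, ∑ k, |E r k| := Finset.sum_le_sum fun r _ =>
      Finset.single_le_sum (f := fun k => |E r k|) (fun _ _ => abs_nonneg _) (Finset.mem_univ k)
    linarith
  set ε : ℝ := 1 / (d * B) with hε
  have hε0 : 0 < ε := by positivity
  have hεB : ε * B = 1 / d := by rw [hε]; field_simp
  set w : V → C → ℝ := fun r k => (if r ∈ M k then 1 / (d : ℝ) else 0) + ε * E r k with hw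
  have hcolsum : ∀ k, ∑ r ∈ T, w r k = (M k).card / d + ε * ∑ r ∈ T, E r k := by
    intro k
    simp only [hw]
    rw [Finset.sum_add_distrib, ← Finset.mul_sum, ← Finset.sum_filter, Finset.sum_const]
    have : T.filter (fun r => r ∈ M k) = M k := by
      ext r; simp only [Finset.mem_filter]; exact ⟨fun h => h.2, fun h => ⟨hM.sub k h, h⟩⟩
    rw [this]; simp [div_eq_mul_inv]
  set L : V → C → ℝ := fun r k => unitAt u c r k - unitAt u' c' r k with hL
  have hLsum : ∀ g : V → C → ℝ, ∑ r ∈ T, ∑ k, L r k * g r k = g u c - g u' c' := by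
    intro g
    have e : ∀ (a : V) (b : C), a ∈ T → ∑ r ∈ T, ∑ k, unitAt a b r k * g r k = g a b := by
      intro a b ha
      rw [Finset.sum_eq_single_of_mem a ha, Finset.sum_eq_single_of_mem b (Finset.mem_univ b)]
      · simp [unitAt]
      · intro k _ hk; simp [unitAt, hk]
      · intro r _ hr; simp [unitAt, hr]
    simp only [hL, sub_mul, Finset.sum_sub_distrib, e u c huT, e u' c' huT']
  have hmiss : ∀ r k, r ∉ M k → E r k = 0 := by
    intro r k h
    by_contra h'
    exact h (hE r k h')
  obtain ⟨m, hinj, hpos, hcov, hle⟩ := exists_matching_of_weights T w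
    (fun r hrT k => by
      by_cases hm : r ∈ M k
      · have := neg_le_of_abs_le (hEB r hrT k)
        simp only [hw, hm, if_true]
        have : ε * -B ≤ ε * E r k := mul_le_mul_of_nonneg_left this hε0.le
        linarith
      · simp [hw, hm, hmiss r k hm])
    (fun r hrT => by
      simp only [hw]
      rw [Finset.sum_add_distrib, ← Finset.mul_sum, hr r hrT, ← Finset.sum_filter,
        Finset.sum_const, hM.row r hrT]
      simp [hd0.ne'])
    (fun k => by
      rw [hcolsum]
      by_cases ht : (M k).card = d
      · rw [hk k ht, ht]; simp [hd0.ne']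
      · have h3 : (M k).card + 1 ≤ d := by have := hM.col k; omega
        have h4 : ((M k).card : ℝ) + 1 ≤ d := by exact_mod_cast h3
        have h5 : ε * ∑ r ∈ T, E r k ≤ ε * B :=
          mul_le_mul_of_nonneg_left (le_of_abs_le (hEk k)) hε0.le
        calc ((M k).card : ℝ) / d + ε * ∑ r ∈ T, E r k ≤ (M k).card / d + 1 / d := by linarith
          _ = ((M k).card + 1) / d := by ring
          _ ≤ 1 := by rw [div_le_one hd0]; exact h4) L
  have hval : 0 < ∑ r ∈ T, L r (m r) := by
    refine lt_of_lt_of_le ?_ hle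
    rw [hLsum]
    simp only [hw, hu, hu', if_true]
    have := mul_lt_mul_of_pos_left hlt hε0
    linarith
  have hval' : ∑ r ∈ T, L r (m r) =
      (if m u = c then 1 else 0) - (if m u' = c' then (1 : ℝ) else 0) := by
    simp only [hL, Finset.sum_sub_distrib]
    congr 1
    · rw [Finset.sum_eq_single_of_mem u huT fun r _ hr => by simp [unitAt, hr]]
      simp [unitAt]
    · rw [Finset.sum_eq_single_of_mem u' huT' fun r _ hr => by simp [unitAt, hr]]
      simp [unitAt]
  rw [hval'] at hval
  refine ⟨m, hinj, fun r hrT => ?_, fun k hkt => hcov k ?_, ?_, ?_⟩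
  · by_contra h
    have := hpos r hrT
    simp [hw, h, hmiss r _ h] at this
  · rw [hcolsum, hk k hkt, hkt]; simp [hd0.ne']
  · by_contra h
    rw [if_neg h] at hval
    split_ifs at hval <;> linarith
  · intro h
    rw [if_pos h] at hval
    split_ifs at hval <;> linarith

end

section

variable {V C : Type} [Fintype C] [DecidableEq V] [DecidableEq C] {T : Finset V}
  {M M' : C → Finset V} {d : ℕ} {A A' S : Finset V} {Q Q' : Finset C} {u u' : V} {c c' q γ : C}

/-- The effect on the missing sets of swapping the colors `q` and `γ` on the vertex set `S`. -/
def IsKempeChange (M M' : C → Finset V) (q γ : C) (S : Finset V) : Prop :=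
  ∀ k r, r ∈ M' k ↔ if r ∈ S then r ∈ M (Equiv.swap q γ k) else r ∈ M k

theorem IsKempeChange.of_ne (h : IsKempeChange M M' q γ S) {k : C} (h1 : k ≠ q) (h2 : k ≠ γ)
    (r : V) : r ∈ M' k ↔ r ∈ M k := by
  rw [h k r, Equiv.swap_apply_of_ne_of_ne h1 h2, ite_self]

theorem IsKempeChange.left (h : IsKempeChange M M' q γ S) (r : V) :
    r ∈ M' q ↔ if r ∈ S then r ∈ M γ else r ∈ M q := by
  rw [h q r, Equiv.swap_apply_left]

theorem IsKempeChange.right (h : IsKempeChange M M' q γ S) (r : V) :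
    r ∈ M' γ ↔ if r ∈ S then r ∈ M q else r ∈ M γ := by
  rw [h γ r, Equiv.swap_apply_right]

theorem IsKempeChange.card_left (h : IsKempeChange M M' q γ S) :
    (M' q).card + (S ∩ M q).card = (M q).card + (S ∩ M γ).card := by
  have e : M' q = (M q \ S) ∪ (S ∩ M γ) := by
    ext r; rw [h.left r]
    by_cases hr : r ∈ S <;> simp [hr]
  rw [e, Finset.card_union_of_disjoint, Finset.inter_comm S (M q)]
  · have := Finset.card_sdiff_add_card_inter (M q) S
    omega
  · exact Finset.disjoint_left.2 fun r h1 h2 =>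
      (Finset.mem_sdiff.1 h1).2 (Finset.mem_inter.1 h2).1

theorem IsKempeChange.card_right (h : IsKempeChange M M' q γ S) :
    (M' γ).card + (S ∩ M γ).card = (M γ).card + (S ∩ M q).card := by
  have h' : IsKempeChange M M' γ q S := fun k r => by rw [h k r, Equiv.swap_comm]
  exact h'.card_left

theorem IsObstruction.eq_or (hM : IsObstruction T M d u c u' c' A Q) (hq : q ∈ Q) (hqc : q ≠ c)
    {r : V} (hr : r ∈ M q) : r ∈ A :=
  (hM.inn q hq r hr).resolve_right fun h => hqc h.2

/-- A Kempe change destroys a minimal obstruction without creating one of the same type. -/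
theorem IsObstruction.not_of_kempeChange (hM : MissSystem T M d) (hd : 3 ≤ d)
    (hu : u ∈ M c) (hu' : u' ∈ M c') (hobs : IsObstruction T M d u c u' c' A Q)
    (hmin : ∀ A' Q', IsObstruction T M d u c u' c' A' Q' → A.card + Q.card ≤ A'.card + Q'.card)
    (hq : q ∈ Q) (hqc : q ≠ c) (hγ : (M γ).card < d) (hγc : γ ≠ c')
    (hS : IsKempeChange M M' q γ S) (hSne : (S ∩ M q).Nonempty)
    (hScard : (S ∩ M q).card + (S ∩ M γ).card = 2) :
    ¬ IsObstruction T M' d u c u' c' A' Q' := by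
  intro hobs'
  have hγQ : γ ∉ Q := fun h => hγ.ne (hobs.tight γ h)
  have hqc' : q ≠ c' := fun h => hobs.notMem_right (h ▸ hq)
  have hout : outPairs T M (A ∩ A') (Q ∩ Q') ⊆
      insert (u', c') (((S ∩ M q).filter fun x => x ∈ A' ∧ q ∉ Q').image fun x => (x, q)) := by
    intro p hp
    obtain ⟨r, k⟩ := p
    obtain ⟨h1, h2, h3⟩ := hM.mem_outPairs.1 hp
    simp only [Finset.mem_inter, not_and] at h1 h2 h3
    by_cases hk : k ∈ Q
    · have hkQ' := h3 hk
      by_cases hkq : k = q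
      · subst hkq
        by_cases hrS : r ∈ S
        · refine Finset.mem_insert_of_mem (Finset.mem_image.2 ⟨r, ?_, rfl⟩)
          simp [hrS, h1, h2.2, hkQ']
        · exact absurd (hobs'.out r h2.2 k ((hS.left r).2 (by simpa [hrS] using h1)))
            (by simp [hkQ', hqc'])
      · have hkγ : k ≠ γ := fun h => hγQ (h ▸ hk)
        rcases hobs'.out r h2.2 k ((hS.of_ne hkq hkγ r).2 h1) with h | h
        · exact absurd h hkQ'
        · exact absurd (h.2 ▸ hk) hobs.notMem_right
    · rcases hobs.out r h2.1 k h1 with h | h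
      · exact absurd h hk
      · simp [h]
  have hinn : γ ∉ Q' → innPairs T M (A ∩ A') (Q ∩ Q') ⊆
      insert (u, c) (((S ∩ M q).filter fun _ => q ∈ Q').image fun x => (x, q)) := by
    intro hγQ' p hp
    obtain ⟨r, k⟩ := p
    obtain ⟨h1, h2, h3⟩ := hM.mem_innPairs.1 hp
    simp only [Finset.mem_inter, not_and] at h1 h2 h3
    by_cases hr : r ∈ A
    · have hrA' := h2 hr
      by_cases hkq : k = q
      · subst hkq
        by_cases hrS : r ∈ S
        · refine Finset.mem_insert_of_mem (Finset.mem_image.2 ⟨r, ?_, rfl⟩)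
          simp [hrS, h1, h3.2]
        · exact absurd (hobs'.inn k h3.2 r ((hS.left r).2 (by simpa [hrS] using h1)))
            (by simp [hrA', hqc])
      · have hkγ : k ≠ γ := fun h => hγQ (h ▸ h3.1)
        rcases hobs'.inn k h3.2 r ((hS.of_ne hkq hkγ r).2 h1) with h | h
        · exact absurd h hrA'
        · exact absurd (h.1 ▸ hr) hobs.notMem_left
    · rcases hobs.inn k h3.1 r h1 with h | h
      · exact absurd h hr
      · simp [h]
  have hjo : (u', c') ∈ outPairs T M (A ∩ A') (Q ∩ Q') := hM.mem_outPairs.2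
    ⟨hu', Finset.mem_inter.2 ⟨hobs.mem_left, hobs'.mem_left⟩,
      fun h => hobs.notMem_right (Finset.mem_inter.1 h).1⟩
  have hji : (u, c) ∈ innPairs T M (A ∩ A') (Q ∩ Q') := hM.mem_innPairs.2
    ⟨hu, fun h => hobs.notMem_left (Finset.mem_inter.1 h).1,
      Finset.mem_inter.2 ⟨hobs.mem_right, hobs'.mem_right⟩⟩
  have hco := Finset.card_pos.2 ⟨_, hjo⟩
  have hci := Finset.card_pos.2 ⟨_, hji⟩
  have hSpos := Finset.card_pos.2 hSne
  have hAsub : A ∩ A' ⊆ T := Finset.inter_subset_left.trans hobs.sub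
  have hQt : ∀ k ∈ Q ∩ Q', (M k).card = d := fun k hk => hobs.tight k (Finset.mem_inter.1 hk).1
  have finish : (outPairs T M (A ∩ A') (Q ∩ Q')).card = 1 →
      (innPairs T M (A ∩ A') (Q ∩ Q')).card = 1 →
      (A ⊆ A' ∧ Q ⊆ Q') := by
    intro ho hi
    have h := hmin (A ∩ A') (Q ∩ Q') ⟨hAsub, hQt,
      Finset.mem_inter.2 ⟨hobs.mem_left, hobs'.mem_left⟩,
      fun h => hobs.notMem_left (Finset.mem_inter.1 h).1,
      Finset.mem_inter.2 ⟨hobs.mem_right, hobs'.mem_right⟩,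
      fun h => hobs.notMem_right (Finset.mem_inter.1 h).1, fun a ha k hak => by
        by_cases hk : k ∈ Q ∩ Q'
        · exact Or.inl hk
        · have := Finset.card_le_one.1 ho.le (a, k) (hM.mem_outPairs.2 ⟨hak, ha, hk⟩) _ hjo
          exact Or.inr (by simpa using this), fun k hk r hr => by
        by_cases hrA : r ∈ A ∩ A'
        · exact Or.inl hrA
        · have := Finset.card_le_one.1 hi.le (r, k) (hM.mem_innPairs.2 ⟨hr, hrA, hk⟩) _ hji
          exact Or.inr (by simpa using this)⟩
    have h1 := Finset.card_le_card (Finset.inter_subset_left (s₁ := A) (s₂ := A'))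
    have h2 := Finset.card_le_card (Finset.inter_subset_left (s₁ := Q) (s₂ := Q'))
    exact ⟨Finset.inter_eq_left.1 (Finset.eq_of_subset_of_card_le Finset.inter_subset_left
      (by omega)), Finset.inter_eq_left.1 (Finset.eq_of_subset_of_card_le
      Finset.inter_subset_left (by omega))⟩
  have hcard1 := Finset.card_le_card hout
  rcases (by omega : (S ∩ M q).card = 1 ∨ (S ∩ M q).card = 2) with h1 | h2
  · have hγQ' : γ ∉ Q' := fun h => by
      have := hobs'.tight γ h
      have := hS.card_right
      omega
    obtain ⟨a, ha⟩ := hSne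
    obtain ⟨haS, haq⟩ := Finset.mem_inter.1 ha
    have haA' : ∀ x ∈ S ∩ M q, x ∉ A' := fun x hx h => by
      obtain ⟨hxS, hxq⟩ := Finset.mem_inter.1 hx
      rcases hobs'.out x h γ ((hS.right x).2 (by simpa [hxS] using hxq)) with h | h
      · exact hγQ' h
      · exact hγc h.2
    have hempty : (S ∩ M q).filter (fun x => x ∈ A' ∧ q ∉ Q') = ∅ :=
      Finset.filter_eq_empty_iff.2 fun x hx h => haA' x hx h.1
    rw [hempty, Finset.image_empty] at hcard1
    have hcard2 := (Finset.card_le_card (hinn hγQ')).trans (Finset.card_insert_le _ _)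
    have hcard3 := (Finset.card_image_le (s := (S ∩ M q).filter fun _ => q ∈ Q')
      (f := fun x => (x, q))).trans (Finset.card_filter_le _ _)
    simp only [insert_empty_eq, Finset.card_singleton] at hcard1
    have heq := hM.balance_eq hAsub hQt (by omega) (by omega)
    have := (finish (by omega) (by omega)).1
    exact haA' a ha (this (hobs.eq_or hq hqc haq))
  · have hqQ' : q ∉ Q' := fun h => by
      have := hobs'.tight q h
      have := hobs.tight q hq
      have := hS.card_left
      omega
    have hinn' : innPairs T M (A ∩ A') (Q ∩ Q') ⊆ {(u, c)} := by
      intro p hp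
      obtain ⟨r, k⟩ := p
      obtain ⟨h1, h2, h3⟩ := hM.mem_innPairs.1 hp
      simp only [Finset.mem_inter, not_and] at h1 h2 h3
      have hkq : k ≠ q := fun h => hqQ' (h ▸ h3.2)
      have hkγ : k ≠ γ := fun h => hγQ (h ▸ h3.1)
      by_cases hr : r ∈ A
      · rcases hobs'.inn k h3.2 r ((hS.of_ne hkq hkγ r).2 h1) with h | h
        · exact absurd h (h2 hr)
        · simp [h]
      · rcases hobs.inn k h3.1 r h1 with h | h
        · exact absurd h hr
        · simp [h]
    have hcard2 := Finset.card_le_card hinn'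
    rw [Finset.card_singleton] at hcard2
    have hcard3 := (Finset.card_image_le (s := (S ∩ M q).filter fun x => x ∈ A' ∧ q ∉ Q')
      (f := fun x => (x, q))).trans (Finset.card_filter_le _ _)
    have hcard4 := Finset.card_insert_le (u', c')
      (((S ∩ M q).filter fun x => x ∈ A' ∧ q ∉ Q').image fun x => (x, q))
    have heq := hM.balance_eq hAsub hQt (by omega) (by omega)
    exact hqQ' ((finish (by omega) (by omega)).2 hq)

/-- A Kempe change chosen with respect to an obstruction creates no obstruction of the opposite
type. -/
theorem IsObstruction.of_kempeChange (hM : MissSystem T M d) (hd : 3 ≤ d)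
    (hobs : IsObstruction T M d u c u' c' A Q)
    (hq : q ∈ Q) (hqc : q ≠ c) (hγ : (M γ).card < d) (hγc : γ ≠ c')
    (hS : IsKempeChange M M' q γ S) (hSne : (S ∩ M q).Nonempty)
    (hScard : (S ∩ M q).card + (S ∩ M γ).card = 2)
    (hobs' : IsObstruction T M' d u' c' u c A' Q') :
    IsObstruction T M d u' c' u c A' Q' := by
  have hγQ : γ ∉ Q := fun h => hγ.ne (hobs.tight γ h)
  have hγc' : γ ≠ c := fun h => hγQ (h ▸ hobs.mem_right)
  have hqc' : q ≠ c' := fun h => hobs.notMem_right (h ▸ hq)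
  have hAsub : A ∩ A' ⊆ T := Finset.inter_subset_left.trans hobs.sub
  have hQt : ∀ k ∈ Q ∩ Q', (M k).card = d := fun k hk => hobs.tight k (Finset.mem_inter.1 hk).1
  have hSpos := Finset.card_pos.2 hSne
  have hout : outPairs T M (A ∩ A') (Q ∩ Q') ⊆
      ((S ∩ M q).filter fun x => x ∈ A' ∧ q ∉ Q').image fun x => (x, q) := by
    intro p hp
    obtain ⟨r, k⟩ := p
    obtain ⟨h1, h2, h3⟩ := hM.mem_outPairs.1 hp
    simp only [Finset.mem_inter, not_and] at h1 h2 h3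
    by_cases hk : k ∈ Q
    · have hkQ' := h3 hk
      by_cases hkq : k = q
      · subst hkq
        by_cases hrS : r ∈ S
        · refine Finset.mem_image.2 ⟨r, ?_, rfl⟩
          simp [hrS, h1, h2.2, hkQ']
        · exact absurd (hobs'.out r h2.2 k ((hS.left r).2 (by simpa [hrS] using h1)))
            (by simp [hkQ', hqc])
      · have hkγ : k ≠ γ := fun h => hγQ (h ▸ hk)
        rcases hobs'.out r h2.2 k ((hS.of_ne hkq hkγ r).2 h1) with h | h
        · exact absurd h hkQ'
        · exact absurd (h.1 ▸ h2.1) hobs.notMem_left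
    · rcases hobs.out r h2.1 k h1 with h | h
      · exact absurd h hk
      · exact absurd (h.1 ▸ h2.2) hobs'.notMem_left
  have hinn : innPairs T M (A ∩ A') (Q ∩ Q') ⊆
      ((S ∩ M q).filter fun _ => q ∈ Q').image fun x => (x, q) := by
    intro p hp
    obtain ⟨r, k⟩ := p
    obtain ⟨h1, h2, h3⟩ := hM.mem_innPairs.1 hp
    simp only [Finset.mem_inter, not_and] at h1 h2 h3
    by_cases hr : r ∈ A
    · have hrA' := h2 hr
      by_cases hkq : k = q
      · subst hkq
        by_cases hrS : r ∈ S
        · refine Finset.mem_image.2 ⟨r, ?_, rfl⟩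
          simp [hrS, h1, h3.2]
        · exact absurd (hobs'.inn k h3.2 r ((hS.left r).2 (by simpa [hrS] using h1)))
            (by simp [hrA', hqc'])
      · have hkγ : k ≠ γ := fun h => hγQ (h ▸ h3.1)
        rcases hobs'.inn k h3.2 r ((hS.of_ne hkq hkγ r).2 h1) with h | h
        · exact absurd h hrA'
        · exact absurd (h.2 ▸ h3.1) hobs.notMem_right
    · rcases hobs.inn k h3.1 r h1 with h | h
      · exact absurd h hr
      · exact absurd (h.2 ▸ h3.2) hobs'.notMem_right
  have hcard1 := (Finset.card_le_card hout).trans Finset.card_image_le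
  have hcard2 := (Finset.card_le_card hinn).trans Finset.card_image_le
  have hmem : ∀ x ∈ S ∩ M q, x ∈ A := fun x hx => hobs.eq_or hq hqc (Finset.mem_inter.1 hx).2
  obtain ⟨hqQ', hγQ', hSA'⟩ : q ∉ Q' ∧ γ ∉ Q' ∧ ∀ x ∈ A', x ∈ S → x ∉ M q ∧ x ∉ M γ := by
    rcases (by omega : (S ∩ M q).card = 1 ∨ (S ∩ M q).card = 2) with h1 | h2
    · have hγQ' : γ ∉ Q' := fun h => by
        have := hobs'.tight γ h
        have := hS.card_right
        omega
      have haA' : ∀ x ∈ S ∩ M q, x ∉ A' := fun x hx h => by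
        obtain ⟨hxS, hxq⟩ := Finset.mem_inter.1 hx
        rcases hobs'.out x h γ ((hS.right x).2 (by simpa [hxS] using hxq)) with h | h
        · exact hγQ' h
        · exact hγc' h.2
      have hempty : (S ∩ M q).filter (fun x => x ∈ A' ∧ q ∉ Q') = ∅ :=
        Finset.filter_eq_empty_iff.2 fun x hx h => haA' x hx h.1
      rw [hempty, Finset.card_empty] at hcard1
      have hcard3 := Finset.card_filter_le (S ∩ M q) fun _ => q ∈ Q'
      have heq := hM.balance_eq hAsub hQt (by omega) (by omega)
      have hqQ' : q ∉ Q' := fun hqQ' => by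
        obtain ⟨a, ha⟩ := hSne
        have : (a, q) ∈ innPairs T M (A ∩ A') (Q ∩ Q') := hM.mem_innPairs.2
          ⟨(Finset.mem_inter.1 ha).2, fun h => haA' a ha (Finset.mem_inter.1 h).2,
            Finset.mem_inter.2 ⟨hq, hqQ'⟩⟩
        have := Finset.card_pos.2 ⟨_, this⟩
        omega
      refine ⟨hqQ', hγQ', fun x hxA hxS => ⟨fun hx => haA' x (Finset.mem_inter.2 ⟨hxS, hx⟩) hxA,
        fun hx => ?_⟩⟩
      rcases hobs'.out x hxA q ((hS.left x).2 (by simpa [hxS] using hx)) with h | h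
      · exact hqQ' h
      · exact hqc h.2
    · have hqQ' : q ∉ Q' := fun h => by
        have := hobs'.tight q h
        have := hobs.tight q hq
        have := hS.card_left
        omega
      have hempty : (S ∩ M q).filter (fun _ => q ∈ Q') = ∅ :=
        Finset.filter_eq_empty_iff.2 fun x hx h => hqQ' h
      rw [hempty, Finset.card_empty] at hcard2
      have hcard3 := Finset.card_filter_le (S ∩ M q) fun x => x ∈ A' ∧ q ∉ Q'
      have heq := hM.balance_eq hAsub hQt (by omega) (by omega)
      have haA' : ∀ x ∈ S ∩ M q, x ∉ A' := fun x hx h => by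
        have : (x, q) ∈ outPairs T M (A ∩ A') (Q ∩ Q') := hM.mem_outPairs.2
          ⟨(Finset.mem_inter.1 hx).2, Finset.mem_inter.2 ⟨hmem x hx, h⟩,
            fun h => hqQ' (Finset.mem_inter.1 h).2⟩
        have := Finset.card_pos.2 ⟨_, this⟩
        omega
      refine ⟨hqQ', fun hγQ' => ?_, fun x hxA hxS =>
        ⟨fun hx => haA' x (Finset.mem_inter.2 ⟨hxS, hx⟩) hxA, fun hx => ?_⟩⟩
      · obtain ⟨a, ha⟩ := hSne
        obtain ⟨haS, haq⟩ := Finset.mem_inter.1 ha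
        rcases hobs'.inn γ hγQ' a ((hS.right a).2 (by simpa [haS] using haq)) with h | h
        · exact haA' a ha h
        · exact hγc h.2
      · have : (S ∩ M γ).card = 0 := by omega
        rw [Finset.card_eq_zero] at this
        exact absurd (Finset.mem_inter.2 ⟨hxS, hx⟩) (by simp [this])
  have hne : ∀ k ∈ Q', k ≠ q ∧ k ≠ γ := fun k hk =>
    ⟨fun h => hqQ' (h ▸ hk), fun h => hγQ' (h ▸ hk)⟩
  refine ⟨hobs'.sub, fun k hk => ?_, hobs'.mem_left, hobs'.notMem_left, hobs'.mem_right,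
    hobs'.notMem_right, fun a ha k hak => ?_, fun k hk r hr => ?_⟩
  · rw [← hobs'.tight k hk]
    congr 1; ext r
    exact (hS.of_ne (hne k hk).1 (hne k hk).2 r).symm
  · refine hobs'.out a ha k ?_
    by_cases haS : a ∈ S
    · have := hSA' a ha haS
      exact (hS.of_ne (fun h => this.1 (h ▸ hak)) (fun h => this.2 (h ▸ hak)) a).2 hak
    · rw [hS k a, if_neg haS]; exact hak
  · exact hobs'.inn k hk r ((hS.of_ne (hne k hk).1 (hne k hk).2 r).2 hr)

end

section

variable {V C : Type} [Fintype V] [Fintype C] [DecidableEq V] [DecidableEq C] {T : Finset V}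
  {f : V → V → C}

/-- The graph on `T` formed by the edges of two given colors. -/
def kempeGraph (T : Finset V) (f : V → V → C) (q γ : C) : SimpleGraph V :=
  SimpleGraph.fromRel fun v w => v ∈ T ∧ w ∈ T ∧ (f v w = q ∨ f v w = γ)

theorem IsProper.kempeGraph_adj (hf : IsProper T f) {q γ : C} {v w : V} :
    (kempeGraph T f q γ).Adj v w ↔ v ≠ w ∧ v ∈ T ∧ w ∈ T ∧ (f v w = q ∨ f v w = γ) := by
  rw [kempeGraph, SimpleGraph.fromRel_adj, hf.1 w v]
  tauto

open Classical in
/-- The vertices of the Kempe component of `a`. -/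
noncomputable def kempeComponent (T : Finset V) (f : V → V → C) (q γ : C) (a : V) : Finset V :=
  T.filter fun x => (kempeGraph T f q γ).Reachable a x

theorem mem_kempeComponent {q γ : C} {a x : V} :
    x ∈ kempeComponent T f q γ a ↔ x ∈ T ∧ (kempeGraph T f q γ).Reachable a x := by
  simp [kempeComponent]

theorem IsProper.kempeComponent_closed (hf : IsProper T f) {q γ : C} {a v w : V}
    (hv : v ∈ kempeComponent T f q γ a) (hw : w ∈ T) (hvw : w ≠ v)
    (h : f v w = q ∨ f v w = γ) : w ∈ kempeComponent T f q γ a := by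
  rw [mem_kempeComponent] at hv ⊢
  exact ⟨hw, hv.2.trans (hf.kempeGraph_adj.2 ⟨hvw.symm, hv.1, hw, h⟩).reachable⟩

theorem IsProper.mem_of_kempeGraph_reachable (hf : IsProper T f) {q γ : C} {a x : V}
    (h : (kempeGraph T f q γ).Reachable a x) (ha : a ∈ T) : x ∈ T := by
  obtain ⟨p⟩ := h
  induction p with
  | nil => exact ha
  | cons h' p ih => exact ih (hf.kempeGraph_adj.1 h').2.2.1

open Classical in
/-- A Kempe component is a path or a cycle, so it has at most two ends. -/
theorem IsProper.card_ends_kempeComponent_le (hf : IsProper T f) {q γ : C} (hqγ : q ≠ γ) {a : V}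
    (ha : a ∈ T) :
    (kempeComponent T f q γ a ∩ miss T f q).card + (kempeComponent T f q γ a ∩ miss T f γ).card
      ≤ 2 := by
  set S := kempeComponent T f q γ a with hS
  set G := kempeGraph T f q γ with hG
  set K := G.connectedComponentMk a with hK
  have hmem : ∀ x, x ∈ S ↔ x ∈ K := by
    intro x
    change x ∈ S ↔ G.connectedComponentMk x = K
    rw [hK, SimpleGraph.ConnectedComponent.eq,
      hS, mem_kempeComponent]
    exact ⟨fun h => h.2.symm, fun h => ⟨hf.mem_of_kempeGraph_reachable h.symm ha, h.symm⟩⟩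
  have hcardK : Nat.card K = S.card := by
    rw [Nat.card_eq_fintype_card]
    exact Fintype.card_of_subtype S hmem
  have hconn := K.connected_toSimpleGraph.card_vert_le_card_edgeSet_add_one
  rw [hcardK, Nat.card_eq_fintype_card, ← SimpleGraph.edgeFinset_card] at hconn
  have hdeg := K.toSimpleGraph.sum_degrees_eq_twice_card_edges
  have hle : ∀ v : K, K.toSimpleGraph.degree v ≤
      (({q, γ} : Finset C).filter fun k => v.1 ∉ miss T f k).card := by
    intro v
    rw [← SimpleGraph.card_neighborFinset_eq_degree]
    refine Finset.card_le_card_of_injOn (fun w => f v.1 w.1) ?_ ?_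
    · intro w hw
      have hw' := (SimpleGraph.mem_neighborFinset _ _ _).1 hw
      rw [SimpleGraph.ConnectedComponent.toSimpleGraph_adj _ v.2 w.2, hf.kempeGraph_adj] at hw'
      simp only [Finset.coe_filter, Finset.mem_insert, Finset.mem_singleton, Set.mem_ofPred_eq]
      exact ⟨hw'.2.2.2, fun h => (mem_miss.1 h).2 w.1 hw'.2.2.1 hw'.1.symm rfl⟩
    · intro w hw x hx hwx
      have hw' := (SimpleGraph.mem_neighborFinset _ _ _).1 hw
      have hx' := (SimpleGraph.mem_neighborFinset _ _ _).1 hx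
      rw [SimpleGraph.ConnectedComponent.toSimpleGraph_adj _ v.2 w.2, hf.kempeGraph_adj] at hw'
      rw [SimpleGraph.ConnectedComponent.toSimpleGraph_adj _ v.2 x.2, hf.kempeGraph_adj] at hx'
      exact Subtype.ext (hf.2 v.1 hw'.2.1 w.1 hw'.2.2.1 x.1 hx'.2.2.1 hw'.1 hx'.1 hwx)
  have hsum := Finset.sum_le_sum fun v (_ : v ∈ (Finset.univ : Finset K)) => hle v
  rw [hdeg, ← Finset.sum_subtype S hmem
    (fun x => (({q, γ} : Finset C).filter fun k => x ∉ miss T f k).card)] at hsum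
  simp_rw [Finset.card_filter] at hsum
  rw [Finset.sum_comm, Finset.sum_pair hqγ, ← Finset.card_filter, ← Finset.card_filter] at hsum
  have e : ∀ k, (S.filter fun x => x ∉ miss T f k).card + (S ∩ miss T f k).card = S.card := by
    intro k
    rw [← Finset.filter_mem_eq_inter, add_comm]
    exact Finset.card_filter_add_card_filter_not _
  have e1 := e q
  have e2 := e γ
  omega

/-- The coloring obtained by swapping two colors on `S`. -/
def kempeSwap (f : V → V → C) (q γ : C) (S : Finset V) (v w : V) : C :=
  if v ∈ S ∧ w ∈ S then Equiv.swap q γ (f v w) else f v w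

theorem IsProper.kempeSwap_eq (hf : IsProper T f) {q γ : C} {a v w : V}
    (hw : w ∈ T) (hvw : v ≠ w) :
    kempeSwap f q γ (kempeComponent T f q γ a) v w =
      if v ∈ kempeComponent T f q γ a then Equiv.swap q γ (f v w) else f v w := by
  rw [kempeSwap]
  by_cases hvS : v ∈ kempeComponent T f q γ a
  · by_cases hwS : w ∈ kempeComponent T f q γ a
    · rw [if_pos ⟨hvS, hwS⟩, if_pos hvS]
    · rw [if_neg fun h => hwS h.2, if_pos hvS]
      have : ¬ (f v w = q ∨ f v w = γ) := fun h =>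
        hwS (hf.kempeComponent_closed hvS hw hvw.symm h)
      push Not at this
      exact (Equiv.swap_apply_of_ne_of_ne this.1 this.2).symm
  · rw [if_neg fun h => hvS h.1, if_neg hvS]

theorem IsProper.kempeSwap (hf : IsProper T f) (q γ : C) (a : V) :
    IsProper T (kempeSwap f q γ (kempeComponent T f q γ a)) := by
  refine ⟨fun u v => ?_, fun u hu v hv w hw huv huw h => ?_⟩
  · simp only [_root_.kempeSwap, hf.1 u v, and_comm]
  · rw [hf.kempeSwap_eq hv huv, hf.kempeSwap_eq hw huw] at h
    refine hf.2 u hu v hv w hw huv huw ?_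
    split_ifs at h with h'
    · exact (Equiv.swap q γ).injective h
    · exact h

theorem IsProper.isKempeChange (hf : IsProper T f) (q γ : C) (a : V) :
    IsKempeChange (miss T f) (miss T (_root_.kempeSwap f q γ (kempeComponent T f q γ a))) q γ
      (kempeComponent T f q γ a) := by
  intro k r
  split_ifs with hr
  · rw [mem_miss, mem_miss]
    refine and_congr_right fun _ => forall_congr' fun v => forall_congr' fun hv =>
      forall_congr' fun hvr => ?_
    rw [hf.kempeSwap_eq hv (Ne.symm hvr), if_pos hr, Ne, Ne, Equiv.swap_apply_eq_iff]
  · rw [mem_miss, mem_miss]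
    refine and_congr_right fun _ => forall_congr' fun v => forall_congr' fun hv =>
      forall_congr' fun hvr => ?_
    rw [hf.kempeSwap_eq hv (Ne.symm hvr), if_neg hr]

theorem IsProper.missSystem (hf : IsProper T f) {d : ℕ} (hd : T.card + d = Fintype.card C + 1)
    (hcol : ∀ c, (miss T f c).card ≤ d) : MissSystem T (miss T f) d :=
  ⟨miss_subset, fun u hu => by have := hf.card_missing_colors hu; omega, hcol⟩

/-- There are many colors that are not tight. -/
theorem MissSystem.le_card_nontight {M : C → Finset V} {d : ℕ} (hM : MissSystem T M d)
    (hC : T.card + d = Fintype.card C + 1) (hd : 0 < d) {u' : V} {c' : C} (hu' : u' ∈ M c') :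
    d - 1 ≤ ((Finset.univ.filter fun k => (M k).card < d).erase c').card := by
  by_contra hlt
  push Not at hlt
  set NT := (Finset.univ.filter fun k => (M k).card < d).erase c'
  have hsum : ∑ k, (M k).card = d * T.card := by
    have h1 : ∀ k, (M k).card = ∑ u ∈ T, if u ∈ M k then 1 else 0 := by
      intro k
      rw [← Finset.card_filter]
      congr 1; ext u
      simp only [Finset.mem_filter]
      exact ⟨fun h => ⟨hM.sub k h, h⟩, fun h => h.2⟩
    simp_rw [h1]
    rw [Finset.sum_comm]
    simp_rw [← Finset.card_filter]
    rw [Finset.sum_congr rfl hM.row, Finset.sum_const, smul_eq_mul, mul_comm]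
  have hle : ∀ k, d ≤ (M k).card + (if k ∈ NT then d else 0) + (if k = c' then d - 1 else 0) := by
    intro k
    by_cases hk : k = c'
    · have : 0 < (M c').card := Finset.card_pos.2 ⟨u', hu'⟩
      subst hk
      simp [NT]; omega
    · by_cases hk' : (M k).card < d
      · simp [NT, hk, hk']
      · simp [NT, hk, hk']; omega
  have h2 := Finset.sum_le_sum fun k (_ : k ∈ (Finset.univ : Finset C)) => hle k
  rw [Finset.sum_add_distrib, Finset.sum_add_distrib, hsum, Finset.sum_ite_eq' Finset.univ c',
    ← Finset.sum_filter, Finset.filter_mem_eq_inter, Finset.univ_inter] at h2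
  simp only [Finset.sum_const, smul_eq_mul, Finset.card_univ, Finset.mem_univ, if_true] at h2
  have h3 : Fintype.card C = T.card + d - 1 := by omega
  obtain ⟨e, rfl⟩ : ∃ e, d = e + 1 := ⟨d - 1, by omega⟩
  have h4 : NT.card + 1 ≤ e := by omega
  rw [h3, show T.card + (e + 1) - 1 = T.card + e by omega, show e + 1 - 1 = e by omega] at h2
  nlinarith [Nat.mul_le_mul_right (e + 1) h4]

theorem IsObstruction.le_card_erase {M : C → Finset V} {d : ℕ} (hM : MissSystem T M d)
    (hd : 3 ≤ d) {u u' : V} {c c' : C} {A : Finset V} {Q : Finset C}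
    (hobs : IsObstruction T M d u c u' c' A Q) : d - 1 ≤ (Q.erase c).card := by
  have h1 := hobs.tight c hobs.mem_right
  obtain ⟨a, ha⟩ : (((M c).erase u).erase u').Nonempty := by
    rw [← Finset.card_pos]
    have := Finset.pred_card_le_card_erase (s := M c) (a := u)
    have := Finset.pred_card_le_card_erase (s := (M c).erase u) (a := u')
    omega
  rw [Finset.mem_erase, Finset.mem_erase] at ha
  have haA : a ∈ A := (hobs.inn c hobs.mem_right a ha.2.2).resolve_right fun h => ha.2.1 h.1
  have h2 : (Finset.univ.filter fun k => a ∈ M k) ⊆ Q := by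
    intro k hk
    exact (hobs.out a haA k (by simpa using hk)).resolve_right fun h => ha.1 h.1
  have h3 := Finset.card_le_card h2
  rw [hM.row a (hobs.sub haA)] at h3
  rw [Finset.card_erase_of_mem hobs.mem_right]
  omega

theorem exists_mem_mul_le_sum {ι : Type} (s : Finset ι) (r : ι → ℕ) {k : ℕ} (hk : 0 < k)
    (hs : k ≤ s.card) : ∃ i ∈ s, k * r i ≤ ∑ j ∈ s, r j := by
  obtain ⟨i, hi, hmin⟩ := s.exists_min_image r (Finset.card_pos.1 (by omega))
  refine ⟨i, hi, (Nat.mul_le_mul_right _ hs).trans ?_⟩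
  rw [← smul_eq_mul]
  exact Finset.card_nsmul_le_sum s r _ hmin

theorem IsProper.miss_kempeComponent (hf : IsProper T f) {q γ : C} {a : V} {k : C}
    (hk : k = q ∨ k = γ) :
    miss (kempeComponent T f q γ a) f k = kempeComponent T f q γ a ∩ miss T f k := by
  ext x
  rw [Finset.mem_inter, mem_miss, mem_miss]
  refine ⟨fun h => ⟨h.1, (mem_kempeComponent.1 h.1).1, fun v hv hvx hfv => ?_⟩,
    fun h => ⟨h.1, fun v hv => h.2.2 v (mem_kempeComponent.1 hv).1⟩⟩
  exact h.2 v (hf.kempeComponent_closed h.1 hv hvx (by rwa [hfv])) hvx hfv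

theorem IsProper.card_ends_kempeComponent (hf : IsProper T f) {q γ : C} (hqγ : q ≠ γ) {a : V}
    (ha : a ∈ miss T f q) :
    (kempeComponent T f q γ a ∩ miss T f q).card + (kempeComponent T f q γ a ∩ miss T f γ).card
      = 2 := by
  have hS := hf.mono (S := kempeComponent T f q γ a) fun x hx => (mem_kempeComponent.1 hx).1
  have h1 := hS.even_card_miss_add q
  have h2 := hS.even_card_miss_add γ
  rw [hf.miss_kempeComponent (Or.inl rfl)] at h1
  rw [hf.miss_kempeComponent (Or.inr rfl)] at h2
  have h3 := hf.card_ends_kempeComponent_le hqγ (miss_subset _ ha)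
  have h4 : 0 < (kempeComponent T f q γ a ∩ miss T f q).card := Finset.card_pos.2
    ⟨a, Finset.mem_inter.2 ⟨mem_kempeComponent.2 ⟨miss_subset _ ha, .rfl⟩, ha⟩⟩
  rw [Nat.even_iff] at h1 h2
  omega

/-- A Kempe change along a component that avoids the prescribed edges `R` removes all
obstructions of one type. -/
theorem IsProper.exists_kempe_elimination (hf : IsProper T f) {d : ℕ}
    (hC : T.card + d = Fintype.card C + 1) (hd : 3 ≤ d) (hcol : ∀ k, (miss T f k).card ≤ d)
    {R : Finset (V × V)} (hR : ∀ e ∈ R, e.1 ∈ T ∧ e.2 ∈ T ∧ e.1 ≠ e.2) {u u' : V} {c c' : C}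
    (hρ : 2 * (R.filter fun e => f e.1 e.2 ≠ c ∧ f e.1 e.2 ≠ c').card < d * (d - 1))
    (hu : u ∈ miss T f c) (hu' : u' ∈ miss T f c')
    (hobs : ∃ A Q, IsObstruction T (miss T f) d u c u' c' A Q) :
    ∃ f' : V → V → C, IsProper T f' ∧ (∀ k, (miss T f' k).card ≤ d) ∧
      (∀ e ∈ R, f' e.1 e.2 = f e.1 e.2) ∧ u ∈ miss T f' c ∧ u' ∈ miss T f' c' ∧
      (∀ A Q, ¬ IsObstruction T (miss T f') d u c u' c' A Q) ∧
      ∀ A Q, IsObstruction T (miss T f') d u' c' u c A Q →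
        IsObstruction T (miss T f) d u' c' u c A Q := by
  classical
  have hM := hf.missSystem hC hcol
  obtain ⟨⟨A, Q⟩, hAQ, hmin⟩ := (Finset.univ.filter fun p : Finset V × Finset C =>
    IsObstruction T (miss T f) d u c u' c' p.1 p.2).exists_min_image
      (fun p => p.1.card + p.2.card) (by
        obtain ⟨A, Q, h⟩ := hobs
        exact ⟨(A, Q), by simpa using h⟩)
  replace hAQ : IsObstruction T (miss T f) d u c u' c' A Q := by simpa using hAQ
  have hmin' : ∀ A' Q', IsObstruction T (miss T f) d u c u' c' A' Q' →
      A.card + Q.card ≤ A'.card + Q'.card := fun A' Q' h => hmin (A', Q') (by simpa using h)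
  set r : C → ℕ := fun k => (R.filter fun e => f e.1 e.2 = k).card with hr
  set NT := (Finset.univ.filter fun k => (miss T f k).card < d).erase c' with hNT
  obtain ⟨q, hq, hrq⟩ := exists_mem_mul_le_sum (Q.erase c) r (by omega) (hAQ.le_card_erase hM hd)
  obtain ⟨γ, hγ, hrγ⟩ := exists_mem_mul_le_sum NT r (by omega)
    (hM.le_card_nontight hC (by omega) hu')
  have hdisj : Disjoint (Q.erase c) NT := Finset.disjoint_left.2 fun k h1 h2 => by
    have := hAQ.tight k (Finset.mem_erase.1 h1).2
    have := (Finset.mem_filter.1 (Finset.mem_erase.1 h2).2).2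
    omega
  have hsum : ∑ k ∈ Q.erase c, r k + ∑ k ∈ NT, r k ≤
      (R.filter fun e => f e.1 e.2 ≠ c ∧ f e.1 e.2 ≠ c').card := by
    rw [← Finset.sum_union hdisj, hr]
    rw [← Finset.card_biUnion]
    · refine Finset.card_le_card fun e he => ?_
      obtain ⟨k, hk, hek⟩ := Finset.mem_biUnion.1 he
      obtain ⟨heR, rfl⟩ := Finset.mem_filter.1 hek
      refine Finset.mem_filter.2 ⟨heR, ?_⟩
      rcases Finset.mem_union.1 hk with hk | hk
      · rw [Finset.mem_erase] at hk
        exact ⟨hk.1, fun h => hAQ.notMem_right (h ▸ hk.2)⟩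
      · rw [hNT, Finset.mem_erase, Finset.mem_filter] at hk
        exact ⟨fun h => hk.2.2.ne (h ▸ hAQ.tight c hAQ.mem_right), hk.1⟩
    · intro i _ j _ hij
      exact Finset.disjoint_left.2 fun e h1 h2 =>
        hij ((Finset.mem_filter.1 h1).2.symm.trans (Finset.mem_filter.1 h2).2)
  obtain ⟨hqc, hqQ⟩ := Finset.mem_erase.1 hq
  rw [hNT, Finset.mem_erase, Finset.mem_filter] at hγ
  obtain ⟨hγc', -, hγt⟩ := hγ
  have hqt := hAQ.tight q hqQ
  have hqγ : q ≠ γ := by rintro rfl; omega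
  have hqc' : q ≠ c' := fun h => hAQ.notMem_right (h ▸ hqQ)
  have hγc : γ ≠ c := fun h => by
    have := hAQ.tight c hAQ.mem_right
    rw [← h] at this
    omega
  have hrr : 2 * (r q + r γ) < d := by
    obtain ⟨e, rfl⟩ : ∃ e, d = e + 1 := ⟨d - 1, by omega⟩
    simp only [Nat.add_sub_cancel] at hrq hrγ hρ
    nlinarith
  set B := R.filter fun e => f e.1 e.2 = q ∨ f e.1 e.2 = γ with hB
  have hBcard : B.card ≤ r q + r γ := by
    rw [hB, Finset.filter_or]
    exact Finset.card_union_le _ _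
  obtain ⟨a, haq, haB⟩ : ∃ a ∈ miss T f q, ∀ e ∈ B, e.1 ∉ kempeComponent T f q γ a := by
    by_contra! hcon
    have hsub : miss T f q ⊆ B.biUnion fun e => kempeComponent T f q γ e.1 ∩ miss T f q := by
      intro a ha
      obtain ⟨e, he, hea⟩ := hcon a ha
      refine Finset.mem_biUnion.2 ⟨e, he, Finset.mem_inter.2 ⟨mem_kempeComponent.2
        ⟨miss_subset _ ha, (mem_kempeComponent.1 hea).2.symm⟩, ha⟩⟩
    have h1 := (Finset.card_le_card hsub).trans (Finset.card_biUnion_le_card_mul B _ 2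
      fun e he => (Nat.le_add_right _ _).trans (hf.card_ends_kempeComponent_le hqγ
        (hR e (Finset.mem_filter.1 he).1).1))
    omega
  set S := kempeComponent T f q γ a with hS
  have hch := hf.isKempeChange q γ a
  have hends := hf.card_ends_kempeComponent hqγ haq
  have hne : (S ∩ miss T f q).Nonempty :=
    ⟨a, Finset.mem_inter.2 ⟨mem_kempeComponent.2 ⟨miss_subset _ haq, .rfl⟩, haq⟩⟩
  have hcq := hch.card_left
  have hcγ := hch.card_right
  rw [← hS] at hch hends hcq hcγ
  have hpos := Finset.card_pos.2 hne
  refine ⟨_root_.kempeSwap f q γ S, hf.kempeSwap q γ a, fun k => ?_, fun e he => ?_, ?_, ?_,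
    fun A' Q' => hAQ.not_of_kempeChange hM hd hu hu' hmin' hqQ hqc hγt hγc' hch hne hends,
    fun A' Q' h => hAQ.of_kempeChange hM hd hqQ hqc hγt hγc' hch hne hends h⟩
  · by_cases h1 : k = q
    · subst h1; omega
    by_cases h2 : k = γ
    · subst h2
      have e1 := hf.even_card_miss_add k
      have e2 := hf.even_card_miss_add q
      rw [Nat.even_iff] at e1 e2
      omega
    · have : miss T (_root_.kempeSwap f q γ S) k = miss T f k := by
        ext x; exact hch.of_ne h1 h2 x
      rw [this]; exact hcol k
  · obtain ⟨h1, h2, h3⟩ := hR e he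
    rw [hS, hf.kempeSwap_eq h2 h3, ← hS]
    by_cases heB : e ∈ B
    · rw [if_neg (haB e heB)]
    · have : ¬ (f e.1 e.2 = q ∨ f e.1 e.2 = γ) := fun h => heB (Finset.mem_filter.2 ⟨he, h⟩)
      push Not at this
      rw [Equiv.swap_apply_of_ne_of_ne this.1 this.2, ite_self]
  · exact (hch.of_ne (Ne.symm hqc) (Ne.symm hγc) u).2 hu
  · exact (hch.of_ne (Ne.symm hqc') (Ne.symm hγc') u').2 hu'

theorem IsProper.exists_without_obstruction (hf : IsProper T f) {d : ℕ}
    (hC : T.card + d = Fintype.card C + 1) (hd : 3 ≤ d) (hcol : ∀ k, (miss T f k).card ≤ d)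
    {R : Finset (V × V)} (hR : ∀ e ∈ R, e.1 ∈ T ∧ e.2 ∈ T ∧ e.1 ≠ e.2) {u u' : V} {c c' : C}
    (hρ : 2 * (R.filter fun e => f e.1 e.2 ≠ c ∧ f e.1 e.2 ≠ c').card < d * (d - 1))
    (hu : u ∈ miss T f c) (hu' : u' ∈ miss T f c') :
    ∃ f' : V → V → C, IsProper T f' ∧ (∀ k, (miss T f' k).card ≤ d) ∧
      (∀ e ∈ R, f' e.1 e.2 = f e.1 e.2) ∧ u ∈ miss T f' c ∧ u' ∈ miss T f' c' ∧
      (∀ A Q, ¬ IsObstruction T (miss T f') d u c u' c' A Q) ∧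
      ∀ A Q, ¬ IsObstruction T (miss T f') d u' c' u c A Q := by
  obtain ⟨f₁, hf₁, hcol₁, hR₁, hu₁, hu₁', hobs₁⟩ : ∃ f' : V → V → C, IsProper T f' ∧
      (∀ k, (miss T f' k).card ≤ d) ∧ (∀ e ∈ R, f' e.1 e.2 = f e.1 e.2) ∧ u ∈ miss T f' c ∧
      u' ∈ miss T f' c' ∧ ∀ A Q, ¬ IsObstruction T (miss T f') d u c u' c' A Q := by
    by_cases h : ∃ A Q, IsObstruction T (miss T f) d u c u' c' A Q
    · obtain ⟨f', h1, h2, h3, h4, h5, h6, -⟩ :=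
        hf.exists_kempe_elimination hC hd hcol hR hρ hu hu' h
      exact ⟨f', h1, h2, h3, h4, h5, h6⟩
    · push Not at h
      exact ⟨f, hf, hcol, fun _ _ => rfl, hu, hu', h⟩
  by_cases h : ∃ A Q, IsObstruction T (miss T f₁) d u' c' u c A Q
  · have hρ' : 2 * (R.filter fun e => f₁ e.1 e.2 ≠ c' ∧ f₁ e.1 e.2 ≠ c).card < d * (d - 1) := by
      rwa [Finset.filter_congr fun e he => by rw [hR₁ e he, and_comm]]
    obtain ⟨f', h1, h2, h3, h4, h5, h6, h7⟩ :=
      hf₁.exists_kempe_elimination hC hd hcol₁ hR hρ' hu₁' hu₁ h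
    exact ⟨f', h1, h2, fun e he => (h3 e he).trans (hR₁ e he), h5, h4,
      fun A Q h => hobs₁ A Q (h7 A Q h), h6⟩
  · push Not at h
    exact ⟨f₁, hf₁, hcol₁, hR₁, hu₁, hu₁', hobs₁, h⟩

/-- A proper edge coloring can be modified outside a small set `R` of edges so that the `c`-edge
at `u` and the `c'`-edge at `u'` lead to different vertices outside `T`. -/
theorem IsProper.exists_separated (hf : IsProper Finset.univ f)
    (hC : Fintype.card C + 1 = Fintype.card V) (hV : Even (Fintype.card V)) {d : ℕ}
    (hT : T.card + d = Fintype.card V) (hd : 3 ≤ d)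
    {R : Finset (V × V)} (hR : ∀ e ∈ R, e.1 ∈ T ∧ e.2 ∈ T ∧ e.1 ≠ e.2) {u u' : V} {c c' : C}
    (huu : u ≠ u')
    (hρ : 2 * (R.filter fun e => f e.1 e.2 ≠ c ∧ f e.1 e.2 ≠ c').card < d * (d - 1))
    (hu : u ∈ miss T f c) (hu' : u' ∈ miss T f c') :
    ∃ g : V → V → C, IsProper Finset.univ g ∧ (∀ e ∈ R, g e.1 e.2 = f e.1 e.2) ∧
      ∃ x x' : V, x ∉ T ∧ x' ∉ T ∧ x ≠ x' ∧ g u x = c ∧ g u' x' = c' := by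
  have hTC : T.card + d = Fintype.card C + 1 := by omega
  obtain ⟨f', hf', hcol, hR', h1, h2, h3, h4⟩ := (hf.mono (Finset.subset_univ T)
    ).exists_without_obstruction hTC hd (fun k => by
      have := hf.card_miss_add_le hC T k
      omega) hR hρ hu hu'
  have : Nonempty C := ⟨c⟩
  obtain ⟨m, hinj, hm, ht, hmu, hmu'⟩ :=
    (hf'.missSystem hTC hcol).exists_separating_matching hd h1 h2 huu h3 h4
  obtain ⟨x, hx⟩ : ∃ x, x ∉ T := by
    by_contra! h
    have : T = Finset.univ := Finset.eq_univ_iff_forall.2 h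
    rw [this, Finset.card_univ] at hT
    omega
  have huT := miss_subset _ h1
  have huT' := miss_subset _ h2
  obtain ⟨g, hg, hgf⟩ := (hf'.insert_extendAt hx hinj hm).exists_extension hC hV
    (hf'.card_miss_extendAt_add_le hx hm hV (fun k => by have := hcol k; omega)
      fun k hk => ht k (by omega))
  have hne : ∀ v ∈ T, v ≠ x := by rintro v hv rfl; exact hx hv
  have hgT : ∀ v ∈ T, ∀ w ∈ T, g v w = f' v w := fun v hv w hw => by
    rw [hgf v (Finset.mem_insert_of_mem hv) w (Finset.mem_insert_of_mem hw),
      extendAt_of_ne (hne v hv) (hne w hw)]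
  have hgx : ∀ v ∈ T, g v x = m v := fun v hv => by
    rw [hgf v (Finset.mem_insert_of_mem hv) x (Finset.mem_insert_self _ _), extendAt_right]
  obtain ⟨x', hx'u, hx'⟩ := hg.exists_color_eq hC u' c'
  refine ⟨g, hg, fun e he => ?_, x, x', hx, fun h => ?_, ?_, ?_, hx'⟩
  · rw [hgT _ (hR e he).1 _ (hR e he).2.1, hR' e he]
  · rw [hgT u' huT' x' h] at hx'
    exact (mem_miss.1 h2).2 x' h hx'u hx'
  · rintro rfl
    exact hmu' (by rw [← hgx u' huT', hx'])
  · rw [hgx u huT, hmu]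

end

/-- A partial proper edge coloring of a complete graph, as the symmetric set of all triples
`(u, v, c)` such that the edge `uv` has color `c`. -/
structure IsPrecoloring {V C : Type} (H : Finset (V × V × C)) : Prop where
  symm : ∀ u v c, (u, v, c) ∈ H → (v, u, c) ∈ H
  ne : ∀ u v c, (u, v, c) ∈ H → u ≠ v
  right : ∀ u v w c, (u, v, c) ∈ H → (u, w, c) ∈ H → v = w
  color : ∀ u v c d, (u, v, c) ∈ H → (u, v, d) ∈ H → c = d

/-- Extendability to a proper edge coloring of the complete graph. -/
def Completable {V C : Type} [Fintype V] (H : Finset (V × V × C)) : Prop :=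
  ∃ f : V → V → C, IsProper Finset.univ f ∧ ∀ u v c, (u, v, c) ∈ H → f u v = c

/-- The vertices incident to precolored edges. -/
def covered {V C : Type} [DecidableEq V] (H : Finset (V × V × C)) : Finset V :=
  H.image fun p => p.1

/-- A perfect matching of `T` with all edges but one of the same color. -/
def IsExceptional {V C : Type} (T : Finset V) (H : Finset (V × V × C)) : Prop :=
  (∀ u ∈ T, ∃ v c, (u, v, c) ∈ H) ∧ (∀ u v c v' c', (u, v, c) ∈ H → (u, v', c') ∈ H → v = v') ∧
    ∃ x y c c', c ≠ c' ∧ (x, y, c') ∈ H ∧ (∃ u v, (u, v, c) ∈ H) ∧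
      ∀ u v e, (u, v, e) ∈ H → e = c ∨ (u = x ∧ v = y) ∨ (u = y ∧ v = x)

/-- `x` is incident to exactly one precolored edge, which goes to `u` and has color `c`. -/
def IsLeaf {V C : Type} (H : Finset (V × V × C)) (x u : V) (c : C) : Prop :=
  (x, u, c) ∈ H ∧ ∀ v k, (x, v, k) ∈ H → v = u ∧ k = c

section

variable {V C : Type} [DecidableEq V] [DecidableEq C] {H : Finset (V × V × C)}

theorem mem_covered {u : V} : u ∈ covered H ↔ ∃ v c, (u, v, c) ∈ H := by
  simp [covered]

theorem IsPrecoloring.subset {H' : Finset (V × V × C)} (hH : IsPrecoloring H) (h : H' ⊆ H)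
    (hs : ∀ u v c, (u, v, c) ∈ H' → (v, u, c) ∈ H') : IsPrecoloring H' :=
  ⟨hs, fun u v c h1 => hH.ne u v c (h h1), fun u v w c h1 h2 => hH.right u v w c (h h1) (h h2),
    fun u v c d h1 h2 => hH.color u v c d (h h1) (h h2)⟩

/-- Identification of the leaf `x'` with the leaf `x`. -/
def identify (H : Finset (V × V × C)) (x u : V) (c : C) (x' u' : V) (c' : C) :
    Finset (V × V × C) :=
  (H.filter fun p => (p.1 ≠ x ∧ p.1 ≠ x') ∧ p.2.1 ≠ x ∧ p.2.1 ≠ x') ∪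
    {(x, u, c), (u, x, c), (x, u', c'), (u', x, c')}

theorem mem_identify {x u x' u' a b : V} {c c' k : C} :
    (a, b, k) ∈ identify H x u c x' u' c' ↔
      ((a, b, k) ∈ H ∧ (a ≠ x ∧ a ≠ x') ∧ b ≠ x ∧ b ≠ x') ∨ (a = x ∧ b = u ∧ k = c) ∨
        (a = u ∧ b = x ∧ k = c) ∨ (a = x ∧ b = u' ∧ k = c') ∨ (a = u' ∧ b = x ∧ k = c') := by
  simp [identify]; tauto

variable {x u x' u' : V} {c c' : C}

theorem IsLeaf.nbr_ne (hH : IsPrecoloring H) (hx : IsLeaf H x u c) (hx' : IsLeaf H x' u' c')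
    (huu : u ≠ u') (hcc : c ≠ c') : x ≠ x' ∧ u ≠ x ∧ u ≠ x' ∧ u' ≠ x ∧ u' ≠ x' := by
  refine ⟨?_, (hH.ne _ _ _ hx.1).symm, ?_, ?_, (hH.ne _ _ _ hx'.1).symm⟩
  · rintro rfl; exact huu (hx'.2 _ _ hx.1).1
  · rintro rfl; exact hcc (hx'.2 _ _ (hH.symm _ _ _ hx.1)).2
  · rintro rfl; exact hcc (hx.2 _ _ (hH.symm _ _ _ hx'.1)).2.symm

set_option maxHeartbeats 2000000 in
theorem IsPrecoloring.identify (hH : IsPrecoloring H) (hx : IsLeaf H x u c)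
    (hx' : IsLeaf H x' u' c') (huu : u ≠ u') (hcc : c ≠ c') :
    IsPrecoloring (identify H x u c x' u' c') := by
  obtain ⟨h1, h2, h3, h4, h5⟩ := hx.nbr_ne hH hx' huu hcc
  have hs := hH.symm
  have hr := hH.right
  have hux := hs _ _ _ hx.1
  have hux' := hs _ _ _ hx'.1
  have hc := hH.color
  have hn := hH.ne
  refine ⟨fun a b k h => ?_, fun a b k h => ?_, fun a b b' k h h' => ?_, fun a b k k' h h' => ?_⟩
  · rw [mem_identify] at h ⊢; have := hs a b k; tauto
  · rw [mem_identify] at h; have := hn a b k; grind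
  · rw [mem_identify] at h h'; have := hr a b b' k
    have i1 : ∀ b, (u, b, c) ∈ H → b = x := fun b hb => hr _ _ _ _ hb hux
    have i2 : ∀ b, (u', b, c') ∈ H → b = x' := fun b hb => hr _ _ _ _ hb hux'
    rcases h with h | ⟨rfl, rfl, rfl⟩ | ⟨rfl, rfl, rfl⟩ | ⟨rfl, rfl, rfl⟩ | ⟨rfl, rfl, rfl⟩ <;>
    rcases h' with h' | h' | h' | h' | h' <;> grind
  · rw [mem_identify] at h h'; have := hc a b k k'; grind

theorem card_identify (hH : IsPrecoloring H) (hx : IsLeaf H x u c)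
    (hx' : IsLeaf H x' u' c') (huu : u ≠ u') (hcc : c ≠ c') :
    (identify H x u c x' u' c').card = H.card := by
  obtain ⟨h1, h2, h3, h4, h5⟩ := hx.nbr_ne hH hx' huu hcc
  have hright : ∀ v k, (v, x, k) ∈ H → v = u ∧ k = c := fun v k h => hx.2 v k (hH.symm _ _ _ h)
  have hright' : ∀ v k, (v, x', k) ∈ H → v = u' ∧ k = c' :=
    fun v k h => hx'.2 v k (hH.symm _ _ _ h)
  have e1 : H.filter (fun p => ¬ ((p.1 ≠ x ∧ p.1 ≠ x') ∧ p.2.1 ≠ x ∧ p.2.1 ≠ x')) =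
      {(x, u, c), (u, x, c), (x', u', c'), (u', x', c')} := by
    ext ⟨a, b, k⟩
    simp only [Finset.mem_filter, Finset.mem_insert, Finset.mem_singleton, Prod.mk.injEq]
    constructor
    · rintro ⟨h, h6⟩
      have h7 : a = x ∨ a = x' ∨ b = x ∨ b = x' := by tauto
      rcases h7 with rfl | rfl | rfl | rfl
      · exact Or.inl ⟨rfl, hx.2 _ _ h⟩
      · exact Or.inr (Or.inr (Or.inl ⟨rfl, hx'.2 _ _ h⟩))
      · obtain ⟨rfl, rfl⟩ := hright _ _ h; exact Or.inr (Or.inl ⟨rfl, rfl, rfl⟩)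
      · obtain ⟨rfl, rfl⟩ := hright' _ _ h; exact Or.inr (Or.inr (Or.inr ⟨rfl, rfl, rfl⟩))
    · rintro (⟨rfl, rfl, rfl⟩ | ⟨rfl, rfl, rfl⟩ | ⟨rfl, rfl, rfl⟩ | ⟨rfl, rfl, rfl⟩)
      · exact ⟨hx.1, by tauto⟩
      · exact ⟨hH.symm _ _ _ hx.1, by tauto⟩
      · exact ⟨hx'.1, by tauto⟩
      · exact ⟨hH.symm _ _ _ hx'.1, by tauto⟩
  have e2 : ({(x, u, c), (u, x, c), (x', u', c'), (u', x', c')} : Finset (V × V × C)).card = 4 := by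
    rw [Finset.card_insert_of_notMem, Finset.card_insert_of_notMem, Finset.card_insert_of_notMem,
      Finset.card_singleton] <;>
    simp only [Finset.mem_insert, Finset.mem_singleton, Prod.mk.injEq, not_or] <;> tauto
  have e3 : ({(x, u, c), (u, x, c), (x, u', c'), (u', x, c')} : Finset (V × V × C)).card = 4 := by
    rw [Finset.card_insert_of_notMem, Finset.card_insert_of_notMem, Finset.card_insert_of_notMem,
      Finset.card_singleton] <;>
    simp only [Finset.mem_insert, Finset.mem_singleton, Prod.mk.injEq, not_or] <;> tauto
  rw [_root_.identify, Finset.card_union_of_disjoint, e3, ← e2, ← e1,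
    Finset.card_filter_add_card_filter_not]
  refine Finset.disjoint_left.2 fun p hp hp' => ?_
  simp only [Finset.mem_insert, Finset.mem_singleton] at hp'
  have hp := (Finset.mem_filter.1 hp).2
  rcases hp' with rfl | rfl | rfl | rfl <;> simp at hp

theorem card_covered_identify_lt (hH : IsPrecoloring H) (hx : IsLeaf H x u c)
    (hx' : IsLeaf H x' u' c') (huu : u ≠ u') (hcc : c ≠ c') :
    (covered (identify H x u c x' u' c')).card < (covered H).card := by
  obtain ⟨h1, h2, h3, h4, h5⟩ := hx.nbr_ne hH hx' huu hcc
  refine Finset.card_lt_card (Finset.ssubset_iff_of_subset ?_ |>.2 ⟨x', ?_, ?_⟩)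
  · intro a ha
    obtain ⟨b, k, h⟩ := mem_covered.1 ha
    rw [mem_identify] at h
    rw [mem_covered]
    rcases h with h | ⟨rfl, rfl, rfl⟩ | ⟨rfl, rfl, rfl⟩ | ⟨rfl, rfl, rfl⟩ | ⟨rfl, rfl, rfl⟩
    · exact ⟨_, _, h.1⟩
    · exact ⟨_, _, hx.1⟩
    · exact ⟨_, _, hH.symm _ _ _ hx.1⟩
    · exact ⟨_, _, hx.1⟩
    · exact ⟨_, _, hH.symm _ _ _ hx'.1⟩
  · exact mem_covered.2 ⟨_, _, hx'.1⟩
  · intro h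
    obtain ⟨b, k, h⟩ := mem_covered.1 h
    rw [mem_identify] at h
    grind

theorem not_isExceptional_identify (T : Finset V) (huu : u ≠ u') :
    ¬ IsExceptional T (identify H x u c x' u' c') := by
  rintro ⟨-, h, -⟩
  exact huu (h x u c u' c' (mem_identify.2 (by simp)) (mem_identify.2 (by simp)))

theorem exists_orientation (R : Finset (V × V)) (hR : ∀ e ∈ R, e.1 ≠ e.2) :
    ∃ R₀ ⊆ R, (∀ e ∈ R, e.swap ∈ R → e ∈ R₀ ∨ e.swap ∈ R₀) ∧ ∀ e ∈ R₀, e.swap ∉ R₀ := by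
  induction R using Finset.induction_on with
  | empty => exact ⟨∅, by simp⟩
  | insert e R he ih =>
    obtain ⟨R₀, h1, h2, h3⟩ := ih fun e h => hR e (Finset.mem_insert_of_mem h)
    have hne : e.swap ≠ e := fun h => hR e (Finset.mem_insert_self _ _) (congrArg Prod.snd h)
    by_cases hs : e.swap ∈ R₀
    · refine ⟨R₀, h1.trans (Finset.subset_insert _ _), fun a ha ha' => ?_, h3⟩
      rcases Finset.mem_insert.1 ha with rfl | ha
      · exact Or.inr hs
      · rcases Finset.mem_insert.1 ha' with h | ha'
        · left; rw [← h] at hs; simpa using hs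
        · exact h2 a ha ha'
    · refine ⟨insert e R₀, Finset.insert_subset_insert _ h1, fun a ha ha' => ?_, fun a ha => ?_⟩
      · rcases Finset.mem_insert.1 ha with rfl | ha
        · simp
        · rcases Finset.mem_insert.1 ha' with h | ha'
          · right; rw [h]; simp
          · have := h2 a ha ha'
            simp only [Finset.mem_insert]; tauto
      · rcases Finset.mem_insert.1 ha with rfl | ha
        · simp [hne, hs]
        · simp only [Finset.mem_insert, not_or]
          refine ⟨fun h => hs ?_, h3 a ha⟩
          rw [← h]; simpa using ha

variable [Fintype V] [Fintype C]

/-- Version of `IsProper.exists_separated` for a symmetric set of prescribed edges. -/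
theorem IsProper.exists_separated_of_symm {f : V → V → C} {T : Finset V}
    (hf : IsProper Finset.univ f)
    (hC : Fintype.card C + 1 = Fintype.card V) (hV : Even (Fintype.card V)) {d : ℕ}
    (hT : T.card + d = Fintype.card V) (hd : 3 ≤ d)
    {R : Finset (V × V)} (hR : ∀ e ∈ R, e.1 ∈ T ∧ e.2 ∈ T ∧ e.1 ≠ e.2)
    (hsymm : ∀ e ∈ R, e.swap ∈ R) (huu : u ≠ u')
    (hρ : (R.filter fun e => f e.1 e.2 ≠ c ∧ f e.1 e.2 ≠ c').card < d * (d - 1))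
    (hu : u ∈ miss T f c) (hu' : u' ∈ miss T f c') :
    ∃ g : V → V → C, IsProper Finset.univ g ∧ (∀ e ∈ R, g e.1 e.2 = f e.1 e.2) ∧
      ∃ x x' : V, x ∉ T ∧ x' ∉ T ∧ x ≠ x' ∧ g u x = c ∧ g u' x' = c' := by
  obtain ⟨R₀, h1, h2, h3⟩ := exists_orientation R fun e he => (hR e he).2.2
  set P := R₀.filter fun e => f e.1 e.2 ≠ c ∧ f e.1 e.2 ≠ c' with hP
  have hcard : 2 * P.card ≤ (R.filter fun e => f e.1 e.2 ≠ c ∧ f e.1 e.2 ≠ c').card := by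
    have hdis : Disjoint P (P.image Prod.swap) := by
      refine Finset.disjoint_left.2 fun e he he' => ?_
      obtain ⟨e', h4, rfl⟩ := Finset.mem_image.1 he'
      exact h3 e' (Finset.mem_filter.1 h4).1 (Finset.mem_filter.1 he).1
    rw [two_mul]
    nth_rewrite 2 [← Finset.card_image_of_injective P Prod.swap_injective]
    rw [← Finset.card_union_of_disjoint hdis]
    refine Finset.card_le_card (Finset.union_subset (Finset.filter_subset_filter _ h1) ?_)
    intro e he
    obtain ⟨e', h4, rfl⟩ := Finset.mem_image.1 he
    obtain ⟨h5, h6⟩ := Finset.mem_filter.1 h4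
    refine Finset.mem_filter.2 ⟨hsymm _ (h1 h5), ?_⟩
    simp only [Prod.fst_swap, Prod.snd_swap]
    rwa [hf.1]
  obtain ⟨g, hg, hgf, hx⟩ := hf.exists_separated hC hV hT hd (fun e he => hR e (h1 he)) huu
    (hcard.trans_lt hρ) hu hu'
  refine ⟨g, hg, fun e he => ?_, hx⟩
  rcases h2 e he (hsymm e he) with h | h
  · exact hgf e h
  · have := hgf _ h
    simp only [Prod.fst_swap, Prod.snd_swap] at this
    rw [hg.1, this, hf.1]

theorem exists_perm_of_two {T : Finset V} {x x' y y' : V} (hx : x ∉ T) (hx' : x' ∉ T)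
    (hy : y ∉ T) (hy' : y' ∉ T) (hxx : x ≠ x') (hyy : y ≠ y') :
    ∃ π : Equiv.Perm V, (∀ v ∈ T, π v = v) ∧ π x = y ∧ π x' = y' := by
  set w := Equiv.swap x y x' with hw
  have hwy : w ≠ y := by
    rw [hw, Ne, Equiv.swap_apply_eq_iff, Equiv.swap_apply_right]; exact hxx.symm
  have hfix : ∀ v ∈ T, Equiv.swap x y v = v := fun v hv =>
    Equiv.swap_apply_of_ne_of_ne (by rintro rfl; exact hx hv) (by rintro rfl; exact hy hv)
  have hwT : w ∉ T := fun h => by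
    have h1 := hfix w h
    rw [hw, Equiv.swap_apply_self, ← hw] at h1
    exact hx' (h1 ▸ h)
  refine ⟨(Equiv.swap x y).trans (Equiv.swap w y'), fun v hv => ?_, ?_, ?_⟩
  · rw [Equiv.trans_apply, hfix v hv]
    exact Equiv.swap_apply_of_ne_of_ne (by rintro rfl; exact hwT hv) (by rintro rfl; exact hy' hv)
  · rw [Equiv.trans_apply, Equiv.swap_apply_left, Equiv.swap_apply_of_ne_of_ne hwy.symm hyy]
  · rw [Equiv.trans_apply, ← hw, Equiv.swap_apply_left]

theorem IsProper.comp_perm {f : V → V → C} (hf : IsProper Finset.univ f) (π : Equiv.Perm V) :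
    IsProper Finset.univ fun a b => f (π a) (π b) :=
  ⟨fun _ _ => hf.1 _ _, fun a _ b _ b' _ h1 h2 h => π.injective (hf.2 (π a) (Finset.mem_univ _)
    (π b) (Finset.mem_univ _) (π b') (Finset.mem_univ _) (π.injective.ne h1) (π.injective.ne h2) h)⟩

theorem Completable.of_identify (hC : Fintype.card C + 1 = Fintype.card V)
    (hV : Even (Fintype.card V)) (hH : IsPrecoloring H) (hx : IsLeaf H x u c)
    (hx' : IsLeaf H x' u' c') (huu : u ≠ u') (hcc : c ≠ c') {z : ℕ} (hz : 1 ≤ z)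
    (hsupp : (covered H).card + z = Fintype.card V)
    (hρ : (H.filter fun p => ((p.1 ≠ x ∧ p.1 ≠ x') ∧ p.2.1 ≠ x ∧ p.2.1 ≠ x') ∧
      p.2.2 ≠ c ∧ p.2.2 ≠ c').card < (z + 2) * (z + 1))
    (hext : Completable (identify H x u c x' u' c')) : Completable H := by
  obtain ⟨h1, h2, h3, h4, h5⟩ := hx.nbr_ne hH hx' huu hcc
  obtain ⟨f, hf, hfH⟩ := hext
  set T := ((covered H).erase x).erase x' with hT
  have hmT : ∀ a, a ∈ T ↔ a ∈ covered H ∧ a ≠ x ∧ a ≠ x' := by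
    intro a; rw [hT, Finset.mem_erase, Finset.mem_erase]; tauto
  have hxs : x ∈ covered H := mem_covered.2 ⟨_, _, hx.1⟩
  have hxs' : x' ∈ covered H := mem_covered.2 ⟨_, _, hx'.1⟩
  have hus : u ∈ T := (hmT u).2 ⟨mem_covered.2 ⟨_, _, hH.symm _ _ _ hx.1⟩, h2, h3⟩
  have hus' : u' ∈ T := (hmT u').2 ⟨mem_covered.2 ⟨_, _, hH.symm _ _ _ hx'.1⟩, h4, h5⟩
  have hxT : x ∉ T := fun h => ((hmT x).1 h).2.1 rfl
  have hxT' : x' ∉ T := fun h => ((hmT x').1 h).2.2 rfl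
  have hTcard : T.card + (z + 2) = Fintype.card V := by
    have e1 := Finset.card_erase_of_mem hxs
    have e2 := Finset.card_erase_of_mem (Finset.mem_erase.2 ⟨h1.symm, hxs'⟩)
    have e3 : 0 < ((covered H).erase x).card :=
      Finset.card_pos.2 ⟨_, Finset.mem_erase.2 ⟨h1.symm, hxs'⟩⟩
    have e4 : 0 < (covered H).card := Finset.card_pos.2 ⟨_, hxs⟩
    rw [hT]; omega
  have hfu : f u x = c := hfH _ _ _ (mem_identify.2 (by simp))
  have hfu' : f u' x = c' := hfH _ _ _ (mem_identify.2 (by simp))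
  set R := (H.filter fun p => (p.1 ≠ x ∧ p.1 ≠ x') ∧ p.2.1 ≠ x ∧ p.2.1 ≠ x').image
    fun p => (p.1, p.2.1) with hR
  have hmR : ∀ a b, (a, b) ∈ R ↔ ∃ k, (a, b, k) ∈ H ∧ (a ≠ x ∧ a ≠ x') ∧ b ≠ x ∧ b ≠ x' := by
    intro a b
    rw [hR, Finset.mem_image]
    constructor
    · rintro ⟨⟨a', b', k⟩, h, he⟩
      obtain ⟨rfl, rfl⟩ : a' = a ∧ b' = b := by simpa using he
      exact ⟨k, by simpa using h⟩
    · rintro ⟨k, h⟩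
      exact ⟨(a, b, k), by simpa using h, rfl⟩
  have hfR : ∀ a b k, (a, b, k) ∈ H → (a, b) ∈ R → f a b = k := by
    intro a b k h h'
    obtain ⟨k', h6, h7⟩ := (hmR a b).1 h'
    exact hfH _ _ _ (mem_identify.2 (Or.inl ⟨h, h7⟩))
  have hmiss : ∀ v k, v ∈ T → f v x = k → v ∈ miss T f k := by
    intro v k hv hk
    refine mem_miss.2 ⟨hv, fun w hw hwv hfw => hxT ?_⟩
    rw [← hk] at hfw
    have := hf.2 v (Finset.mem_univ _) w (Finset.mem_univ _) x (Finset.mem_univ _) hwv.symm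
      (by rintro rfl; exact hxT hv) hfw
    exact this ▸ hw
  obtain ⟨g, hg, hgR, y, y', hy, hy', hyy, hgy, hgy'⟩ := hf.exists_separated_of_symm hC hV hTcard
    (by omega) (R := R) (u := u) (u' := u') (c := c) (c' := c')
    (by
      rintro ⟨a, b⟩ he
      obtain ⟨k, h6, h7, h8⟩ := (hmR a b).1 he
      exact ⟨(hmT a).2 ⟨mem_covered.2 ⟨_, _, h6⟩, h7⟩,
        (hmT b).2 ⟨mem_covered.2 ⟨_, _, hH.symm _ _ _ h6⟩, h8⟩, hH.ne _ _ _ h6⟩)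
    (by
      rintro ⟨a, b⟩ he
      obtain ⟨k, h6, h7, h8⟩ := (hmR a b).1 he
      exact (hmR b a).2 ⟨k, hH.symm _ _ _ h6, h8, h7⟩)
    huu
    (by
      refine lt_of_le_of_lt ?_ hρ
      refine (Finset.card_le_card ?_).trans (Finset.card_image_le (f := fun p => (p.1, p.2.1)))
      rintro ⟨a, b⟩ he
      obtain ⟨he, he'⟩ := Finset.mem_filter.1 he
      obtain ⟨k, h6, h7⟩ := (hmR a b).1 he
      rw [hfR a b k h6 he] at he'
      exact Finset.mem_image.2 ⟨(a, b, k), Finset.mem_filter.2 ⟨h6, h7, he'⟩, rfl⟩)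
    (hmiss u c hus hfu) (hmiss u' c' hus' hfu')
  obtain ⟨π, hπ, hπx, hπx'⟩ := exists_perm_of_two hxT hxT' hy hy' h1 hyy
  refine ⟨fun a b => g (π a) (π b), hg.comp_perm π, fun a b k h => ?_⟩
  have ha : a ∈ covered H := mem_covered.2 ⟨_, _, h⟩
  have hb : b ∈ covered H := mem_covered.2 ⟨_, _, hH.symm _ _ _ h⟩
  have key : ∀ a b k, (a, b, k) ∈ H → (a = x ∨ a = x') → g (π a) (π b) = k := by
    rintro a b k h (rfl | rfl)
    · obtain ⟨rfl, rfl⟩ := hx.2 _ _ h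
      rw [hπx, hπ _ hus, hg.1, hgy]
    · obtain ⟨rfl, rfl⟩ := hx'.2 _ _ h
      rw [hπx', hπ _ hus', hg.1, hgy']
  by_cases h6 : a = x ∨ a = x'
  · exact key a b k h h6
  by_cases h7 : b = x ∨ b = x'
  · simp only []
    rw [hg.1]
    exact key b a k (hH.symm _ _ _ h) h7
  push Not at h6 h7
  simp only []
  rw [hπ a ((hmT a).2 ⟨ha, h6⟩), hπ b ((hmT b).2 ⟨hb, h7⟩)]
  have hab : (a, b) ∈ R := (hmR a b).2 ⟨k, h, h6, h7⟩
  rw [hgR (a, b) hab, hfR a b k h hab]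

end

section

variable {V C : Type} [DecidableEq V] [DecidableEq C] {H : Finset (V × V × C)}

/-- The number of precolored edges at `u`. -/
def valency (H : Finset (V × V × C)) (u : V) : ℕ := (H.filter fun p => p.1 = u).card

theorem sum_valency (H : Finset (V × V × C)) : ∑ u ∈ covered H, valency H u = H.card :=
  (Finset.card_eq_sum_card_fiberwise fun _ hp => Finset.mem_image_of_mem _ hp).symm

theorem one_le_valency {u : V} (hu : u ∈ covered H) : 1 ≤ valency H u := by
  obtain ⟨v, c, h⟩ := mem_covered.1 hu
  exact Finset.card_pos.2 ⟨_, Finset.mem_filter.2 ⟨h, rfl⟩⟩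

theorem two_le_valency {u : V} (hu : u ∈ covered H) (h : ¬ ∃ v c, IsLeaf H u v c) :
    2 ≤ valency H u := by
  obtain ⟨v, c, h1⟩ := mem_covered.1 hu
  push Not at h
  have h2 : ∃ w k, (u, w, k) ∈ H ∧ ¬ (w = v ∧ k = c) := by
    by_contra! h3
    exact h v c ⟨h1, h3⟩
  obtain ⟨w, k, h3, h4⟩ := h2
  refine Finset.one_lt_card.2 ⟨(u, v, c), Finset.mem_filter.2 ⟨h1, rfl⟩, (u, w, k),
    Finset.mem_filter.2 ⟨h3, rfl⟩, fun h => h4 ?_⟩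
  simp only [Prod.mk.injEq] at h
  exact ⟨h.2.1.symm, h.2.2.symm⟩

open Classical in
/-- The vertices of degree one. -/
noncomputable def leaves (H : Finset (V × V × C)) : Finset V :=
  (covered H).filter fun x => ∃ v c, IsLeaf H x v c

theorem mem_leaves {x : V} : x ∈ leaves H ↔ ∃ v c, IsLeaf H x v c := by
  classical
  rw [leaves, Finset.mem_filter, and_iff_right_iff_imp]
  rintro ⟨v, c, h⟩
  exact mem_covered.2 ⟨v, c, h.1⟩

theorem leaves_subset : leaves H ⊆ covered H := by
  classical exact Finset.filter_subset _ _

theorem two_mul_card_covered_le (H : Finset (V × V × C)) :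
    2 * (covered H).card ≤ H.card + (leaves H).card := by
  classical
  rw [← sum_valency, leaves, Finset.card_filter, ← Finset.sum_add_distrib, mul_comm, ← smul_eq_mul]
  refine Finset.card_nsmul_le_sum _ _ _ fun u hu => ?_
  split_ifs with h
  · have := one_le_valency hu; omega
  · have := two_le_valency hu h; omega

theorem two_mul_card_covered_le_of_star {w : V} (hH : IsPrecoloring H) (hw : w ∉ leaves H)
    (h : ∀ x v c, IsLeaf H x v c → v = w) (hne : (leaves H).Nonempty) :
    2 * (covered H).card ≤ H.card + 2 := by
  classical
  have hws : w ∈ covered H := by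
    obtain ⟨x, hx⟩ := hne
    obtain ⟨v, c, hx⟩ := mem_leaves.1 hx
    obtain rfl := h x v c hx
    exact mem_covered.2 ⟨x, c, hH.symm _ _ _ hx.1⟩
  have h1 : (leaves H).card ≤ valency H w := by
    have : ∀ x, ∃ c, x ∈ leaves H → (w, x, c) ∈ H := by
      intro x
      by_cases hx : x ∈ leaves H
      · obtain ⟨v, c, hx'⟩ := mem_leaves.1 hx
        obtain rfl := h x v c hx'
        exact ⟨c, fun _ => hH.symm _ _ _ hx'.1⟩
      · obtain ⟨y, hy⟩ := hne
        obtain ⟨v, c, hy'⟩ := mem_leaves.1 hy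
        exact ⟨c, fun h => absurd h hx⟩
    choose c hc using this
    refine Finset.card_le_card_of_injOn (fun x => (w, x, c x)) (fun x hx => ?_) ?_
    · exact Finset.mem_coe.2 (Finset.mem_filter.2 ⟨hc x hx, rfl⟩)
    · intro x _ y _ hxy
      simp only [Prod.mk.injEq] at hxy
      exact hxy.2.1
  have h2 : 2 * ((covered H).erase w).card ≤
      ∑ u ∈ (covered H).erase w, valency H u + (leaves H).card := by
    have : (leaves H).card =
        (((covered H).erase w).filter fun x => ∃ v c, IsLeaf H x v c).card := by
      congr 1
      ext x
      rw [Finset.mem_filter, Finset.mem_erase, mem_leaves]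
      refine ⟨fun hx => ⟨⟨?_, leaves_subset (mem_leaves.2 hx)⟩, hx⟩, fun hx => hx.2⟩
      rintro rfl
      exact hw (mem_leaves.2 hx)
    rw [this, Finset.card_filter, ← Finset.sum_add_distrib, mul_comm, ← smul_eq_mul]
    refine Finset.card_nsmul_le_sum _ _ _ fun u hu => ?_
    have hu := Finset.mem_of_mem_erase hu
    split_ifs with h
    · have := one_le_valency hu; omega
    · have := two_le_valency hu h; omega
  have h3 := Finset.add_sum_erase _ (valency H) hws
  have h4 := Finset.card_erase_add_one hws
  rw [sum_valency] at h3
  omega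

/-- No two vertices of `I` are joined by a precolored edge. -/
def IsIndependent (H : Finset (V × V × C)) (I : Finset V) : Prop :=
  ∀ x ∈ I, ∀ y ∈ I, ∀ c, (x, y, c) ∉ H

/-- A set of leaves, no two of them adjacent, containing at least half of all leaves. -/
theorem exists_independent_leaves (hH : IsPrecoloring H) :
    ∃ I ⊆ leaves H, (leaves H).card ≤ 2 * I.card ∧ IsIndependent H I := by
  classical
  obtain ⟨I, hI, hmax⟩ := Finset.exists_max_image
    ((leaves H).powerset.filter (IsIndependent H)) Finset.card
    ⟨∅, by simp [IsIndependent]⟩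
  rw [Finset.mem_filter, Finset.mem_powerset] at hI
  refine ⟨I, hI.1, ?_, hI.2⟩
  have h1 : ∀ x, ∃ y, x ∈ leaves H \ I → y ∈ I ∧ ∃ c, (x, y, c) ∈ H := by
    intro x
    by_cases hx : x ∈ leaves H \ I
    · obtain ⟨hx, hxI⟩ := Finset.mem_sdiff.1 hx
      by_contra! hno
      have h2 := hmax (insert x I) (by
        rw [Finset.mem_filter, Finset.mem_powerset]
        refine ⟨Finset.insert_subset hx hI.1, fun a ha b hb c h => ?_⟩
        rcases Finset.mem_insert.1 ha with rfl | ha' <;>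
        rcases Finset.mem_insert.1 hb with rfl | hb'
        · exact hH.ne _ _ _ h rfl
        · exact (hno b).2 hb' c h
        · exact (hno a).2 ha' c (hH.symm _ _ _ h)
        · exact hI.2 a ha' b hb' c h)
      rw [Finset.card_insert_of_notMem hxI] at h2
      omega
    · exact ⟨x, fun h => absurd h hx⟩
  choose y hy using h1
  have h2 : (leaves H \ I).card ≤ I.card := by
    refine Finset.card_le_card_of_injOn y (fun x hx => (hy x hx).1) fun a ha b hb hab => ?_
    obtain ⟨h3, c, h4⟩ := hy a ha
    obtain ⟨h5, d, h6⟩ := hy b hb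
    rw [← hab] at h6
    obtain ⟨v, k, h7⟩ := mem_leaves.1 (hI.1 h3)
    rw [(h7.2 _ _ (hH.symm _ _ _ h4)).1, (h7.2 _ _ (hH.symm _ _ _ h6)).1]
  have h3 := Finset.card_sdiff_add_card_eq_card hI.1
  omega

end

section

variable {V C : Type} [DecidableEq V] [DecidableEq C] {H : Finset (V × V × C)}
variable [Fintype V] [Fintype C]

theorem IsPrecoloring.insertEdge (hH : IsPrecoloring H) {u v : V} {c : C} (huv : u ≠ v)
    (hn : ∀ k, (u, v, k) ∉ H) (hu : ∀ w, (u, w, c) ∉ H) (hv : ∀ w, (v, w, c) ∉ H) :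
    IsPrecoloring (insert (u, v, c) (insert (v, u, c) H)) := by
  have h1 := hH.symm
  have h2 := hH.ne
  have h3 := hH.right
  have h4 := hH.color
  have hm : ∀ a b k, (a, b, k) ∈ insert (u, v, c) (insert (v, u, c) H) ↔
      (a = u ∧ b = v ∧ k = c) ∨ (a = v ∧ b = u ∧ k = c) ∨ (a, b, k) ∈ H := by
    intro a b k; simp [Finset.mem_insert]
  refine ⟨fun a b k h => ?_, fun a b k h => ?_, fun a b b' k h h' => ?_, fun a b k k' h h' => ?_⟩
  · rw [hm] at h ⊢; have := h1 a b k; tauto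
  · rw [hm] at h; grind
  · rw [hm] at h h'
    rcases h with ⟨rfl, rfl, rfl⟩ | ⟨rfl, rfl, rfl⟩ | h <;> grind
  · rw [hm] at h h'
    rcases h with ⟨rfl, rfl, rfl⟩ | ⟨rfl, rfl, rfl⟩ | h <;> grind

theorem exists_free_color {S : Finset V} (hS : 2 * S.card ≤ Fintype.card C + 1)
    {K : Finset (V × V × C)} (hK : IsPrecoloring K) (hKS : ∀ u v c, (u, v, c) ∈ K → v ∈ S)
    (c₀ : C) {u v : V} (hu : u ∈ S) (hv : v ∈ S) (huv : u ≠ v) (hn : ∀ k, (u, v, k) ∉ K) :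
    ∃ c, c ≠ c₀ ∧ (∀ w, (u, w, c) ∉ K) ∧ ∀ w, (v, w, c) ∉ K := by
  have key : ∀ a ∈ S, ∀ b ∈ S, a ≠ b → (∀ k, (a, b, k) ∉ K) →
      ((K.filter fun p => p.1 = a).image fun p => p.2.2).card + 2 ≤ S.card := by
    intro a ha b hb hab hn
    have h1 : (K.filter fun p => p.1 = a).card ≤ ((S.erase a).erase b).card := by
      refine Finset.card_le_card_of_injOn (fun p => p.2.1) ?_ ?_
      · rintro ⟨a', w, k⟩ hp
        obtain ⟨hp1, rfl⟩ := Finset.mem_filter.1 (Finset.mem_coe.1 hp)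
        refine Finset.mem_coe.2 (Finset.mem_erase.2 ⟨?_, Finset.mem_erase.2
          ⟨(hK.ne _ _ _ hp1).symm, hKS _ _ _ hp1⟩⟩)
        rintro rfl
        exact hn _ hp1
      · rintro ⟨a', w, k⟩ hp ⟨a'', w', k'⟩ hp' (rfl : w = w')
        obtain ⟨hp1, rfl⟩ := Finset.mem_filter.1 (Finset.mem_coe.1 hp)
        obtain ⟨hp2, h⟩ := Finset.mem_filter.1 (Finset.mem_coe.1 hp')
        simp only at h
        subst h
        rw [hK.color _ _ _ _ hp1 hp2]
    have h2 := Finset.card_erase_add_one ha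
    have h3 := Finset.card_erase_add_one (Finset.mem_erase.2 ⟨hab.symm, hb⟩)
    have h4 := Finset.card_image_le (s := K.filter fun p => p.1 = a) (f := fun p => p.2.2)
    omega
  have h1 := key u hu v hv huv hn
  have h2 := key v hv u hu huv.symm fun k h => hn k (hK.symm _ _ _ h)
  obtain ⟨F, hF⟩ : ∃ F, F = insert c₀ (((K.filter fun p => p.1 = u).image fun p => p.2.2) ∪
    (K.filter fun p => p.1 = v).image fun p => p.2.2) := ⟨_, rfl⟩
  have h3 : F.card < Fintype.card C := by
    have h4 := Finset.card_insert_le c₀ (((K.filter fun p => p.1 = u).image fun p => p.2.2) ∪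
      (K.filter fun p => p.1 = v).image fun p => p.2.2)
    have h5 := Finset.card_union_le ((K.filter fun p => p.1 = u).image fun p => p.2.2)
      ((K.filter fun p => p.1 = v).image fun p => p.2.2)
    rw [← hF] at h4
    omega
  obtain ⟨c, hc⟩ : ∃ c, c ∉ F := by
    by_contra! h
    rw [Finset.eq_univ_iff_forall.2 h, Finset.card_univ] at h3
    omega
  simp only [hF, Finset.mem_insert, Finset.mem_union, Finset.mem_image, Finset.mem_filter,
    not_or, not_exists, not_and] at hc
  exact ⟨c, hc.1, fun w h => hc.2.1 (u, w, c) ⟨h, rfl⟩ rfl,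
    fun w h => hc.2.2 (v, w, c) ⟨h, rfl⟩ rfl⟩

/-- Greedy coloring of a small complete graph in which no new edge receives the color `c₀`. -/
theorem IsPrecoloring.exists_greedy (hH : IsPrecoloring H) {S : Finset V}
    (hS : 2 * S.card ≤ Fintype.card C + 1) (hHS : ∀ u v c, (u, v, c) ∈ H → u ∈ S ∧ v ∈ S) (c₀ : C) :
    ∃ f : V → V → C, IsProper S f ∧ (∀ u v c, (u, v, c) ∈ H → f u v = c) ∧
      ∀ u ∈ S, ∀ v ∈ S, u ≠ v → f u v = c₀ → (u, v, c₀) ∈ H := by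
  classical
  obtain ⟨K, hK, hmax⟩ := Finset.exists_max_image
    (Finset.univ.filter fun K : Finset (V × V × C) => IsPrecoloring K ∧ H ⊆ K ∧
      (∀ u v c, (u, v, c) ∈ K → u ∈ S ∧ v ∈ S) ∧ ∀ u v, (u, v, c₀) ∈ K → (u, v, c₀) ∈ H)
    Finset.card ⟨H, Finset.mem_filter.2 ⟨Finset.mem_univ _, hH, subset_rfl, hHS, fun _ _ h => h⟩⟩
  obtain ⟨hK, hHK, hKS, hK0⟩ := (Finset.mem_filter.1 hK).2
  have hall : ∀ u ∈ S, ∀ v ∈ S, u ≠ v → ∃ c, (u, v, c) ∈ K := by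
    intro u hu v hv huv
    by_contra! hn
    obtain ⟨c, hc0, hcu, hcv⟩ := exists_free_color hS hK (fun u v c h => (hKS u v c h).2) c₀ hu hv
      huv hn
    have h1 := hmax (insert (u, v, c) (insert (v, u, c) K)) (by
      refine Finset.mem_filter.2 ⟨Finset.mem_univ _, hK.insertEdge huv hn hcu hcv,
        hHK.trans ((Finset.subset_insert _ _).trans (Finset.subset_insert _ _)),
        fun a b k h => ?_, fun a b h => ?_⟩
      · rw [Finset.mem_insert, Finset.mem_insert, Prod.mk.injEq, Prod.mk.injEq, Prod.mk.injEq,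
          Prod.mk.injEq] at h
        rcases h with ⟨rfl, rfl, -⟩ | ⟨rfl, rfl, -⟩ | h
        exacts [⟨hu, hv⟩, ⟨hv, hu⟩, hKS _ _ _ h]
      · rw [Finset.mem_insert, Finset.mem_insert, Prod.mk.injEq, Prod.mk.injEq, Prod.mk.injEq,
          Prod.mk.injEq] at h
        rcases h with ⟨-, -, rfl⟩ | ⟨-, -, rfl⟩ | h
        exacts [absurd rfl hc0, absurd rfl hc0, hK0 _ _ h])
    rw [Finset.card_insert_of_notMem, Finset.card_insert_of_notMem] at h1
    · omega
    · exact fun h => hn c (hK.symm _ _ _ h)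
    · rw [Finset.mem_insert, not_or, Prod.mk.injEq]
      exact ⟨fun h => huv h.1, hn c⟩
  set f : V → V → C := fun u v => if h : ∃ c, (u, v, c) ∈ K then h.choose else c₀ with hf
  have hfK : ∀ u v c, (u, v, c) ∈ K → f u v = c := by
    intro u v c h
    have h1 : ∃ c, (u, v, c) ∈ K := ⟨c, h⟩
    rw [hf]; simp only
    rw [dif_pos h1]
    exact hK.color _ _ _ _ h1.choose_spec h
  refine ⟨f, ⟨fun u v => ?_, fun u hu v hv w hw huv huw h => ?_⟩, fun u v c h => hfK _ _ _ (hHK h),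
    fun u hu v hv huv h => ?_⟩
  · by_cases h : ∃ c, (u, v, c) ∈ K
    · obtain ⟨c, h⟩ := h
      rw [hfK _ _ _ h, hfK _ _ _ (hK.symm _ _ _ h)]
    · have h' : ¬ ∃ c, (v, u, c) ∈ K := fun ⟨c, h'⟩ => h ⟨c, hK.symm _ _ _ h'⟩
      rw [hf]; simp only
      rw [dif_neg h, dif_neg h']
  · obtain ⟨c, h1⟩ := hall u hu v hv huv
    obtain ⟨d, h2⟩ := hall u hu w hw huw
    rw [hfK _ _ _ h1, hfK _ _ _ h2] at h
    exact hK.right u v w c h1 (h ▸ h2)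
  · obtain ⟨c, h1⟩ := hall u hu v hv huv
    rw [hfK _ _ _ h1] at h
    exact hK0 _ _ (h ▸ h1)

/-- A precoloring is completable if it lives on half of the vertices, up to pendant edges of one
color. -/
theorem Completable.of_core (hC : Fintype.card C + 1 = Fintype.card V)
    (hV : Even (Fintype.card V)) (hH : IsPrecoloring H) {S : Finset V}
    (hS : 2 * S.card ≤ Fintype.card V) (c₀ : C)
    (hHS : ∀ u v c, (u, v, c) ∈ H → u ∉ S → v ∈ S ∧ c = c₀) : Completable H := by
  classical
  set K := H.filter fun p => p.1 ∈ S ∧ p.2.1 ∈ S with hKdef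
  have hmK : ∀ u v c, (u, v, c) ∈ K ↔ (u, v, c) ∈ H ∧ u ∈ S ∧ v ∈ S := by
    intro u v c; simp [hKdef]
  have hK : IsPrecoloring K := hH.subset (Finset.filter_subset _ _) fun u v c h => by
    rw [hmK] at h ⊢
    exact ⟨hH.symm _ _ _ h.1, h.2.2, h.2.1⟩
  obtain ⟨f, hf, hfK, hf0⟩ := hK.exists_greedy (S := S) (by omega)
    (fun u v c h => ((hmK u v c).1 h).2) c₀
  obtain ⟨g, hg, hgf⟩ := hf.exists_extension hC hV fun c => by
    have := Finset.card_le_card (miss_subset (T := S) (f := f) c)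
    omega
  have hnb : ∀ u, ∃ v, v ≠ u ∧ g u v = c₀ := fun u => hg.exists_color_eq hC u c₀
  choose nb hnb1 hnb2 using hnb
  have hnbinj : ∀ u v, nb u = nb v → u = v := by
    intro u v h
    have h1 : g (nb u) u = g (nb u) v := by
      rw [hg.1, hnb2, h, hg.1, hnb2]
    exact hg.2 _ (Finset.mem_univ _) _ (Finset.mem_univ _) _ (Finset.mem_univ _) (hnb1 u)
      (h ▸ hnb1 v) h1
  have hcross : ∀ u a, (u, a, c₀) ∈ H → u ∈ S → a ∉ S → nb u ∉ S := by
    intro u a h hu ha hn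
    have h1 := hf0 u hu _ hn (hnb1 u).symm (by rw [← hgf u hu _ hn, hnb2])
    exact ha (hH.right _ _ _ _ ((hmK _ _ _).1 h1).1 h ▸ hn)
  have hψ : ∀ a, ∃ b, (a ∈ S → b = a) ∧ ∀ u, u ∈ S → a ∉ S → (u, a, c₀) ∈ H → b = nb u := by
    intro a
    by_cases ha : a ∈ S
    · exact ⟨a, fun _ => rfl, fun u _ h => absurd ha h⟩
    by_cases hu : ∃ u, (u, a, c₀) ∈ H
    · obtain ⟨u, hu⟩ := hu
      refine ⟨nb u, fun h => absurd h ha, fun v _ _ hv => ?_⟩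
      rw [hH.right _ _ _ _ (hH.symm _ _ _ hu) (hH.symm _ _ _ hv)]
    · exact ⟨a, fun _ => rfl, fun u _ _ h => absurd ⟨u, h⟩ hu⟩
  choose ψ hψ1 hψ2 using hψ
  set D := S ∪ Finset.univ.filter fun a => a ∉ S ∧ ∃ u ∈ S, (u, a, c₀) ∈ H with hD
  have hmD : ∀ a, a ∈ D ↔ a ∈ S ∨ a ∉ S ∧ ∃ u ∈ S, (u, a, c₀) ∈ H := by
    intro a; simp [hD]
  have hinj : Set.InjOn ψ D := by
    intro a ha b hb hab
    rcases (hmD a).1 (Finset.mem_coe.1 ha) with ha | ⟨ha, u, hu, hua⟩ <;>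
    rcases (hmD b).1 (Finset.mem_coe.1 hb) with hb | ⟨hb, v, hv, hvb⟩
    · rwa [hψ1 a ha, hψ1 b hb] at hab
    · rw [hψ1 a ha, hψ2 b v hv hb hvb] at hab
      exact absurd (hab ▸ ha) (hcross v b hvb hv hb)
    · rw [hψ1 b hb, hψ2 a u hu ha hua] at hab
      exact absurd (hab ▸ hb) (hcross u a hua hu ha)
    · rw [hψ2 a u hu ha hua, hψ2 b v hv hb hvb] at hab
      obtain rfl := hnbinj _ _ hab
      exact hH.right _ _ _ _ hua hvb
  obtain ⟨e, he⟩ := Finset.exists_equiv_extend_of_card_eq (t := (Finset.univ : Finset V))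
    Finset.card_univ.symm (Finset.subset_univ _) hinj
  set π : Equiv.Perm V := e.trans (Equiv.subtypeUnivEquiv Finset.mem_univ) with hπdef
  have hπ : ∀ a ∈ D, π a = ψ a := fun a ha => he a ha
  have hπS : ∀ a ∈ S, π a = a := fun a ha => by
    rw [hπ a ((hmD a).2 (Or.inl ha)), hψ1 a ha]
  have key : ∀ u a c, (u, a, c) ∈ H → u ∈ S → a ∉ S → g u (π a) = c := by
    intro u a c h hu ha
    obtain ⟨-, rfl⟩ := hHS _ _ _ (hH.symm _ _ _ h) ha
    rw [hπ a ((hmD a).2 (Or.inr ⟨ha, u, hu, h⟩)), hψ2 a u hu ha h, hnb2]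
  refine ⟨fun a b => g (π a) (π b), hg.comp_perm π, fun u v c h => ?_⟩
  simp only
  by_cases hu : u ∈ S <;> by_cases hv : v ∈ S
  · rw [hπS u hu, hπS v hv, hgf u hu v hv]
    exact hfK _ _ _ ((hmK _ _ _).2 ⟨h, hu, hv⟩)
  · rw [hπS u hu]; exact key u v c h hu hv
  · rw [hπS v hv, hg.1]; exact key v u c (hH.symm _ _ _ h) hv hu
  · exact absurd (hHS _ _ _ h hu).1 hv

/-- A precoloring without a pair of leaves to identify is completable. -/
theorem Completable.of_leaves (hC : Fintype.card C + 1 = Fintype.card V)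
    (hV : Even (Fintype.card V)) (hH : IsPrecoloring H) (hcard : H.card ≤ Fintype.card V)
    (hl : ∀ x u c x' u' c', IsLeaf H x u c → IsLeaf H x' u' c' → u ≠ u' → c = c') :
    Completable H := by
  classical
  have h0 := two_mul_card_covered_le H
  by_cases hone : ∃ c₀, ∀ x u c, IsLeaf H x u c → c = c₀
  · obtain ⟨c₀, hone⟩ := hone
    obtain ⟨I, hI, hI2, hind⟩ := exists_independent_leaves hH
    refine Completable.of_core hC hV hH (S := covered H \ I) ?_ c₀ fun u v c h hu => ?_
    · rw [Finset.card_sdiff_of_subset (hI.trans leaves_subset)]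
      omega
    · have hu' : u ∈ I := by
        by_contra hu'
        exact hu (Finset.mem_sdiff.2 ⟨mem_covered.2 ⟨_, _, h⟩, hu'⟩)
      refine ⟨Finset.mem_sdiff.2 ⟨mem_covered.2 ⟨_, _, hH.symm _ _ _ h⟩, fun hv =>
        hind u hu' v hv c h⟩, ?_⟩
      obtain ⟨w, k, hw⟩ := mem_leaves.1 (hI hu')
      rw [(hw.2 _ _ h).2, hone _ _ _ hw]
  · push Not at hone
    have : Nonempty C := by
      refine Fintype.card_pos_iff.1 (Nat.pos_of_ne_zero fun h => ?_)
      rw [h] at hC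
      rw [← hC] at hV
      exact absurd hV (by decide)
    obtain ⟨x, u, c, hx, -⟩ := hone (Classical.arbitrary C)
    obtain ⟨x', u', c', hx', hcc⟩ := hone c
    have huu : u = u' := by
      by_contra huu
      exact hcc (hl _ _ _ _ _ _ hx hx' huu).symm
    subst huu
    have hstar : ∀ y v k, IsLeaf H y v k → v = u := by
      intro y v k hy
      by_contra hvu
      exact hcc ((hl _ _ _ _ _ _ hy hx' hvu).symm.trans (hl _ _ _ _ _ _ hy hx hvu))
    have hu : u ∉ leaves H := by
      intro hu
      obtain ⟨v, k, h⟩ := mem_leaves.1 hu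
      exact hcc ((h.2 _ _ (hH.symm _ _ _ hx'.1)).2.trans (h.2 _ _ (hH.symm _ _ _ hx.1)).2.symm)
    have h1 := two_mul_card_covered_le_of_star hH hu hstar ⟨x, mem_leaves.2 ⟨_, _, hx⟩⟩
    have hxs : x ∈ covered H := mem_covered.2 ⟨_, _, hx.1⟩
    have h2 := Finset.card_erase_add_one hxs
    refine Completable.of_core hC hV hH (S := (covered H).erase x) (by omega) c fun a v k h ha => ?_
    have hax : a = x := by
      by_contra hax
      exact ha (Finset.mem_erase.2 ⟨hax, mem_covered.2 ⟨_, _, h⟩⟩)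
    subst hax
    exact ⟨Finset.mem_erase.2 ⟨(hH.ne _ _ _ h).symm, mem_covered.2 ⟨_, _, hH.symm _ _ _ h⟩⟩,
      (hx.2 _ _ h).2⟩

end

section

variable {α β C : Type} [DecidableEq α] [DecidableEq β] [DecidableEq C]

/-- An injection of a subset of `S` into `W` extends to an injection of `S` into `W`. -/
theorem exists_injOn_extension [Nonempty β] {S : Finset α} {W : Finset β} (hSW : S.card = W.card)
    {E : Finset α} (hE : E ⊆ S) (e : α → β) (he : ∀ s ∈ E, e s ∈ W) (hinj : Set.InjOn e E) :
    ∃ σ : α → β, (∀ s ∈ E, σ s = e s) ∧ (∀ s ∈ S, σ s ∈ W) ∧ Set.InjOn σ S := by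
  obtain ⟨g, hg⟩ := Finset.exists_equiv_extend_of_card_eq (α := S) (t := W)
    (by rw [Fintype.card_coe, hSW]) (s := E.subtype (· ∈ S)) (f := fun s => e s)
    (by
      intro w hw
      obtain ⟨s, hs, rfl⟩ := Finset.mem_image.1 hw
      exact he _ (Finset.mem_subtype.1 hs))
    (by
      intro a ha b hb hab
      exact Subtype.ext (hinj (Finset.mem_subtype.1 ha) (Finset.mem_subtype.1 hb) hab))
  refine ⟨fun s => if h : s ∈ S then g ⟨s, h⟩ else Classical.arbitrary β, fun s hs => ?_,
    fun s hs => ?_, fun a ha b hb hab => ?_⟩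
  · simp only [hE hs, dite_true]
    exact hg ⟨s, hE hs⟩ (Finset.mem_subtype.2 hs)
  · simp only [hs, dite_true]
    exact (g ⟨s, hs⟩).2
  · have ha := Finset.mem_coe.1 ha
    have hb := Finset.mem_coe.1 hb
    simp only [ha, hb, dite_true] at hab
    simpa using g.injective (Subtype.ext hab)

/-- A family of pairwise disjoint perfect matchings of a balanced complete bipartite graph that is
not yet a factorization can be enlarged. -/
theorem exists_disjoint_injOn [Nonempty β] {S : Finset α} {W : Finset β} (hSW : S.card = W.card)
    {D : Finset C} (hD : D.card < S.card) {σ : C → α → β} (hσ : ∀ c ∈ D, ∀ s ∈ S, σ c s ∈ W)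
    (hinj : ∀ c ∈ D, Set.InjOn (σ c) S)
    (hdis : ∀ c ∈ D, ∀ d ∈ D, ∀ s ∈ S, σ c s = σ d s → c = d) :
    ∃ τ : α → β, (∀ s ∈ S, τ s ∈ W) ∧ Set.InjOn τ S ∧ ∀ c ∈ D, ∀ s ∈ S, τ s ≠ σ c s := by
  set N : S → Finset β := fun s => W \ D.image fun c => σ c s with hN
  have hmN : ∀ (s : S) w, w ∈ N s ↔ w ∈ W ∧ ∀ c ∈ D, σ c s ≠ w := by
    intro s w; simp [hN]
  have hHall : ∀ A : Finset S, A.card ≤ (A.biUnion N).card := by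
    intro A
    have h1 : A.card * (S.card - D.card) ≤ (A.biUnion N).card * (S.card - D.card) := by
      refine Finset.card_mul_le_card_mul (fun s w => w ∈ N s) (fun s hs => ?_) (fun w hw => ?_)
      · have h2 : N s ⊆ Finset.bipartiteAbove (fun s w => w ∈ N s) (A.biUnion N) s := fun w hw =>
          Finset.mem_filter.2 ⟨Finset.mem_biUnion.2 ⟨s, hs, hw⟩, hw⟩
        refine le_trans ?_ (Finset.card_le_card h2)
        have h3 := Finset.le_card_sdiff (D.image fun c => σ c s) W
        have h4 := Finset.card_image_le (s := D) (f := fun c => σ c s)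
        simp only [hN]
        omega
      · have hwW : w ∈ W := by
          obtain ⟨s, -, hs⟩ := Finset.mem_biUnion.1 hw
          exact ((hmN s w).1 hs).1
        have h2 : ∀ c, ∃ s, c ∈ D → s ∈ S ∧ σ c s = w := by
          intro c
          by_cases hc : c ∈ D
          · obtain ⟨s, hs, h⟩ := Finset.surjOn_of_injOn_of_card_le (σ c) (hσ c hc) (hinj c hc)
              hSW.ge hwW
            exact ⟨s, fun _ => ⟨hs, h⟩⟩
          · by_contra! h
            have : Nonempty α := by
              obtain ⟨s, -, -⟩ := Finset.mem_biUnion.1 hw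
              exact ⟨s⟩
            exact hc (h (Classical.arbitrary α)).1
        choose p hp using h2
        have h3 : (Finset.bipartiteBelow (fun s w => w ∈ N s) A w).card ≤ (S \ D.image p).card := by
          refine Finset.card_le_card_of_injOn (fun s => (s : α)) (fun s hs => ?_)
            Subtype.val_injective.injOn
          have hs := (Finset.mem_filter.1 (Finset.mem_coe.1 hs)).2
          refine Finset.mem_coe.2 (Finset.mem_sdiff.2 ⟨s.2, fun h => ?_⟩)
          obtain ⟨c, hc, h⟩ := Finset.mem_image.1 h
          have h6 := (hp c hc).2
          rw [h] at h6
          exact ((hmN s w).1 hs).2 c hc h6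
        have h4 : D.image p ⊆ S := by
          intro s hs
          obtain ⟨c, hc, rfl⟩ := Finset.mem_image.1 hs
          exact (hp c hc).1
        have h5 : (D.image p).card = D.card := by
          refine Finset.card_image_of_injOn fun c hc d hd hcd => ?_
          refine hdis c hc d hd (p c) (hp c hc).1 ?_
          rw [(hp c hc).2, hcd, (hp d hd).2]
        rw [Finset.card_sdiff_of_subset h4, h5] at h3
        exact h3
    exact Nat.le_of_mul_le_mul_right h1 (by omega)
  obtain ⟨g, hg, hgN⟩ := (Finset.all_card_le_biUnion_card_iff_exists_injective N).1 hHall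
  refine ⟨fun s => if h : s ∈ S then g ⟨s, h⟩ else Classical.arbitrary β, fun s hs => ?_,
    fun a ha b hb hab => ?_, fun c hc s hs => ?_⟩
  · simp only [hs, dite_true]
    exact ((hmN _ _).1 (hgN ⟨s, hs⟩)).1
  · have ha := Finset.mem_coe.1 ha
    have hb := Finset.mem_coe.1 hb
    simp only [ha, hb, dite_true] at hab
    simpa using hg hab
  · simp only [hs, dite_true]
    exact (((hmN _ _).1 (hgN ⟨s, hs⟩)).2 c hc).symm

/-- Pairwise disjoint perfect matchings of a balanced complete bipartite graph extend to a proper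
edge coloring. -/
theorem exists_latin [Nonempty β] [Nonempty C] {S : Finset α} {W : Finset β} (hSW : S.card = W.card)
    {Z : Finset C} (hZ : Z.card = S.card) {D : Finset C} (hDZ : D ⊆ Z) {σ : C → α → β}
    (hσ : ∀ c ∈ D, ∀ s ∈ S, σ c s ∈ W) (hinj : ∀ c ∈ D, Set.InjOn (σ c) S)
    (hdis : ∀ c ∈ D, ∀ d ∈ D, ∀ s ∈ S, σ c s = σ d s → c = d) :
    ∃ L : α → β → C, (∀ s ∈ S, ∀ w ∈ W, L s w ∈ Z) ∧
      (∀ s ∈ S, ∀ w ∈ W, ∀ w' ∈ W, L s w = L s w' → w = w') ∧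
      (∀ s ∈ S, ∀ s' ∈ S, ∀ w ∈ W, L s w = L s' w → s = s') ∧
      ∀ c ∈ D, ∀ s ∈ S, L s (σ c s) = c := by
  obtain ⟨k, hk⟩ : ∃ k, k = (Z \ D).card := ⟨_, rfl⟩
  induction k generalizing D σ with
  | zero =>
    have hZD : Z ⊆ D := Finset.sdiff_eq_empty_iff_subset.1 (Finset.card_eq_zero.1 hk.symm)
    obtain rfl := Finset.Subset.antisymm hDZ hZD
    rcases S.eq_empty_or_nonempty with rfl | hS
    · rw [Finset.card_empty, Finset.card_eq_zero] at hZ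
      have hW : W = ∅ := by rw [← Finset.card_eq_zero, ← hSW, Finset.card_empty]
      subst hW
      exact ⟨fun _ _ => Classical.arbitrary C, by simp⟩
    have h1 : ∀ s w, ∃ c, s ∈ S → w ∈ W → c ∈ D ∧ σ c s = w := by
      intro s w
      by_cases h : s ∈ S ∧ w ∈ W
      · obtain ⟨c, hc, h'⟩ := Finset.surjOn_of_injOn_of_card_le (s := D) (t := W)
          (fun c => σ c s) (fun c hc => hσ c hc s h.1)
          (fun c hc d hd hcd => hdis c hc d hd s h.1 hcd) (by omega) h.2
        exact ⟨c, fun _ _ => ⟨hc, h'⟩⟩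
      · obtain ⟨c, -⟩ : D.Nonempty := by
          rw [← Finset.card_pos, hZ, Finset.card_pos]; exact hS
        exact ⟨c, fun h1 h2 => absurd ⟨h1, h2⟩ h⟩
    choose L hL using h1
    refine ⟨L, fun s hs w hw => (hL s w hs hw).1, fun s hs w hw w' hw' h => ?_,
      fun s hs s' hs' w hw h => ?_, fun c hc s hs => ?_⟩
    · rw [← (hL s w hs hw).2, h, (hL s w' hs hw').2]
    · have h2 := (hL s w hs hw).2.trans (hL s' w hs' hw).2.symm
      rw [← h] at h2
      exact hinj _ (hL s w hs hw).1 hs hs' h2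
    · have h2 := hL s (σ c s) hs (hσ c hc s hs)
      exact hdis _ h2.1 _ hc s hs h2.2
  | succ k ih =>
    obtain ⟨z, hz⟩ : (Z \ D).Nonempty := Finset.card_pos.1 (by omega)
    obtain ⟨hzZ, hzD⟩ := Finset.mem_sdiff.1 hz
    have h1 := Finset.card_sdiff_add_card_eq_card hDZ
    obtain ⟨τ, hτW, hτinj, hτ⟩ := exists_disjoint_injOn hSW (by omega) hσ hinj hdis
    obtain ⟨L, hL1, hL2, hL3, hL4⟩ := ih (D := insert z D) (σ := fun c => if c = z then τ else σ c)
      (Finset.insert_subset hzZ hDZ)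
      (fun c hc s hs => by
        split_ifs with h
        · exact hτW s hs
        · exact hσ c (Finset.mem_of_mem_insert_of_ne hc h) s hs)
      (fun c hc => by
        split_ifs with h
        · exact hτinj
        · exact hinj c (Finset.mem_of_mem_insert_of_ne hc h))
      (fun c hc d hd s hs h => by
        split_ifs at h with h2 h3 h3
        · rw [h2, h3]
        · exact absurd h (hτ d (Finset.mem_of_mem_insert_of_ne hd h3) s hs)
        · exact absurd h.symm (hτ c (Finset.mem_of_mem_insert_of_ne hc h2) s hs)
        · exact hdis c (Finset.mem_of_mem_insert_of_ne hc h2) d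
            (Finset.mem_of_mem_insert_of_ne hd h3) s hs h)
      (by
        rw [Finset.sdiff_insert, Finset.card_erase_of_mem hz, ← hk]
        rfl)
    refine ⟨L, hL1, hL2, hL3, fun c hc s hs => ?_⟩
    have h2 := hL4 c (Finset.mem_insert_of_mem hc) s hs
    rwa [if_neg (by rintro rfl; exact hzD hc)] at h2

/-- A permutation that moves every element of `E` within `E`. -/
theorem exists_derangement [Fintype α] {E : Finset α} (hE : E.card ≠ 1) :
    ∃ π : Equiv.Perm α, (∀ a ∈ E, π a ∈ E ∧ π a ≠ a) ∧ ∀ a ∉ E, π a = a := by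
  obtain ⟨π, hπ, hs⟩ := E.exists_cycleOn
  refine ⟨π, fun a ha => ⟨hπ.1.mapsTo ha, hπ.apply_ne ?_ ha⟩, fun a ha => ?_⟩
  · have h : E.card ≠ 0 := (Finset.card_pos.2 ⟨a, ha⟩).ne'
    exact Finset.one_lt_card_iff_nontrivial.1 (by omega)
  · by_contra h
    exact ha (hs (Equiv.Perm.mem_support.2 h))

/-- Two disjoint perfect matchings extending given disjoint partial matchings. -/
theorem exists_two_injOn [Fintype α] [Nonempty β] {S : Finset α} {W : Finset β}
    (hSW : S.card = W.card)
    (hS : 4 ≤ S.card) {E E' : Finset α} (hE : E ⊆ S) (hE' : E' ⊆ S) (hEE : Disjoint E E')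
    (h1 : E.card + 2 ≤ S.card) (h2 : E'.card + 2 ≤ S.card) {e : α → β}
    (he : ∀ s ∈ E ∪ E', e s ∈ W) (hinj : Set.InjOn e (E ∪ E' : Finset α)) :
    ∃ σ σ' : α → β, (∀ s ∈ E, σ s = e s) ∧ (∀ s ∈ E', σ' s = e s) ∧ (∀ s ∈ S, σ s ∈ W) ∧
      (∀ s ∈ S, σ' s ∈ W) ∧ Set.InjOn σ S ∧ Set.InjOn σ' S ∧ ∀ s ∈ S, σ s ≠ σ' s := by
  obtain ⟨τ, hτ, hτW, hτinj⟩ := exists_injOn_extension hSW (Finset.union_subset hE hE') e he hinj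
  have hsub : E ⊆ S \ E' := fun a ha =>
    Finset.mem_sdiff.2 ⟨hE ha, Finset.disjoint_left.1 hEE ha⟩
  have hcard := Finset.card_sdiff_add_card_eq_card hE'
  have hcard' := Finset.card_le_card hsub
  obtain ⟨F, hEF, hFS, hF⟩ := Finset.exists_subsuperset_card_eq hsub (n := max E.card 2)
    (le_max_left _ _) (by omega)
  have hFS' : F ⊆ S := hFS.trans Finset.sdiff_subset
  have hcard'' := Finset.card_sdiff_add_card_eq_card hFS'
  obtain ⟨π, hπ, hπ'⟩ := exists_derangement (E := F) (by omega)
  obtain ⟨ρ, hρ, hρ'⟩ := exists_derangement (E := S \ F) (by omega)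
  have hπS : ∀ s ∈ S, π s ∈ S := by
    intro s hs
    by_cases h : s ∈ F
    · exact hFS' (hπ s h).1
    · rwa [hπ' s h]
  have hρS : ∀ s ∈ S, ρ s ∈ S := by
    intro s hs
    by_cases h : s ∈ F
    · rwa [hρ' s fun h' => (Finset.mem_sdiff.1 h').2 h]
    · exact (Finset.mem_sdiff.1 (hρ s (Finset.mem_sdiff.2 ⟨hs, h⟩)).1).1
  refine ⟨fun s => τ (ρ s), fun s => τ (π s), fun s hs => ?_, fun s hs => ?_,
    fun s hs => hτW _ (hρS s hs), fun s hs => hτW _ (hπS s hs),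
    fun a ha b hb h => ρ.injective (hτinj (hρS a ha) (hρS b hb) h),
    fun a ha b hb h => π.injective (hτinj (hπS a ha) (hπS b hb) h), fun s hs h => ?_⟩
  · simp only
    rw [hρ' s fun h => (Finset.mem_sdiff.1 h).2 (hEF hs), hτ s (Finset.mem_union_left _ hs)]
  · simp only
    rw [hπ' s fun h => (Finset.mem_sdiff.1 (hFS h)).2 hs, hτ s (Finset.mem_union_right _ hs)]
  · have h := hτinj (hρS s hs) (hπS s hs) h
    by_cases hs' : s ∈ F
    · rw [hρ' s fun h' => (Finset.mem_sdiff.1 h').2 hs'] at h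
      exact (hπ s hs').2 h.symm
    · rw [hπ' s hs'] at h
      exact (hρ s (Finset.mem_sdiff.2 ⟨hs, hs'⟩)).2 h

/-- A perfect matching that maps `D` to `D'` and avoids a given perfect matching `I`. -/
theorem exists_injOn_avoiding [Fintype α] [Nonempty β] {S : Finset α} {W : Finset β}
    (hSW : S.card = W.card) {D : Finset α} {D' : Finset β} (hD : D ⊆ S) (hD' : D' ⊆ W)
    (hDD : D.card = D'.card) {I : α → β} (hI : Set.InjOn I S)
    (hone : D.card = 1 → ∀ s ∈ D, I s ∉ D') (hco : D.card + 1 ≠ S.card) :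
    ∃ σ : α → β, (∀ s ∈ S, σ s ∈ W) ∧ Set.InjOn σ S ∧ (∀ s ∈ D, σ s ∈ D') ∧
      ∀ s ∈ S, σ s ≠ I s := by
  have hc := Finset.card_sdiff_add_card_eq_card hD
  have hc' := Finset.card_sdiff_add_card_eq_card hD'
  obtain ⟨a, ha, haD, hainj⟩ := exists_injOn_extension hDD
    (Finset.filter_subset (fun s => I s ∈ D') D) I (fun s hs => (Finset.mem_filter.1 hs).2)
    (hI.mono fun s hs => hD (Finset.mem_filter.1 hs).1)
  obtain ⟨b, hb, hbD, hbinj⟩ := exists_injOn_extension (S := S \ D) (W := W \ D') (by omega)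
    (Finset.filter_subset (fun s => I s ∈ W \ D') (S \ D)) I
    (fun s hs => (Finset.mem_filter.1 hs).2)
    (hI.mono fun s hs => (Finset.mem_sdiff.1 (Finset.mem_filter.1 hs).1).1)
  obtain ⟨π, hπ, hπ'⟩ : ∃ π : Equiv.Perm α, (∀ s ∈ D, π s ∈ D) ∧
      ∀ s ∈ D, I s ∈ D' → π s ≠ s := by
    by_cases h : D.card = 1
    · exact ⟨1, fun s hs => hs, fun s hs h' => absurd h' (hone h s hs)⟩
    · obtain ⟨π, hπ, -⟩ := exists_derangement h
      exact ⟨π, fun s hs => (hπ s hs).1, fun s hs _ => (hπ s hs).2⟩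
  obtain ⟨ρ, hρ, -⟩ := exists_derangement (E := S \ D) (by omega)
  have h1 : ∀ s ∈ S, s ∉ D → ρ s ∈ S \ D ∧ ρ s ≠ s := fun s hs h =>
    hρ s (Finset.mem_sdiff.2 ⟨hs, h⟩)
  refine ⟨fun s => if s ∈ D then a (π s) else b (ρ s), fun s hs => ?_, fun s hs t ht hst => ?_,
    fun s hs => ?_, fun s hs => ?_⟩
  · simp only
    split_ifs with h
    · exact hD' (haD _ (hπ s h))
    · exact (Finset.mem_sdiff.1 (hbD _ (h1 s hs h).1)).1
  · simp only at hst
    have hs := Finset.mem_coe.1 hs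
    have ht := Finset.mem_coe.1 ht
    split_ifs at hst with h h' h'
    · exact π.injective (hainj (hπ s h) (hπ t h') hst)
    · exact absurd (hst ▸ haD _ (hπ s h)) (Finset.mem_sdiff.1 (hbD _ (h1 t ht h').1)).2
    · exact absurd (hst ▸ haD _ (hπ t h')) (Finset.mem_sdiff.1 (hbD _ (h1 s hs h).1)).2
    · exact ρ.injective (hbinj (h1 s hs h).1 (h1 t ht h').1 hst)
  · simp only [hs, if_true]
    exact haD _ (hπ s hs)
  · simp only
    split_ifs with h
    · intro hI'
      have h2 : I s ∈ D' := hI' ▸ haD _ (hπ s h)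
      rw [← ha s (Finset.mem_filter.2 ⟨h, h2⟩)] at hI'
      exact hπ' s h h2 (hainj (hπ s h) h hI')
    · intro hI'
      have h2 : I s ∈ W \ D' := hI' ▸ hbD _ (h1 s hs h).1
      have h3 : s ∈ S \ D := Finset.mem_sdiff.2 ⟨hs, h⟩
      rw [← hb s (Finset.mem_filter.2 ⟨h3, h2⟩)] at hI'
      exact (h1 s hs h).2 (hbinj (h1 s hs h).1 h3 hI')

end

/-- The main theorem for complete graphs on `2 * m` vertices. -/
def AndersenHilton (m : ℕ) : Prop :=
  ∀ (V C : Type) [Fintype V] [DecidableEq V] [Fintype C] [DecidableEq C]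
    (H : Finset (V × V × C)), Fintype.card V = 2 * m → Fintype.card C + 1 = 2 * m →
    IsPrecoloring H → H.card ≤ 2 * m → ¬ IsExceptional Finset.univ H → Completable H

section

variable {V C : Type} [DecidableEq V] [DecidableEq C]

/-- The precolored edges inside `S`. -/
def inside (H : Finset (V × V × C)) (S : Finset V) : Finset (V × V × C) :=
  H.filter fun p => p.1 ∈ S ∧ p.2.1 ∈ S

variable {H : Finset (V × V × C)}

theorem mem_inside {S : Finset V} {u v : V} {c : C} :
    (u, v, c) ∈ inside H S ↔ (u, v, c) ∈ H ∧ u ∈ S ∧ v ∈ S := by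
  simp [inside]

theorem IsPrecoloring.inside (hH : IsPrecoloring H) (S : Finset V) :
    IsPrecoloring (inside H S) :=
  hH.subset (Finset.filter_subset _ _) fun u v c h => by
    rw [mem_inside] at h ⊢
    exact ⟨hH.symm _ _ _ h.1, h.2.2, h.2.1⟩

theorem AndersenHilton.exists_on {m : ℕ} (h : AndersenHilton m) {T : Finset V} {Y : Finset C}
    (hT : T.card = 2 * m) (hY : Y.card + 1 = 2 * m) (hH : IsPrecoloring H)
    (hHT : ∀ u v c, (u, v, c) ∈ H → u ∈ T ∧ c ∈ Y) (hcard : H.card ≤ 2 * m)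
    (hexc : ¬ IsExceptional T H) :
    ∃ g : V → V → C, IsProper T g ∧ (∀ u ∈ T, ∀ v ∈ T, g u v ∈ Y) ∧
      ∀ u v c, (u, v, c) ∈ H → g u v = c := by
  set K : Finset (T × T × Y) :=
    Finset.univ.filter fun p => ((p.1 : V), (p.2.1 : V), (p.2.2 : C)) ∈ H with hK
  have hmK : ∀ u v c, (u, v, c) ∈ K ↔ ((u : V), (v : V), (c : C)) ∈ H := by
    intro u v c; simp [hK]
  have hlift : ∀ u v c, (u, v, c) ∈ H → ∃ (h1 : u ∈ T) (h2 : v ∈ T) (h3 : c ∈ Y),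
      ((⟨u, h1⟩, ⟨v, h2⟩, ⟨c, h3⟩) : T × T × Y) ∈ K := fun u v c h =>
    ⟨(hHT _ _ _ h).1, (hHT _ _ _ (hH.symm _ _ _ h)).1, (hHT _ _ _ h).2, (hmK _ _ _).2 h⟩
  obtain ⟨f, hf, hfK⟩ := h T Y K (by rw [Fintype.card_coe, hT]) (by rw [Fintype.card_coe, hY])
    (by
      refine ⟨fun u v c h => ?_, fun u v c h h' => ?_, fun u v w c h1 h2 => ?_,
        fun u v c d h1 h2 => ?_⟩
      · rw [hmK] at h ⊢; exact hH.symm _ _ _ h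
      · rw [hmK] at h; exact hH.ne _ _ _ h (congrArg _ h')
      · rw [hmK] at h1 h2; exact Subtype.ext (hH.right _ _ _ _ h1 h2)
      · rw [hmK] at h1 h2; exact Subtype.ext (hH.color _ _ _ _ h1 h2))
    (by
      refine le_trans (Finset.card_le_card_of_injOn
        (fun p => ((p.1 : V), (p.2.1 : V), (p.2.2 : C))) (fun p hp => ?_) ?_) hcard
      · exact (Finset.mem_filter.1 hp).2
      · rintro ⟨u, v, c⟩ - ⟨u', v', c'⟩ - h
        simp only [Prod.mk.injEq] at h
        rw [Subtype.ext h.1, Subtype.ext h.2.1, Subtype.ext h.2.2])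
    (by
      rintro ⟨h1, h2, x, y, c, c', hcc, hxy, ⟨a, b, hab⟩, hall⟩
      refine hexc ⟨fun u hu => ?_, fun u v c v' c' h h' => ?_, x, y, c, c', ?_, (hmK _ _ _).1 hxy,
        ⟨a, b, (hmK _ _ _).1 hab⟩, fun u v e h => ?_⟩
      · obtain ⟨v, c, h⟩ := h1 ⟨u, hu⟩ (Finset.mem_univ _)
        exact ⟨v, c, (hmK _ _ _).1 h⟩
      · obtain ⟨h3, h4, h5, h⟩ := hlift _ _ _ h
        obtain ⟨h3', h4', h5', h'⟩ := hlift _ _ _ h'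
        simpa using h2 _ _ _ _ _ h h'
      · exact fun h => hcc (Subtype.ext h)
      · obtain ⟨h3, h4, h5, h⟩ := hlift _ _ _ h
        simpa [Subtype.ext_iff] using hall _ _ _ h)
  obtain ⟨y₀, hy₀⟩ : Y.Nonempty := by
    rw [← Finset.card_pos]; omega
  set g : V → V → C := fun u v =>
    if h : u ∈ T ∧ v ∈ T then f ⟨u, h.1⟩ ⟨v, h.2⟩ else y₀ with hg
  have hgf : ∀ u v (h1 : u ∈ T) (h2 : v ∈ T), g u v = f ⟨u, h1⟩ ⟨v, h2⟩ := by
    intro u v h1 h2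
    simp [hg, h1, h2]
  refine ⟨g, ⟨fun u v => ?_, fun u hu v hv w hw huv huw h => ?_⟩, fun u hu v hv => ?_,
    fun u v c h => ?_⟩
  · by_cases h : u ∈ T ∧ v ∈ T
    · rw [hgf u v h.1 h.2, hgf v u h.2 h.1, hf.1]
    · simp only [hg]
      rw [dif_neg h, dif_neg fun h' => h h'.symm]
  · rw [hgf u v hu hv, hgf u w hu hw] at h
    simpa using hf.2 _ (Finset.mem_univ _) _ (Finset.mem_univ _) _ (Finset.mem_univ _)
      (fun h => huv (congrArg Subtype.val h)) (fun h => huw (congrArg Subtype.val h))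
      (Subtype.ext h)
  · rw [hgf u v hu hv]; exact (f _ _).2
  · obtain ⟨h1, h2, h3, h⟩ := hlift _ _ _ h
    rw [hgf u v h1 h2, hfK _ _ _ h]

variable [Fintype V] [Fintype C]

/-- Colorings of two complementary complete graphs and of the edges between them. -/
theorem exists_glue {S : Finset V} {f g L : V → V → C} (hf : IsProper S f) (hg : IsProper Sᶜ g)
    (hrow : ∀ s ∈ S, ∀ w ∉ S, ∀ w' ∉ S, L s w = L s w' → w = w')
    (hcol : ∀ s ∈ S, ∀ s' ∈ S, ∀ w ∉ S, L s w = L s' w → s = s')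
    (hfL : ∀ s ∈ S, ∀ s' ∈ S, s ≠ s' → ∀ w ∉ S, f s s' ≠ L s w)
    (hgL : ∀ w ∉ S, ∀ w' ∉ S, w ≠ w' → ∀ s ∈ S, g w w' ≠ L s w) :
    ∃ k : V → V → C, IsProper Finset.univ k ∧ (∀ u ∈ S, ∀ v ∈ S, k u v = f u v) ∧
      (∀ u ∉ S, ∀ v ∉ S, k u v = g u v) ∧ ∀ u ∈ S, ∀ v ∉ S, k u v = L u v := by
  have hf2 := hf.2
  have hg2 := hg.2
  simp only [Finset.mem_compl] at hg2
  refine ⟨fun u v => if u ∈ S then if v ∈ S then f u v else L u v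
    else if v ∈ S then L v u else g u v, ⟨fun u v => ?_, fun u _ v _ w _ huv huw h => ?_⟩,
    fun u hu v hv => by simp [hu, hv], fun u hu v hv => by simp [hu, hv],
    fun u hu v hv => by simp [hu, hv]⟩
  · by_cases hu : u ∈ S <;> by_cases hv : v ∈ S <;> simp [hu, hv, hf.1 u v, hg.1 u v]
  · by_cases hu : u ∈ S <;> by_cases hv : v ∈ S <;> by_cases hw : w ∈ S <;>
      simp only [hu, hv, hw, if_true, if_false] at h
    · exact hf2 u hu v hv w hw huv huw h
    · exact absurd h (hfL u hu v hv huv w hw)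
    · exact absurd h.symm (hfL u hu w hw huw v hv)
    · exact hrow u hu v hv w hw h
    · exact hcol v hv w hw u hu h
    · exact absurd h.symm (hgL u hu w hw huw v hv)
    · exact absurd h (hgL u hu v hv huv w hw)
    · exact hg2 u hu v hv w hw huv huw h

/-- Completion along a partition into two parts of even size. -/
theorem Completable.of_even_split {m : ℕ} (hm : AndersenHilton m)
    (hC : Fintype.card C + 1 = Fintype.card V) (hV : Fintype.card V = 4 * m)
    (hH : IsPrecoloring H) {S : Finset V} (hS : S.card = 2 * m) {Y : Finset C}
    (hY : Y.card + 1 = 2 * m) (hin : ∀ u v c, (u, v, c) ∈ H → (u ∈ S ↔ v ∈ S) → c ∈ Y)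
    (hc : (inside H S).card ≤ 2 * m) (hc' : (inside H Sᶜ).card ≤ 2 * m)
    (hexc : ¬ IsExceptional S (inside H S)) (hexc' : ¬ IsExceptional Sᶜ (inside H Sᶜ))
    {D : Finset C} (hD : ∀ c ∈ D, c ∉ Y) {σ : C → V → V}
    (hσ : ∀ c ∈ D, ∀ s ∈ S, σ c s ∉ S) (hinj : ∀ c ∈ D, Set.InjOn (σ c) S)
    (hdis : ∀ c ∈ D, ∀ d ∈ D, ∀ s ∈ S, σ c s = σ d s → c = d)
    (hcross : ∀ u v c, (u, v, c) ∈ H → u ∈ S → v ∉ S → c ∈ D ∧ σ c u = v) :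
    Completable H := by
  have hS' : Sᶜ.card = 2 * m := by rw [Finset.card_compl, hV, hS]; omega
  have : Nonempty V := Fintype.card_pos_iff.1 (by omega)
  have : Nonempty C := Fintype.card_pos_iff.1 (by omega)
  obtain ⟨f, hf, hfY, hfH⟩ := hm.exists_on hS hY (hH.inside S) (fun u v c h => by
    rw [mem_inside] at h
    exact ⟨h.2.1, hin _ _ _ h.1 ⟨fun _ => h.2.2, fun _ => h.2.1⟩⟩) hc hexc
  obtain ⟨g, hg, hgY, hgH⟩ := hm.exists_on hS' hY (hH.inside Sᶜ) (fun u v c h => by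
    rw [mem_inside] at h
    refine ⟨h.2.1, hin _ _ _ h.1 ?_⟩
    have h1 := Finset.mem_compl.1 h.2.1
    have h2 := Finset.mem_compl.1 h.2.2
    tauto) hc' hexc'
  obtain ⟨L, hLY, hrow, hcol, hLσ⟩ := exists_latin (S := S) (W := Sᶜ) (Z := Yᶜ) (hS.trans hS'.symm)
    (by rw [Finset.card_compl, hS]; omega) (D := D) (fun c hc => Finset.mem_compl.2 (hD c hc))
    (σ := σ) (fun c hc s hs => Finset.mem_compl.2 (hσ c hc s hs)) hinj hdis
  simp only [Finset.mem_compl] at hLY hrow hcol hgY hgH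
  obtain ⟨k, hk, hkf, hkg, hkL⟩ := exists_glue hf hg hrow hcol
    (fun s hs s' hs' _ w hw h => hLY s hs w hw (h ▸ hfY s hs s' hs'))
    (fun w hw w' hw' _ s hs h => hLY s hs w hw (h ▸ hgY w hw w' hw'))
  have key : ∀ u v c, (u, v, c) ∈ H → u ∈ S → v ∉ S → k u v = c := by
    intro u v c h hu hv
    obtain ⟨h1, rfl⟩ := hcross u v c h hu hv
    rw [hkL u hu _ hv, hLσ c h1 u hu]
  refine ⟨k, hk, fun u v c h => ?_⟩
  by_cases hu : u ∈ S <;> by_cases hv : v ∈ S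
  · rw [hkf u hu v hv]; exact hfH _ _ _ (mem_inside.2 ⟨h, hu, hv⟩)
  · exact key u v c h hu hv
  · rw [hk.1]; exact key v u c (hH.symm _ _ _ h) hv hu
  · rw [hkg u hu v hv]
    exact hgH _ _ _ (mem_inside.2 ⟨h, Finset.mem_compl.2 hu, Finset.mem_compl.2 hv⟩)

/-- Completion along a partition into two parts of odd size. -/
theorem Completable.of_odd_split {n : ℕ} (hn : 2 ≤ n)
    (hC : Fintype.card C + 1 = Fintype.card V) (hV : Fintype.card V = 2 * n)
    (hH : IsPrecoloring H) {S : Finset V} (hS : S.card = n) {Y : Finset C} (hY : Y.card = n)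
    {x y : V} (hx : x ∉ S) (hy : y ∈ S) {f g : V → V → C} (hf : IsProper (insert x S) f)
    (hg : IsProper (insert y Sᶜ) g) (hfY : ∀ u ∈ insert x S, ∀ v ∈ insert x S, f u v ∈ Y)
    (hgY : ∀ u ∈ insert y Sᶜ, ∀ v ∈ insert y Sᶜ, g u v ∈ Y)
    (hfH : ∀ u v c, (u, v, c) ∈ H → u ∈ S → v ∈ S → f u v = c)
    (hgH : ∀ u v c, (u, v, c) ∈ H → u ∉ S → v ∉ S → g u v = c) {c₀ : C} (hc₀ : c₀ ∉ Y)
    (hcross : ∀ u v c, (u, v, c) ∈ H → u ∈ S → v ∉ S → c = c₀)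
    (halone : ∀ u v c, (u, v, c) ∈ H → u ∈ S → v ∉ S → ∀ w ∈ S, ∀ k, (u, w, k) ∉ H)
    {D : Finset V} (hD : ∀ u, u ∈ D ↔ u ∈ S ∧ ∃ v ∉ S, (u, v, c₀) ∈ H) (hDn : D.card + 1 ≠ n)
    (hD1 : D.card = 1 → ∀ u v, (u, v, c₀) ∈ H → u ∈ S → v ∉ S → f u x ≠ g v y) :
    Completable H := by
  classical
  have hS' : Sᶜ.card = n := by rw [Finset.card_compl, hV, hS]; omega
  have : Nonempty V := Fintype.card_pos_iff.1 (by omega)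
  have : Nonempty C := Fintype.card_pos_iff.1 (by omega)
  have hSx : ∀ {s}, s ∈ S → s ∈ insert x S := fun h => Finset.mem_insert_of_mem h
  have hSy : ∀ {w}, w ∉ S → w ∈ insert y Sᶜ :=
    fun h => Finset.mem_insert_of_mem (Finset.mem_compl.2 h)
  have hxx := Finset.mem_insert_self x S
  have hyy := Finset.mem_insert_self y Sᶜ
  have hnx : ∀ {s}, s ∈ S → s ≠ x := fun h h' => hx (h' ▸ h)
  have hny : ∀ {w}, w ∉ S → w ≠ y := fun h h' => h (h' ▸ hy)
  have hfinj : ∀ s ∈ S, ∀ t ∈ S, f s x = f t x → s = t := fun s hs t ht h =>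
    hf.2 x hxx s (hSx hs) t (hSx ht) (hnx hs).symm (hnx ht).symm (by rw [hf.1, h, hf.1])
  have hginj : ∀ s ∉ S, ∀ t ∉ S, g s y = g t y → s = t := fun s hs t ht h =>
    hg.2 y hyy s (hSy hs) t (hSy ht) (hny hs).symm (hny ht).symm (by rw [hg.1, h, hg.1])
  have hI : ∀ s, ∃ w, s ∈ S → w ∉ S ∧ g w y = f s x := by
    intro s
    by_cases hs : s ∈ S
    · obtain ⟨w, hw, h⟩ := Finset.surjOn_of_injOn_of_card_le (s := Sᶜ) (t := Y) (fun w => g w y)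
        (fun w hw => hgY w (hSy (Finset.mem_compl.1 hw)) y hyy)
        (fun s hs t ht h => hginj s (by simpa using hs) t (by simpa using ht) h) (by omega)
        (hfY s (hSx hs) x hxx)
      exact ⟨w, fun _ => ⟨by simpa using hw, h⟩⟩
    · exact ⟨s, fun h => absurd h hs⟩
  choose I hI using hI
  have hIinj : Set.InjOn I S := fun s hs t ht h =>
    hfinj s hs t ht (by rw [← (hI s hs).2, h, (hI t ht).2])
  have hp : ∀ s, ∃ w, s ∈ D → w ∉ S ∧ (s, w, c₀) ∈ H := by
    intro s
    by_cases hs : s ∈ D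
    · obtain ⟨w, hw, h⟩ := ((hD s).1 hs).2
      exact ⟨w, fun _ => ⟨hw, h⟩⟩
    · exact ⟨s, fun h => absurd h hs⟩
  choose p hp using hp
  have hpinj : Set.InjOn p D := fun s hs t ht h => by
    have h1 := hH.symm _ _ _ (hp s hs).2
    have h2 := hH.symm _ _ _ (hp t ht).2
    rw [← h] at h2
    exact hH.right _ _ _ _ h1 h2
  have hDS : D ⊆ S := fun s hs => ((hD s).1 hs).1
  have hDp : D.card = (D.image p).card := (Finset.card_image_of_injOn hpinj).symm
  obtain ⟨σ, hσS, hσinj, hσD, hσI⟩ := exists_injOn_avoiding (W := Sᶜ) (hS.trans hS'.symm) hDS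
    (D' := D.image p)
    (fun w hw => by
      obtain ⟨s, hs, rfl⟩ := Finset.mem_image.1 hw
      exact Finset.mem_compl.2 (hp s hs).1)
    hDp hIinj
    (fun h1 s hs hI' => by
      obtain ⟨t, ht, h⟩ := Finset.mem_image.1 hI'
      obtain rfl : t = s := Finset.card_le_one.1 h1.le t ht s hs
      refine hD1 h1 t (p t) (hp t ht).2 (hDS ht) (hp t ht).1 ?_
      rw [h, (hI t (hDS ht)).2])
    (by rwa [hS])
  simp only [Finset.mem_compl] at hσS
  obtain ⟨i, hi⟩ : Y.Nonempty := by rw [← Finset.card_pos]; omega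
  have hic : i ≠ c₀ := by rintro rfl; exact hc₀ hi
  obtain ⟨L, hLY, hrow, hcol, hLσ⟩ := exists_latin (S := S) (W := Sᶜ) (Z := insert i Yᶜ)
    (hS.trans hS'.symm)
    (by
      rw [Finset.card_insert_of_notMem (by simpa using hi), Finset.card_compl, hS]
      omega)
    (D := {i, c₀})
    (by
      intro c hc
      rw [Finset.mem_insert, Finset.mem_singleton] at hc
      rw [Finset.mem_insert, Finset.mem_compl]
      rcases hc with rfl | rfl
      · exact Or.inl rfl
      · exact Or.inr hc₀)
    (σ := fun c => if c = i then I else σ)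
    (fun c hc s hs => by
      split_ifs
      · exact Finset.mem_compl.2 (hI s hs).1
      · exact Finset.mem_compl.2 (hσS s hs))
    (fun c hc => by
      split_ifs
      · exact hIinj
      · exact hσinj)
    (fun c hc d hd s hs h => by
      rw [Finset.mem_insert, Finset.mem_singleton] at hc hd
      split_ifs at h with h1 h2 h2
      · rw [h1, h2]
      · exact absurd h.symm (hσI s hs)
      · exact absurd h (hσI s hs)
      · rw [hc.resolve_left h1, hd.resolve_left h2])
  simp only [Finset.mem_compl, Finset.mem_insert] at hLY hrow hcol
  have hLI : ∀ s ∈ S, ∀ w ∉ S, L s w = i → g w y = f s x := by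
    intro s hs w hw h
    have h1 := hLσ i (by simp) s hs
    rw [if_pos rfl] at h1
    rw [hrow s hs w hw (I s) (hI s hs).1 (h.trans h1.symm), (hI s hs).2]
  have hLnY : ∀ s ∈ S, ∀ w ∉ S, L s w ≠ i → L s w ∉ Y := fun s hs w hw h =>
    (hLY s hs w hw).resolve_left h
  obtain ⟨k, hk, hkf, hkg, hkL⟩ := exists_glue (S := S) (f := f) (g := g)
    (L := fun s w => if L s w = i then f s x else L s w)
    (hf.mono (Finset.subset_insert _ _)) (hg.mono (Finset.subset_insert _ _))
    (fun s hs w hw w' hw' h => by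
      have h1 := hfY s (hSx hs) x hxx
      split_ifs at h with h2 h3 h3
      · exact hrow s hs w hw w' hw' (h2.trans h3.symm)
      · exact absurd (h ▸ h1) (hLnY s hs w' hw' h3)
      · exact absurd (h ▸ h1) (hLnY s hs w hw h2)
      · exact hrow s hs w hw w' hw' h)
    (fun s hs s' hs' w hw h => by
      split_ifs at h with h2 h3 h3
      · exact hcol s hs s' hs' w hw (h2.trans h3.symm)
      · exact absurd (h ▸ hfY s (hSx hs) x hxx) (hLnY s' hs' w hw h3)
      · exact absurd (h ▸ hfY s' (hSx hs') x hxx) (hLnY s hs w hw h2)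
      · exact hcol s hs s' hs' w hw h)
    (fun s hs s' hs' hss w hw h => by
      split_ifs at h with h2
      · exact hnx hs' (hf.2 s (hSx hs) s' (hSx hs') x hxx hss (hnx hs) h)
      · exact hLnY s hs w hw h2 (h ▸ hfY s (hSx hs) s' (hSx hs')))
    (fun w hw w' hw' hww s hs h => by
      split_ifs at h with h2
      · rw [← hLI s hs w hw h2] at h
        exact hny hw' (hg.2 w (hSy hw) w' (hSy hw') y hyy hww (hny hw) h)
      · exact hLnY s hs w hw h2 (h ▸ hgY w (hSy hw) w' (hSy hw')))
  have ht : ∀ s, ∃ t, (s ∈ D → t ∈ D ∧ σ t = p s) ∧ (s ∉ D → t = s) := by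
    intro s
    by_cases hs : s ∈ D
    · obtain ⟨t, ht, h⟩ := Finset.surjOn_of_injOn_of_card_le (s := D) (t := D.image p) σ
        (fun s hs => hσD s hs) (hσinj.mono hDS) hDp.ge (Finset.mem_image_of_mem p hs)
      exact ⟨t, fun _ => ⟨ht, h⟩, fun h => absurd hs h⟩
    · exact ⟨s, fun h => absurd h hs, fun _ => rfl⟩
  choose ψ hψ hψ' using ht
  have hψinj : Function.Injective ψ := by
    intro a b hab
    by_cases ha : a ∈ D <;> by_cases hb : b ∈ D
    · exact hpinj ha hb (by rw [← (hψ a ha).2, hab, (hψ b hb).2])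
    · rw [hψ' b hb] at hab
      exact absurd (hab ▸ (hψ a ha).1) hb
    · rw [hψ' a ha] at hab
      exact absurd (hab ▸ (hψ b hb).1) ha
    · rwa [hψ' a ha, hψ' b hb] at hab
  have key : ∀ u v c, (u, v, c) ∈ H → u ∈ S → v ∉ S → k (ψ u) (ψ v) = c := by
    intro u v c h hu hv
    obtain rfl := hcross u v c h hu hv
    have huD : u ∈ D := (hD u).2 ⟨hu, v, hv, h⟩
    obtain ⟨h1, h2⟩ := hψ u huD
    have h3 : p u = v := hH.right _ _ _ _ (hp u huD).2 h
    rw [hψ' v fun h => hv (hDS h), ← h3, ← h2, hkL _ (hDS h1) _ (hσS _ (hDS h1))]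
    have h4 := hLσ c (by simp) (ψ u) (hDS h1)
    rw [if_neg hic.symm] at h4
    rw [if_neg (by rw [h4]; exact hic.symm), h4]
  refine ⟨fun a b => k (ψ a) (ψ b), hk.comp_perm (Equiv.ofBijective ψ
    ((Fintype.bijective_iff_injective_and_card ψ).2 ⟨hψinj, rfl⟩)), fun u v c h => ?_⟩
  simp only
  have hnD : ∀ u v c, (u, v, c) ∈ H → u ∈ S → v ∈ S → u ∉ D := by
    intro u v c h hu hv hu'
    exact halone u (p u) c₀ (hp u hu').2 hu (hp u hu').1 v hv c h
  by_cases hu : u ∈ S <;> by_cases hv : v ∈ S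
  · rw [hψ' u (hnD u v c h hu hv), hψ' v (hnD v u c (hH.symm _ _ _ h) hv hu), hkf u hu v hv]
    exact hfH _ _ _ h hu hv
  · exact key u v c h hu hv
  · rw [hk.1]; exact key v u c (hH.symm _ _ _ h) hv hu
  · rw [hψ' u fun h => hu (hDS h), hψ' v fun h => hv (hDS h), hkg u hu v hv]
    exact hgH _ _ _ h hu hv

end

section

variable {V C : Type} [DecidableEq V] [DecidableEq C] {H : Finset (V × V × C)}

open Classical in
/-- The precolored edges sharing no vertex with another precolored edge. -/
noncomputable def isolated (H : Finset (V × V × C)) : Finset (V × V × C) :=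
  H.filter fun p => IsLeaf H p.1 p.2.1 p.2.2 ∧ IsLeaf H p.2.1 p.1 p.2.2

theorem mem_isolated {u v : V} {c : C} :
    (u, v, c) ∈ isolated H ↔ IsLeaf H u v c ∧ IsLeaf H v u c := by
  simp only [isolated, Finset.mem_filter, and_iff_right_iff_imp]
  exact fun h => h.1.1

theorem card_leaves_le (hH : IsPrecoloring H) :
    2 * (leaves H).card ≤ H.card + (isolated H).card := by
  classical
  set L := H.filter fun p => IsLeaf H p.1 p.2.1 p.2.2 with hL
  set L' := H.filter fun p => IsLeaf H p.2.1 p.1 p.2.2 with hL'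
  have h1 : L.card = (leaves H).card := by
    refine Finset.card_nbij (fun p => p.1) ?_ ?_ ?_
    · rintro ⟨u, v, c⟩ h
      exact mem_leaves.2 ⟨v, c, (Finset.mem_filter.1 h).2⟩
    · rintro ⟨u, v, c⟩ h ⟨u', v', c'⟩ h' (rfl : u = u')
      have h1 := (Finset.mem_filter.1 h).2
      obtain ⟨rfl, rfl⟩ := h1.2 _ _ (Finset.mem_filter.1 h').1
      rfl
    · intro u hu
      obtain ⟨v, c, h⟩ := mem_leaves.1 hu
      exact ⟨(u, v, c), Finset.mem_coe.2 (Finset.mem_filter.2 ⟨h.1, h⟩), rfl⟩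
  have h2 : L.card = L'.card := by
    refine Finset.card_nbij' (fun p => (p.2.1, p.1, p.2.2)) (fun p => (p.2.1, p.1, p.2.2))
      ?_ ?_ (fun _ _ => rfl) (fun _ _ => rfl)
    · rintro ⟨u, v, c⟩ h
      have h := Finset.mem_filter.1 h
      exact Finset.mem_filter.2 ⟨hH.symm _ _ _ h.1, h.2⟩
    · rintro ⟨u, v, c⟩ h
      have h := Finset.mem_filter.1 h
      exact Finset.mem_filter.2 ⟨hH.symm _ _ _ h.1, h.2⟩
  have h3 : L ∩ L' = isolated H := by rw [hL, hL', ← Finset.filter_and]; rfl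
  have h4 := Finset.card_union_add_card_inter L L'
  have h5 : (L ∪ L').card ≤ H.card :=
    Finset.card_le_card (Finset.union_subset (Finset.filter_subset _ _) (Finset.filter_subset _ _))
  rw [h3] at h4
  omega

theorem four_mul_card_covered_le (hH : IsPrecoloring H) :
    4 * (covered H).card ≤ 3 * H.card + (isolated H).card := by
  have h1 := two_mul_card_covered_le H
  have h2 := card_leaves_le hH
  omega

/-- A set of precolored isolated edges, each with one of its two orientations. -/
structure IsIsolatedSet (H B : Finset (V × V × C)) : Prop where
  leaf : ∀ u v c, (u, v, c) ∈ B → IsLeaf H u v c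
  leaf' : ∀ u v c, (u, v, c) ∈ B → IsLeaf H v u c
  oriented : ∀ u v c, (u, v, c) ∈ B → (v, u, c) ∉ B

theorem IsIsolatedSet.mono {B B' : Finset (V × V × C)} (hB : IsIsolatedSet H B) (h : B' ⊆ B) :
    IsIsolatedSet H B' :=
  ⟨fun u v c h' => hB.leaf u v c (h h'), fun u v c h' => hB.leaf' u v c (h h'),
    fun u v c h1 h2 => hB.oriented u v c (h h1) (h h2)⟩

/-- The reversed edges. -/
def reversal (B : Finset (V × V × C)) : Finset (V × V × C) :=
  B.image fun p => (p.2.1, p.1, p.2.2)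

theorem mem_reversal {B : Finset (V × V × C)} {u v : V} {c : C} :
    (u, v, c) ∈ reversal B ↔ (v, u, c) ∈ B := by
  simp [reversal]

theorem card_reversal (B : Finset (V × V × C)) : (reversal B).card = B.card :=
  Finset.card_image_of_injective _ fun p q h => by
    simp only [Prod.mk.injEq] at h
    exact Prod.ext h.2.1 (Prod.ext h.1 h.2.2)

theorem IsIsolatedSet.disjoint_reversal {B : Finset (V × V × C)} (hB : IsIsolatedSet H B) :
    Disjoint B (reversal B) :=
  Finset.disjoint_left.2 fun ⟨_, _, _⟩ h h' => hB.oriented _ _ _ h (mem_reversal.1 h')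

theorem IsIsolatedSet.subset {B : Finset (V × V × C)} (hB : IsIsolatedSet H B) : B ⊆ H :=
  fun ⟨_, _, _⟩ h => (hB.leaf _ _ _ h).1

theorem IsIsolatedSet.reversal_subset {B : Finset (V × V × C)} (hB : IsIsolatedSet H B) :
    reversal B ⊆ H :=
  fun ⟨_, _, _⟩ h => (hB.leaf' _ _ _ (mem_reversal.1 h)).1

theorem IsIsolatedSet.two_mul_card {B : Finset (V × V × C)} (hB : IsIsolatedSet H B) :
    (B ∪ reversal B).card = 2 * B.card := by
  rw [Finset.card_union_of_disjoint hB.disjoint_reversal, card_reversal, two_mul]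

theorem IsPrecoloring.exists_isolatedSet [Fintype V] (hH : IsPrecoloring H) :
    ∃ B, IsIsolatedSet H B ∧ (isolated H).card = 2 * B.card ∧
      ∀ p ∈ isolated H, p ∈ B ∨ p ∈ reversal B := by
  set e := Fintype.equivFin V
  have hB : IsIsolatedSet H ((isolated H).filter fun p => e p.1 < e p.2.1) := by
    refine ⟨fun u v c h => ?_, fun u v c h => ?_, fun u v c h h' => ?_⟩
    · exact (mem_isolated.1 (Finset.mem_filter.1 h).1).1
    · exact (mem_isolated.1 (Finset.mem_filter.1 h).1).2
    · exact lt_asymm (Finset.mem_filter.1 h).2 (Finset.mem_filter.1 h').2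
  have key : ∀ p ∈ isolated H, p ∈ (isolated H).filter (fun p => e p.1 < e p.2.1) ∨
      p ∈ reversal ((isolated H).filter fun p => e p.1 < e p.2.1) := by
    rintro ⟨u, v, c⟩ h
    rw [mem_reversal, Finset.mem_filter, Finset.mem_filter]
    have h' := mem_isolated.1 h
    rcases lt_or_gt_of_ne (e.injective.ne (hH.ne _ _ _ h'.1.1)) with h1 | h1
    · exact Or.inl ⟨h, h1⟩
    · exact Or.inr ⟨mem_isolated.2 h'.symm, h1⟩
  refine ⟨_, hB, ?_, key⟩
  rw [← hB.two_mul_card]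
  congr 1
  refine Finset.Subset.antisymm (fun p hp => Finset.mem_union.2 (key p hp))
    (Finset.union_subset (Finset.filter_subset _ _) ?_)
  rintro ⟨u, v, c⟩ h
  exact mem_isolated.2 (mem_isolated.1 (Finset.mem_filter.1 (mem_reversal.1 h)).1).symm

/-- A set `S` of vertices separating the precolored edges: the edges of `P` cross, those of `Q`
lie outside `S`, and all others lie inside `S`. -/
structure Splits (H P Q : Finset (V × V × C)) (S : Finset V) : Prop where
  cross : ∀ u v c, (u, v, c) ∈ H → u ∈ S → v ∉ S → (u, v, c) ∈ P
  of_cross : ∀ u v c, (u, v, c) ∈ P → u ∈ S ∧ v ∉ S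
  outside : ∀ u v c, (u, v, c) ∈ H → u ∉ S → v ∉ S → (u, v, c) ∈ Q ∪ reversal Q
  of_outside : ∀ u v c, (u, v, c) ∈ Q → u ∉ S ∧ v ∉ S

theorem IsIsolatedSet.exists_splits [Fintype V] (hH : IsPrecoloring H)
    {P Q : Finset (V × V × C)}
    (hB : IsIsolatedSet H (P ∪ Q)) (hPQ : Disjoint P Q) {n z : ℕ}
    (hV : Fintype.card V = 2 * n) (hz : (covered H).card + z = 2 * n)
    (h1 : P.card + 2 * Q.card ≤ n) (h2 : n ≤ z + P.card + 2 * Q.card) :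
    ∃ S : Finset V, S.card = n ∧ Splits H P Q S ∧
      (P.card + 2 * Q.card = n → ∀ u ∉ covered H, u ∈ S) := by
  have hP : ∀ {p}, p ∈ P → p ∈ P ∪ Q := fun h => Finset.mem_union_left _ h
  have hQ : ∀ {p}, p ∈ Q → p ∈ P ∪ Q := fun h => Finset.mem_union_right _ h
  have hfst : Set.InjOn (fun p : V × V × C => p.1) (P ∪ Q : Finset (V × V × C)) := by
    rintro ⟨u, v, c⟩ h ⟨u', v', c'⟩ h' (rfl : u = u')
    obtain ⟨rfl, rfl⟩ := (hB.leaf _ _ _ h).2 _ _ (hB.leaf _ _ _ h').1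
    rfl
  have hsnd : Set.InjOn (fun p : V × V × C => p.2.1) (P ∪ Q : Finset (V × V × C)) := by
    rintro ⟨u, v, c⟩ h ⟨u', v', c'⟩ h' (rfl : v = v')
    obtain ⟨rfl, rfl⟩ := (hB.leaf' _ _ _ h).2 _ _ (hB.leaf' _ _ _ h').1
    rfl
  have hne : ∀ p ∈ P ∪ Q, ∀ q ∈ P ∪ Q, p.1 ≠ q.2.1 := by
    rintro ⟨u, v, c⟩ h ⟨u', v', c'⟩ h' (rfl : u = v')
    obtain ⟨rfl, rfl⟩ := (hB.leaf _ _ _ h).2 _ _ (hB.leaf' _ _ _ h').1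
    exact hB.oriented _ _ _ h h'
  set W := (Q.image fun p => p.1) ∪ (P ∪ Q).image fun p => p.2.1 with hW
  have hmW : ∀ v, v ∈ W ↔ (∃ p ∈ Q, p.1 = v) ∨ ∃ p ∈ P ∪ Q, p.2.1 = v := by
    intro v; rw [hW, Finset.mem_union, Finset.mem_image, Finset.mem_image]
  have hWc : W.card = P.card + 2 * Q.card := by
    rw [hW, Finset.card_union_of_disjoint, Finset.card_image_of_injOn hsnd,
      Finset.card_image_of_injOn (hfst.mono fun p hp => hQ hp),
      Finset.card_union_of_disjoint hPQ]
    · ring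
    · refine Finset.disjoint_left.2 fun v hv hv' => ?_
      obtain ⟨p, hp, rfl⟩ := Finset.mem_image.1 hv
      obtain ⟨q, hq, h⟩ := Finset.mem_image.1 hv'
      exact hne p (hQ hp) q hq h.symm
  have hWs : W ⊆ covered H := by
    intro v hv
    rcases (hmW v).1 hv with ⟨⟨u, w, c⟩, h, rfl⟩ | ⟨⟨u, w, c⟩, h, rfl⟩
    · exact mem_covered.2 ⟨_, _, (hB.leaf _ _ _ (hQ h)).1⟩
    · exact mem_covered.2 ⟨_, _, (hB.leaf' _ _ _ h).1⟩
  have hPW : ∀ u v c, (u, v, c) ∈ P → u ∉ W := by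
    intro u v c h hu
    rcases (hmW u).1 hu with ⟨p, hp, rfl⟩ | ⟨p, hp, h'⟩
    · exact Finset.disjoint_left.1 hPQ h (hfst (hP h) (hQ hp) rfl ▸ hp)
    · exact hne _ (hP h) p hp h'.symm
  obtain ⟨S, hS1, hS2, hS⟩ := Finset.exists_subsuperset_card_eq
    (s := covered H \ W) (t := Finset.univ \ W) (n := n)
    (Finset.sdiff_subset_sdiff (Finset.subset_univ _) le_rfl)
    (by have := Finset.card_sdiff_add_card_eq_card hWs; omega)
    (by
      have := Finset.card_sdiff_add_card_eq_card (Finset.subset_univ W)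
      rw [Finset.card_univ] at this
      omega)
  have hSW : ∀ v ∈ S, v ∉ W := fun v hv => (Finset.mem_sdiff.1 (hS2 hv)).2
  have hWS : ∀ u v c, (u, v, c) ∈ H → u ∉ S → u ∈ W := fun u v c h hu => by
    by_contra h'
    exact hu (hS1 (Finset.mem_sdiff.2 ⟨mem_covered.2 ⟨_, _, h⟩, h'⟩))
  refine ⟨S, hS, ⟨fun u v c h hu hv => ?_, fun u v c h => ⟨?_, ?_⟩, fun u v c h hu hv => ?_,
    fun u v c h => ⟨?_, ?_⟩⟩, fun hn u hu => ?_⟩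
  · have h' := hH.symm _ _ _ h
    rcases (hmW v).1 (hWS v u c h' hv) with ⟨⟨a, b, k⟩, hp, rfl⟩ | ⟨⟨a, b, k⟩, hp, rfl⟩
    · obtain ⟨rfl, rfl⟩ := (hB.leaf _ _ _ (hQ hp)).2 _ _ h'
      exact absurd ((hmW _).2 (Or.inr ⟨_, hQ hp, rfl⟩)) (hSW _ hu)
    · obtain ⟨rfl, rfl⟩ := (hB.leaf' _ _ _ hp).2 _ _ h'
      refine (Finset.mem_union.1 hp).resolve_right fun h2 => ?_
      exact hSW _ hu ((hmW _).2 (Or.inl ⟨_, h2, rfl⟩))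
  · by_contra h'
    exact hPW u v c h (hWS u v c (hB.leaf _ _ _ (hP h)).1 h')
  · exact fun h' => hSW _ h' ((hmW _).2 (Or.inr ⟨_, hP h, rfl⟩))
  · rw [Finset.mem_union, mem_reversal]
    rcases (hmW u).1 (hWS u v c h hu) with ⟨⟨a, b, k⟩, hp, rfl⟩ | ⟨⟨a, b, k⟩, hp, rfl⟩
    · obtain ⟨rfl, rfl⟩ := (hB.leaf _ _ _ (hQ hp)).2 _ _ h
      exact Or.inl hp
    · obtain ⟨rfl, rfl⟩ := (hB.leaf' _ _ _ hp).2 _ _ h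
      refine Or.inr ((Finset.mem_union.1 hp).resolve_left fun h2 => ?_)
      exact hPW _ _ _ h2 (hWS _ _ _ (hH.symm _ _ _ h) hv)
  · exact fun h' => hSW _ h' ((hmW _).2 (Or.inl ⟨_, h, rfl⟩))
  · exact fun h' => hSW _ h' ((hmW _).2 (Or.inr ⟨_, hQ h, rfl⟩))
  · have h3 : S = Finset.univ \ W := by
      refine Finset.eq_of_subset_of_card_le hS2 ?_
      have := Finset.card_sdiff_add_card_eq_card (Finset.subset_univ W)
      rw [Finset.card_univ] at this
      omega
    rw [h3]
    exact Finset.mem_sdiff.2 ⟨Finset.mem_univ _, fun h => hu (hWs h)⟩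

theorem Splits.inside_compl [Fintype V] {P Q : Finset (V × V × C)}
    (hB : IsIsolatedSet H (P ∪ Q)) {S : Finset V} (hS : Splits H P Q S) :
    inside H Sᶜ = Q ∪ reversal Q := by
  ext ⟨u, v, c⟩
  rw [mem_inside, Finset.mem_compl, Finset.mem_compl]
  refine ⟨fun h => hS.outside _ _ _ h.1 h.2.1 h.2.2, fun h => ?_⟩
  rw [Finset.mem_union, mem_reversal] at h
  rcases h with h | h
  · exact ⟨(hB.leaf _ _ _ (Finset.mem_union_right _ h)).1, hS.of_outside _ _ _ h⟩
  · exact ⟨(hB.leaf' _ _ _ (Finset.mem_union_right _ h)).1, (hS.of_outside _ _ _ h).symm⟩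

theorem Splits.card_inside_compl [Fintype V] {P Q : Finset (V × V × C)}
    (hB : IsIsolatedSet H (P ∪ Q)) {S : Finset V} (hS : Splits H P Q S) :
    (inside H Sᶜ).card = 2 * Q.card := by
  rw [hS.inside_compl hB, (hB.mono Finset.subset_union_right).two_mul_card]

theorem Splits.inside_eq (hH : IsPrecoloring H) {P Q : Finset (V × V × C)} {S : Finset V}
    (hS : Splits H P Q S) : inside H S = H \ ((P ∪ Q) ∪ reversal (P ∪ Q)) := by
  ext ⟨u, v, c⟩
  rw [mem_inside, Finset.mem_sdiff, Finset.mem_union, mem_reversal, Finset.mem_union,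
    Finset.mem_union]
  constructor
  · rintro ⟨h, hu, hv⟩
    refine ⟨h, ?_⟩
    rintro ((h' | h') | h' | h')
    · exact (hS.of_cross _ _ _ h').2 hv
    · exact (hS.of_outside _ _ _ h').1 hu
    · exact (hS.of_cross _ _ _ h').2 hu
    · exact (hS.of_outside _ _ _ h').1 hv
  · rintro ⟨h, h'⟩
    by_cases hu : u ∈ S <;> by_cases hv : v ∈ S
    · exact ⟨h, hu, hv⟩
    · exact absurd (Or.inl (Or.inl (hS.cross _ _ _ h hu hv))) h'
    · exact absurd (Or.inr (Or.inl (hS.cross _ _ _ (hH.symm _ _ _ h) hv hu))) h'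
    · have := hS.outside _ _ _ h hu hv
      rw [Finset.mem_union, mem_reversal] at this
      tauto

theorem Splits.card_inside (hH : IsPrecoloring H) {P Q : Finset (V × V × C)}
    (hB : IsIsolatedSet H (P ∪ Q)) (hPQ : Disjoint P Q) {S : Finset V} (hS : Splits H P Q S) :
    (inside H S).card + 2 * P.card + 2 * Q.card = H.card := by
  have h1 := Finset.card_sdiff_add_card_eq_card
    (Finset.union_subset hB.subset hB.reversal_subset)
  rw [hB.two_mul_card, ← hS.inside_eq hH, Finset.card_union_of_disjoint hPQ] at h1
  omega

/-- The colors in use. -/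
def palette (H : Finset (V × V × C)) : Finset C := H.image fun p => p.2.2

theorem mem_palette {c : C} : c ∈ palette H ↔ ∃ u v, (u, v, c) ∈ H := by
  simp [palette]

theorem palette_mono {K : Finset (V × V × C)} (h : K ⊆ H) : palette K ⊆ palette H :=
  Finset.image_subset_image h

theorem palette_union_reversal (B : Finset (V × V × C)) : palette (B ∪ reversal B) = palette B := by
  ext c
  simp only [mem_palette, Finset.mem_union, mem_reversal]
  exact ⟨fun ⟨u, v, h⟩ => h.elim (fun h => ⟨u, v, h⟩) fun h => ⟨v, u, h⟩,
    fun ⟨u, v, h⟩ => ⟨u, v, Or.inl h⟩⟩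

theorem IsPrecoloring.two_mul_card_palette_le (hH : IsPrecoloring H) :
    2 * (palette H).card ≤ H.card := by
  refine Finset.mul_card_image_le_card (f := fun p : V × V × C => p.2.2) H 2 fun c hc => ?_
  obtain ⟨u, v, h⟩ := mem_palette.1 hc
  refine Finset.one_lt_card.2 ⟨(u, v, c), Finset.mem_filter.2 ⟨h, rfl⟩, (v, u, c),
    Finset.mem_filter.2 ⟨hH.symm _ _ _ h, rfl⟩, fun h' => hH.ne _ _ _ h ?_⟩
  simp only [Prod.mk.injEq] at h'
  exact h'.1

theorem IsExceptional.card_palette {T : Finset V} (hH : IsPrecoloring H)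
    (h : IsExceptional T H) :
    (palette H).card = 2 := by
  obtain ⟨-, -, x, y, c, c', hcc, hxy, ⟨u, v, huv⟩, hall⟩ := h
  have h1 : palette H = {c, c'} := by
    ext e
    rw [mem_palette, Finset.mem_insert, Finset.mem_singleton]
    constructor
    · rintro ⟨a, b, h⟩
      rcases hall _ _ _ h with rfl | ⟨rfl, rfl⟩ | ⟨rfl, rfl⟩
      · exact Or.inl rfl
      · exact Or.inr (hH.color _ _ _ _ h hxy)
      · exact Or.inr (hH.color _ _ _ _ (hH.symm _ _ _ h) hxy)
    · rintro (rfl | rfl)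
      · exact ⟨u, v, huv⟩
      · exact ⟨x, y, hxy⟩
  rw [h1, Finset.card_pair hcc]

theorem IsPrecoloring.even_card (hH : IsPrecoloring H) : Even H.card :=
  even_card_of_involution H (fun p => (p.2.1, p.1, p.2.2))
    (fun ⟨_, _, _⟩ h => hH.symm _ _ _ h) (fun _ _ => rfl) fun ⟨u, v, c⟩ h h' => by
      simp only [Prod.mk.injEq] at h'
      exact hH.ne _ _ _ h h'.2.1

end

section

variable {V C : Type} [DecidableEq V] [DecidableEq C] {H P Q : Finset (V × V × C)}

theorem not_isExceptional_of_notMem {T : Finset V} {u : V} (hu : u ∈ T)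
    (h : ∀ v c, (u, v, c) ∉ H) : ¬ IsExceptional T H := fun hexc => by
  obtain ⟨v, c, h'⟩ := hexc.1 u hu
  exact h v c h'

variable [Fintype V] [Fintype C]

theorem Splits.mem_palette_of_iff {S : Finset V} (hS : Splits H P Q S) {Y : Finset C}
    (hYH : palette (H \ (P ∪ reversal P)) ⊆ Y) {u v : V} {c : C} (h : (u, v, c) ∈ H)
    (hu : u ∈ S ↔ v ∈ S) : c ∈ Y := by
  refine hYH (mem_palette.2 ⟨u, v, Finset.mem_sdiff.2 ⟨h, fun h' => ?_⟩⟩)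
  rw [Finset.mem_union, mem_reversal] at h'
  rcases h' with h' | h'
  · have := hS.of_cross _ _ _ h'; tauto
  · have := hS.of_cross _ _ _ h'; tauto

/-- Completion along a splitting into two parts of even size. -/
theorem Completable.of_splits_even {m z : ℕ} (hm : AndersenHilton m)
    (hC : Fintype.card C + 1 = Fintype.card V) (hV : Fintype.card V = 4 * m)
    (hH : IsPrecoloring H) (hB : IsIsolatedSet H (P ∪ Q)) (hPQ : Disjoint P Q)
    (hz : (covered H).card + z = 4 * m) (h1 : P.card + 2 * Q.card ≤ 2 * m)
    (h2 : 2 * m ≤ z + P.card + 2 * Q.card) (h3 : H.card ≤ 2 * m + 2 * P.card + 2 * Q.card)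
    {Y D : Finset C} (hY : Y.card + 1 = 2 * m) (hYH : palette (H \ (P ∪ reversal P)) ⊆ Y)
    (hD : ∀ c ∈ D, c ∉ Y)
    (hσ : ∀ S : Finset V, S.card = 2 * m → (∀ u v c, (u, v, c) ∈ P → u ∈ S ∧ v ∉ S) →
      ∃ σ : C → V → V, (∀ c ∈ D, ∀ s ∈ S, σ c s ∉ S) ∧ (∀ c ∈ D, Set.InjOn (σ c) S) ∧
        (∀ c ∈ D, ∀ d ∈ D, ∀ s ∈ S, σ c s = σ d s → c = d) ∧
        ∀ u v c, (u, v, c) ∈ P → c ∈ D ∧ σ c u = v)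
    (hexc : P.Nonempty ∨ (P.card + 2 * Q.card = 2 * m ∧ 1 ≤ z) ∨ (palette H).card ≤ 1)
    (hexc' : P.Nonempty ∨ (palette Q).card ≠ 2) : Completable H := by
  obtain ⟨S, hS, hSp, hSu⟩ := hB.exists_splits hH hPQ (n := 2 * m) (z := z) (by omega) (by omega)
    h1 (by omega)
  obtain ⟨σ, hσ1, hσ2, hσ3, hσ4⟩ := hσ S hS hSp.of_cross
  have hc := hSp.card_inside hH hB hPQ
  have hc' := hSp.card_inside_compl hB
  refine Completable.of_even_split hm hC hV hH hS hY
    (fun u v c h hu => hSp.mem_palette_of_iff hYH h hu) (by omega) (by omega) ?_ ?_ hD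
    hσ1 hσ2 hσ3 (fun u v c h hu hv => hσ4 u v c (hSp.cross u v c h hu hv))
  · rcases hexc with ⟨⟨u, v, c⟩, h⟩ | ⟨h, hz1⟩ | h
    · refine not_isExceptional_of_notMem (hSp.of_cross _ _ _ h).1 fun w k h' => ?_
      rw [mem_inside] at h'
      obtain ⟨rfl, -⟩ := (hB.leaf _ _ _ (Finset.mem_union_left _ h)).2 _ _ h'.1
      exact (hSp.of_cross _ _ _ h).2 h'.2.2
    · obtain ⟨u, hu⟩ : ∃ u, u ∉ covered H := by
        by_contra! hall
        rw [Finset.eq_univ_of_forall hall, Finset.card_univ] at hz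
        omega
      refine not_isExceptional_of_notMem (hSu h u hu) fun w k h' => ?_
      exact hu (mem_covered.2 ⟨w, k, (mem_inside.1 h').1⟩)
    · intro hexc
      have h4 := hexc.card_palette (hH.inside S)
      have h5 := Finset.card_le_card (palette_mono (H := H) (K := inside H S)
        (Finset.filter_subset _ _))
      omega
  · rcases hexc' with ⟨⟨u, v, c⟩, h⟩ | h
    · refine not_isExceptional_of_notMem (Finset.mem_compl.2 (hSp.of_cross _ _ _ h).2)
        fun w k h' => ?_
      rw [mem_inside, Finset.mem_compl] at h'
      obtain ⟨rfl, -⟩ := (hB.leaf' _ _ _ (Finset.mem_union_left _ h)).2 _ _ h'.1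
      exact Finset.mem_compl.1 h'.2.2 (hSp.of_cross _ _ _ h).1
    · intro hexc
      have h4 := hexc.card_palette (hH.inside Sᶜ)
      rw [hSp.inside_compl hB, palette_union_reversal] at h4
      exact h h4

/-- Completion along a splitting into two parts of odd size, given colorings of both parts. -/
theorem Splits.completable_odd {n : ℕ} (hn : 2 ≤ n)
    (hC : Fintype.card C + 1 = Fintype.card V) (hV : Fintype.card V = 2 * n)
    (hH : IsPrecoloring H) (hB : IsIsolatedSet H (P ∪ Q)) {S : Finset V} (hSp : Splits H P Q S)
    (hS : S.card = n) {Y : Finset C} (hY : Y.card = n)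
    {x y : V} (hx : x ∉ S) (hy : y ∈ S) {f g : V → V → C} (hf : IsProper (insert x S) f)
    (hg : IsProper (insert y Sᶜ) g) (hfY : ∀ u ∈ insert x S, ∀ v ∈ insert x S, f u v ∈ Y)
    (hgY : ∀ u ∈ insert y Sᶜ, ∀ v ∈ insert y Sᶜ, g u v ∈ Y)
    (hfH : ∀ u v c, (u, v, c) ∈ inside H S → f u v = c)
    (hgH : ∀ u v c, (u, v, c) ∈ inside H Sᶜ → g u v = c) {c₀ : C} (hc₀ : c₀ ∉ Y)
    (hP : ∀ u v c, (u, v, c) ∈ P → c = c₀) (hPn : P.card + 1 ≠ n)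
    (hP1 : P.card = 1 → ∀ u v, (u, v, c₀) ∈ P → f u x ≠ g v y) : Completable H := by
  have hinj : Set.InjOn (fun p : V × V × C => p.1) P := by
    rintro ⟨u, v, c⟩ h ⟨u', v', c'⟩ h' (rfl : u = u')
    obtain ⟨rfl, rfl⟩ := (hB.leaf _ _ _ (Finset.mem_union_left _ h)).2 _ _
      (hB.leaf _ _ _ (Finset.mem_union_left _ h')).1
    rfl
  refine Completable.of_odd_split hn hC hV hH hS hY hx hy hf hg hfY hgY
    (fun u v c h hu hv => hfH _ _ _ (mem_inside.2 ⟨h, hu, hv⟩))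
    (fun u v c h hu hv => hgH _ _ _ (mem_inside.2
      ⟨h, Finset.mem_compl.2 hu, Finset.mem_compl.2 hv⟩)) hc₀
    (fun u v c h hu hv => hP _ _ _ (hSp.cross _ _ _ h hu hv))
    (fun u v c h hu hv w hw k h' => ?_) (D := P.image fun p => p.1) (fun u => ?_)
    (by rwa [Finset.card_image_of_injOn hinj])
    (fun h1 u v h hu hv => hP1 (by rwa [Finset.card_image_of_injOn hinj] at h1) u v
      (hSp.cross _ _ _ h hu hv))
  · have h1 := hB.leaf _ _ _ (Finset.mem_union_left _ (hSp.cross _ _ _ h hu hv))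
    exact hv ((h1.2 _ _ h').1 ▸ hw)
  · rw [Finset.mem_image]
    constructor
    · rintro ⟨⟨a, b, c⟩, h, rfl⟩
      obtain rfl := hP _ _ _ h
      exact ⟨(hSp.of_cross _ _ _ h).1, b, (hSp.of_cross _ _ _ h).2,
        (hB.leaf _ _ _ (Finset.mem_union_left _ h)).1⟩
    · rintro ⟨hu, v, hv, h⟩
      exact ⟨_, hSp.cross _ _ _ h hu hv, rfl⟩

/-- Completion along a splitting into two parts of odd size. -/
theorem Completable.of_splits_odd {m n z : ℕ} (hm : AndersenHilton m) (hmn : n + 1 = 2 * m)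
    (hn : 2 ≤ n) (hC : Fintype.card C + 1 = Fintype.card V) (hV : Fintype.card V = 2 * n)
    (hH : IsPrecoloring H) (hB : IsIsolatedSet H (P ∪ Q)) (hPQ : Disjoint P Q)
    (hz : (covered H).card + z = 2 * n) (h1 : P.card + 2 * Q.card ≤ n)
    (h2 : n ≤ z + P.card + 2 * Q.card) (h3 : H.card ≤ 2 * m + 2 * P.card + 2 * Q.card)
    {Y : Finset C} (hY : Y.card = n) (hYH : palette (H \ (P ∪ reversal P)) ⊆ Y)
    {c₀ : C} (hc₀ : c₀ ∉ Y) (hP : ∀ u v c, (u, v, c) ∈ P → c = c₀)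
    (hPn : P.card + 1 ≠ n) (hP1 : P.card ≠ 1) : Completable H := by
  obtain ⟨S, hS, hSp, hSu⟩ := hB.exists_splits hH hPQ hV hz h1 h2
  have hc := hSp.card_inside hH hB hPQ
  have hc' := hSp.card_inside_compl hB
  have hS' : Sᶜ.card = n := by rw [Finset.card_compl, hV, hS]; omega
  obtain ⟨x, hx⟩ : Sᶜ.Nonempty := by rw [← Finset.card_pos]; omega
  obtain ⟨y, hy⟩ : S.Nonempty := by rw [← Finset.card_pos]; omega
  rw [Finset.mem_compl] at hx
  obtain ⟨f, hf, hfY, hfH⟩ := hm.exists_on (T := insert x S) (Y := Y)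
    (by rw [Finset.card_insert_of_notMem hx]; omega) (by omega) (hH.inside S)
    (fun u v c h => by
      rw [mem_inside] at h
      exact ⟨Finset.mem_insert_of_mem h.2.1, hSp.mem_palette_of_iff hYH h.1 (by tauto)⟩)
    (by omega) (not_isExceptional_of_notMem (Finset.mem_insert_self x S) fun v c h =>
      hx (mem_inside.1 h).2.1)
  obtain ⟨g, hg, hgY, hgH⟩ := hm.exists_on (T := insert y Sᶜ) (Y := Y)
    (by rw [Finset.card_insert_of_notMem (by simpa using hy)]; omega) (by omega) (hH.inside Sᶜ)
    (fun u v c h => by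
      rw [mem_inside] at h
      refine ⟨Finset.mem_insert_of_mem h.2.1, hSp.mem_palette_of_iff hYH h.1 ?_⟩
      rw [Finset.mem_compl, Finset.mem_compl] at h
      tauto)
    (by omega) (not_isExceptional_of_notMem (Finset.mem_insert_self y Sᶜ) fun v c h =>
      Finset.mem_compl.1 (mem_inside.1 h).2.1 hy)
  exact hSp.completable_odd hn hC hV hH hB hS hY hx hy hf hg hfY hgY hfH hgH hc₀ hP hPn
    fun h => absurd h hP1

theorem AndersenHilton.exists_on_insert {m : ℕ} (hm : AndersenHilton m) {S : Finset V}
    {Y : Finset C} (hS : S.card + 1 = 2 * m) (hY : Y.card + 1 = 2 * m) (hH : IsPrecoloring H)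
    (hHS : ∀ u v c, (u, v, c) ∈ H → u ∈ S ∧ c ∈ Y) (hcard : H.card + 2 ≤ 2 * m)
    {a x : V} (ha : a ∈ S) (hx : x ∉ S) (haH : ∀ v c, (a, v, c) ∉ H) {l : C} (hl : l ∈ Y)
    (hlH : (insert l (palette H)).card ≠ 2) :
    ∃ g : V → V → C, IsProper (insert x S) g ∧
      (∀ u ∈ insert x S, ∀ v ∈ insert x S, g u v ∈ Y) ∧
      (∀ u v c, (u, v, c) ∈ H → g u v = c) ∧ g a x = l := by
  have hK := hH.insertEdge (u := a) (v := x) (c := l) (fun h => hx (h ▸ ha)) (fun k => haH x k)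
    (fun w => haH w l) (fun w h => hx (hHS _ _ _ h).1)
  have hc := Finset.card_insert_le (a, x, l) (insert (x, a, l) H)
  have hc' := Finset.card_insert_le (x, a, l) H
  obtain ⟨g, hg, hgY, hgH⟩ := hm.exists_on (T := insert x S) (Y := Y)
    (by rw [Finset.card_insert_of_notMem hx]; omega) hY hK (fun u v c h => by
      simp only [Finset.mem_insert, Prod.mk.injEq] at h ⊢
      rcases h with ⟨rfl, rfl, rfl⟩ | ⟨rfl, rfl, rfl⟩ | h
      · exact ⟨Or.inr ha, hl⟩
      · exact ⟨Or.inl rfl, hl⟩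
      · exact ⟨Or.inr (hHS _ _ _ h).1, (hHS _ _ _ h).2⟩)
    (by omega) (fun hexc => by
      have h := hexc.card_palette hK
      simp only [palette, Finset.image_insert] at h
      rw [Finset.insert_idem] at h
      exact hlH h)
  exact ⟨g, hg, hgY, fun u v c h => hgH _ _ _ (by simp [h]), hgH _ _ _ (by simp)⟩

theorem exists_mem_card_insert_ne_two {Y A : Finset C} (hA : A.Nonempty) (hAY : A ⊆ Y)
    (h : A.card + 2 ≤ Y.card) {e : C} (he : A ≠ {e}) :
    ∃ l ∈ Y, l ≠ e ∧ (insert l A).card ≠ 2 := by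
  by_cases h1 : A.card = 1
  · obtain ⟨c, rfl⟩ := Finset.card_eq_one.1 h1
    exact ⟨c, hAY (Finset.mem_singleton_self c), fun h => he (h ▸ rfl), by simp⟩
  · have h2 := Finset.card_sdiff_add_card_eq_card hAY
    have h3 := Finset.pred_card_le_card_erase (s := Y \ A) (a := e)
    obtain ⟨l, hl⟩ : ((Y \ A).erase e).Nonempty := by rw [← Finset.card_pos]; omega
    rw [Finset.mem_erase, Finset.mem_sdiff] at hl
    refine ⟨l, hl.2.1, hl.1, ?_⟩
    rw [Finset.card_insert_of_notMem hl.2.2]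
    have := hA.card_pos
    omega

theorem exists_two_mem_card_insert_ne_two {Y A B : Finset C} (hA : A.Nonempty) (hAY : A ⊆ Y)
    (hAc : A.card + 2 ≤ Y.card) (hB : B.Nonempty) (hBY : B ⊆ Y) (hBc : B.card + 2 ≤ Y.card)
    (h : ∀ c, A = {c} → B ≠ {c}) :
    ∃ l ∈ Y, ∃ l' ∈ Y, l ≠ l' ∧ (insert l A).card ≠ 2 ∧ (insert l' B).card ≠ 2 := by
  by_cases hA1 : ∃ c, A = {c}
  · obtain ⟨c, rfl⟩ := hA1
    obtain ⟨l, hl, hlc, hlB⟩ := exists_mem_card_insert_ne_two hB hBY hBc (h c rfl)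
    exact ⟨c, hAY (Finset.mem_singleton_self c), l, hl, hlc.symm, by simp, hlB⟩
  · obtain ⟨e, he⟩ := hB
    obtain ⟨l', hl', hlB⟩ : ∃ l' ∈ Y, (insert l' B).card ≠ 2 := by
      by_cases hB1 : B = {e}
      · exact ⟨e, hBY he, by simp [hB1]⟩
      · obtain ⟨l, hl, -, h'⟩ := exists_mem_card_insert_ne_two ⟨e, he⟩ hBY hBc hB1
        exact ⟨l, hl, h'⟩
    obtain ⟨l, hl, hll, hlA⟩ := exists_mem_card_insert_ne_two hA hAY hAc
      (e := l') fun h => hA1 ⟨_, h⟩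
    exact ⟨l, hl, l', hl', hll, hlA, hlB⟩

/-- Completion of a perfect matching along a splitting into two parts of odd size with a single
crossing edge. -/
theorem Completable.of_splits_odd_single {m n : ℕ} (hm : AndersenHilton m) (hmn : n + 1 = 2 * m)
    (hn : 3 ≤ n) (hC : Fintype.card C + 1 = Fintype.card V) (hV : Fintype.card V = 2 * n)
    (hH : IsPrecoloring H) (hcard : H.card = 2 * n) (hiso : ∀ p ∈ H, p ∈ isolated H)
    (hz : (covered H).card = 2 * n) {a b : V} {c₀ : C} (hB : IsIsolatedSet H ({(a, b, c₀)} ∪ Q))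
    (hPQ : Disjoint {(a, b, c₀)} Q) (h1 : 1 + 2 * Q.card = n)
    {Y : Finset C} (hY : Y.card = n)
    (hYH : palette (H \ ({(a, b, c₀)} ∪ reversal {(a, b, c₀)})) ⊆ Y)
    (hc₀ : c₀ ∉ Y) (hexc : ¬ IsExceptional Finset.univ H) : Completable H := by
  obtain ⟨S, hS, hSp, hSu⟩ := hB.exists_splits hH hPQ (z := 0) hV hz
    (by rw [Finset.card_singleton]; omega) (by rw [Finset.card_singleton]; omega)
  have hc := hSp.card_inside hH hB hPQ
  have hc' := hSp.card_inside_compl hB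
  rw [Finset.card_singleton] at hc
  have hS' : Sᶜ.card = n := by rw [Finset.card_compl, hV, hS]; omega
  have hab := Finset.mem_union_left Q (Finset.mem_singleton_self (a, b, c₀))
  obtain ⟨ha, hb⟩ := hSp.of_cross _ _ _ (Finset.mem_singleton_self (a, b, c₀))
  have hin : ∀ u v c, (u, v, c) ∈ inside H S → u ∈ S ∧ c ∈ Y := fun u v c h => by
    rw [mem_inside] at h
    exact ⟨h.2.1, hSp.mem_palette_of_iff hYH h.1 (by tauto)⟩
  have hin' : ∀ u v c, (u, v, c) ∈ inside H Sᶜ → u ∈ Sᶜ ∧ c ∈ Y := fun u v c h => by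
    rw [mem_inside, Finset.mem_compl, Finset.mem_compl] at h
    exact ⟨Finset.mem_compl.2 h.2.1, hSp.mem_palette_of_iff hYH h.1 (by tauto)⟩
  have hp := (hH.inside S).two_mul_card_palette_le
  have hp' := (hH.inside Sᶜ).two_mul_card_palette_le
  have hne : ∀ K : Finset (V × V × C), 0 < K.card → (palette K).Nonempty := fun K h =>
    (Finset.card_pos.1 h).image _
  obtain ⟨l, hl, l', hl', hll, hlS, hlS'⟩ := exists_two_mem_card_insert_ne_two
    (hne (inside H S) (by omega))
    (fun c h => by obtain ⟨u, v, h⟩ := mem_palette.1 h; exact (hin _ _ _ h).2) (by omega)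
    (hne (inside H Sᶜ) (by omega))
    (fun c h => by obtain ⟨u, v, h⟩ := mem_palette.1 h; exact (hin' _ _ _ h).2) (by omega)
    (fun c h h' => by
      have hcY : ∀ u v k, (u, v, k) ∈ H → (u ∈ S ↔ v ∈ S) → k = c := by
        intro u v k hk huv
        by_cases hu : u ∈ S
        · have : k ∈ palette (inside H S) :=
            mem_palette.2 ⟨u, v, mem_inside.2 ⟨hk, hu, huv.1 hu⟩⟩
          rwa [h, Finset.mem_singleton] at this
        · have : k ∈ palette (inside H Sᶜ) :=
            mem_palette.2 ⟨u, v, mem_inside.2 ⟨hk, by simpa using hu, by simpa [← huv] using hu⟩⟩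
          rwa [h', Finset.mem_singleton] at this
      obtain ⟨u₀, v₀, h₀⟩ := mem_palette.1 (h ▸ Finset.mem_singleton_self c)
      refine hexc ⟨fun u _ => ?_, fun u v k v' k' hk hk' => ?_, a, b, c, c₀, ?_,
        (hB.leaf _ _ _ hab).1, ⟨u₀, v₀, (mem_inside.1 h₀).1⟩, fun u v e he => ?_⟩
      · rw [← mem_covered, Finset.eq_univ_of_card (covered H) (hz.trans hV.symm)]
        exact Finset.mem_univ u
      · exact (((mem_isolated.1 (hiso _ hk)).1.2 _ _ hk').1).symm
      · rintro rfl
        exact hc₀ (hin _ _ _ h₀).2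
      · by_cases hu : u ∈ S <;> by_cases hv : v ∈ S
        · exact Or.inl (hcY _ _ _ he (by tauto))
        · have := hSp.cross _ _ _ he hu hv
          simp only [Finset.mem_singleton, Prod.mk.injEq] at this
          tauto
        · have := hSp.cross _ _ _ (hH.symm _ _ _ he) hv hu
          simp only [Finset.mem_singleton, Prod.mk.injEq] at this
          tauto
        · exact Or.inl (hcY _ _ _ he (by tauto)))
  obtain ⟨f, hf, hfY, hfH, hfl⟩ := hm.exists_on_insert (by omega) (by omega) (hH.inside S) hin
    (by omega) ha hb (fun v c h => by
      rw [mem_inside] at h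
      exact hb (((hB.leaf _ _ _ hab).2 _ _ h.1).1 ▸ h.2.2)) hl hlS
  obtain ⟨g, hg, hgY, hgH, hgl⟩ := hm.exists_on_insert (by omega) (by omega) (hH.inside Sᶜ) hin'
    (by omega) (a := b) (x := a) (by simpa using hb) (by simpa using ha) (fun v c h => by
      rw [mem_inside] at h
      exact Finset.mem_compl.1 h.2.2 (((hB.leaf' _ _ _ hab).2 _ _ h.1).1 ▸ ha)) hl' hlS'
  refine hSp.completable_odd (by omega) hC hV hH hB hS hY hb ha hf hg hfY hgY hfH hgH hc₀ ?_ ?_ ?_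
  · intro u v c h
    simp only [Finset.mem_singleton, Prod.mk.injEq] at h
    exact h.2.2
  · rw [Finset.card_singleton]; omega
  · intro _ u v h
    simp only [Finset.mem_singleton, Prod.mk.injEq] at h
    obtain ⟨rfl, rfl, -⟩ := h
    rwa [hfl, hgl]

end

section

variable {V C : Type} [DecidableEq V] [DecidableEq C] {H P Q B : Finset (V × V × C)}

theorem IsIsolatedSet.exists_partner (hP : IsIsolatedSet H P) :
    ∃ e : V → V, (∀ u v c, (u, v, c) ∈ P → e u = v) ∧
      Set.InjOn e (P.image fun p => p.1 : Finset V) := by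
  have : ∀ u, ∃ w, ∀ v c, (u, v, c) ∈ P → w = v := by
    intro u
    by_cases h : ∃ v c, (u, v, c) ∈ P
    · obtain ⟨v, c, h⟩ := h
      exact ⟨v, fun v' c' h' => ((hP.leaf _ _ _ h').2 _ _ (hP.leaf _ _ _ h).1).1⟩
    · exact ⟨u, fun v c h' => absurd ⟨v, c, h'⟩ h⟩
  choose e he using this
  refine ⟨e, he, fun u hu u' hu' h => ?_⟩
  obtain ⟨⟨a, v, c⟩, hp, rfl⟩ := Finset.mem_image.1 (Finset.mem_coe.1 hu)
  obtain ⟨⟨a', v', c'⟩, hp', rfl⟩ := Finset.mem_image.1 (Finset.mem_coe.1 hu')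
  simp only [he _ _ _ hp, he _ _ _ hp'] at h
  subst h
  exact ((hP.leaf' _ _ _ hp').2 _ _ (hP.leaf' _ _ _ hp).1).1

theorem IsIsolatedSet.card_image_fst (hP : IsIsolatedSet H P) :
    (P.image fun p => p.1).card = P.card := by
  refine Finset.card_image_of_injOn ?_
  rintro ⟨u, v, c⟩ h ⟨u', v', c'⟩ h' (rfl : u = u')
  obtain ⟨rfl, rfl⟩ := (hP.leaf _ _ _ h).2 _ _ (hP.leaf _ _ _ h').1
  rfl

variable [Fintype V]

theorem IsIsolatedSet.exists_crossing (hP : IsIsolatedSet H P) {c : C}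
    (hc : ∀ u v k, (u, v, k) ∈ P → k = c) {S : Finset V} (hV : Fintype.card V = 2 * S.card)
    (hS : ∀ u v k, (u, v, k) ∈ P → u ∈ S ∧ v ∉ S) :
    ∃ σ : C → V → V, (∀ k ∈ ({c} : Finset C), ∀ s ∈ S, σ k s ∉ S) ∧
      (∀ k ∈ ({c} : Finset C), Set.InjOn (σ k) S) ∧
      (∀ k ∈ ({c} : Finset C), ∀ l ∈ ({c} : Finset C), ∀ s ∈ S, σ k s = σ l s → k = l) ∧
      ∀ u v k, (u, v, k) ∈ P → k ∈ ({c} : Finset C) ∧ σ k u = v := by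
  have hS' : S.card = Sᶜ.card := by rw [Finset.card_compl]; omega
  obtain ⟨e, he, hinj⟩ := hP.exists_partner
  rcases isEmpty_or_nonempty V with hV0 | hV0
  · exact ⟨fun _ s => s, fun _ _ s => isEmptyElim s, fun _ _ s => isEmptyElim s,
      fun k hk l hl s => isEmptyElim s, fun u => isEmptyElim u⟩
  obtain ⟨σ, hσ, hσS, hσi⟩ := exists_injOn_extension hS' (E := P.image fun p => p.1)
    (fun u hu => by
      obtain ⟨⟨a, v, k⟩, hp, rfl⟩ := Finset.mem_image.1 hu
      exact (hS _ _ _ hp).1) e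
    (fun u hu => by
      obtain ⟨⟨a, v, k⟩, hp, rfl⟩ := Finset.mem_image.1 hu
      simp only [he _ _ _ hp]
      exact Finset.mem_compl.2 (hS _ _ _ hp).2) hinj
  simp only [Finset.mem_singleton]
  refine ⟨fun _ => σ, fun _ _ s hs => Finset.mem_compl.1 (hσS s hs), fun _ _ => hσi,
    fun k hk l hl _ _ _ => hk.trans hl.symm, fun u v k h => ⟨hc _ _ _ h, ?_⟩⟩
  exact (hσ u (Finset.mem_image_of_mem _ h)).trans (he _ _ _ h)

theorem IsIsolatedSet.exists_two_crossing (hP : IsIsolatedSet H P) {c c' : C} (hcc : c ≠ c')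
    (hc : ∀ u v k, (u, v, k) ∈ P → k = c ∨ k = c') {S : Finset V}
    (hV : Fintype.card V = 2 * S.card) (h4 : 4 ≤ S.card)
    (h1 : (P.filter fun p => p.2.2 = c).card + 2 ≤ S.card)
    (h2 : (P.filter fun p => p.2.2 = c').card + 2 ≤ S.card)
    (hS : ∀ u v k, (u, v, k) ∈ P → u ∈ S ∧ v ∉ S) :
    ∃ σ : C → V → V, (∀ k ∈ ({c, c'} : Finset C), ∀ s ∈ S, σ k s ∉ S) ∧
      (∀ k ∈ ({c, c'} : Finset C), Set.InjOn (σ k) S) ∧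
      (∀ k ∈ ({c, c'} : Finset C), ∀ l ∈ ({c, c'} : Finset C), ∀ s ∈ S, σ k s = σ l s → k = l) ∧
      ∀ u v k, (u, v, k) ∈ P → k ∈ ({c, c'} : Finset C) ∧ σ k u = v := by
  have hS' : S.card = Sᶜ.card := by rw [Finset.card_compl]; omega
  obtain ⟨e, he, hinj⟩ := hP.exists_partner
  have : Nonempty V := Fintype.card_pos_iff.1 (by omega)
  have hE : ∀ d, ∀ u ∈ (P.filter fun p => p.2.2 = d).image (fun p => p.1),
      u ∈ S ∧ e u ∉ S ∧ u ∈ P.image fun p => p.1 := by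
    intro d u hu
    obtain ⟨⟨a, v, k⟩, hp, rfl⟩ := Finset.mem_image.1 hu
    have hp := (Finset.mem_filter.1 hp).1
    simp only [he _ _ _ hp]
    exact ⟨(hS _ _ _ hp).1, (hS _ _ _ hp).2, Finset.mem_image_of_mem _ hp⟩
  obtain ⟨σ, σ', hσ, hσ', hσS, hσS', hσi, hσi', hd⟩ := exists_two_injOn hS' h4
    (E := (P.filter fun p => p.2.2 = c).image fun p => p.1)
    (E' := (P.filter fun p => p.2.2 = c').image fun p => p.1)
    (fun u hu => (hE _ u hu).1) (fun u hu => (hE _ u hu).1)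
    (Finset.disjoint_left.2 fun u hu hu' => by
      obtain ⟨⟨a, v, k⟩, hp, rfl⟩ := Finset.mem_image.1 hu
      obtain ⟨⟨a', v', k'⟩, hp', h'⟩ := Finset.mem_image.1 hu'
      simp only at h'
      subst h'
      rw [Finset.mem_filter] at hp hp'
      obtain ⟨-, rfl⟩ := (hP.leaf _ _ _ hp.1).2 _ _ (hP.leaf _ _ _ hp'.1).1
      exact hcc (hp.2.symm.trans hp'.2))
    (by rwa [(hP.mono (Finset.filter_subset _ _)).card_image_fst])
    (by rwa [(hP.mono (Finset.filter_subset _ _)).card_image_fst]) (e := e)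
    (fun u hu => by
      rw [Finset.mem_compl]
      rcases Finset.mem_union.1 hu with h | h
      · exact (hE _ u h).2.1
      · exact (hE _ u h).2.1)
    (hinj.mono fun u hu => by
      rcases Finset.mem_union.1 (Finset.mem_coe.1 hu) with h | h
      · exact Finset.mem_coe.2 (hE _ u h).2.2
      · exact Finset.mem_coe.2 (hE _ u h).2.2)
  simp only [Finset.mem_compl] at hσS hσS'
  simp only [Finset.mem_insert, Finset.mem_singleton]
  refine ⟨fun k => if k = c then σ else σ', fun k _ s hs => ?_, fun k _ => ?_,
    fun k hk l hl s hs h => ?_, fun u v k h => ⟨hc _ _ _ h, ?_⟩⟩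
  · beta_reduce
    split_ifs
    · exact hσS s hs
    · exact hσS' s hs
  · beta_reduce
    split_ifs
    · exact hσi
    · exact hσi'
  · beta_reduce at h
    split_ifs at h with h5 h6 h6
    · rw [h5, h6]
    · exact absurd h (hd s hs)
    · exact absurd h.symm (hd s hs)
    · rw [hk.resolve_left h5, hl.resolve_left h6]
  · beta_reduce
    rw [← he _ _ _ h]
    rcases hc _ _ _ h with hk | hk
    · rw [if_pos hk]
      exact hσ u (Finset.mem_image_of_mem _ (Finset.mem_filter.2 ⟨h, hk⟩))
    · rw [if_neg (hk ▸ hcc.symm)]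
      exact hσ' u (Finset.mem_image_of_mem _ (Finset.mem_filter.2 ⟨h, hk⟩))

theorem exists_subset_card_palette_ne_two {m : ℕ} (hm : 3 ≤ m) (hB : m ≤ B.card)
    (h : (palette B).card ≠ 2) : ∃ Q ⊆ B, Q.card = m ∧ (palette Q).card ≠ 2 := by
  by_cases h1 : (palette B).card ≤ 1
  · obtain ⟨Q, hQ, hQm⟩ := Finset.exists_subset_card_eq hB
    have := Finset.card_le_card (palette_mono hQ)
    exact ⟨Q, hQ, hQm, by omega⟩
  · obtain ⟨a, ha, b, hb, c, hc, hab, hac, hbc⟩ := Finset.two_lt_card.1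
      (show 2 < (palette B).card by omega)
    obtain ⟨u, v, ha⟩ := mem_palette.1 ha
    obtain ⟨u', v', hb⟩ := mem_palette.1 hb
    obtain ⟨u'', v'', hc⟩ := mem_palette.1 hc
    obtain ⟨Q, hQ, hQB, hQm⟩ := Finset.exists_subsuperset_card_eq
      (s := {(u, v, a), (u', v', b), (u'', v'', c)}) (t := B) (n := m)
      (by simp [Finset.insert_subset_iff, ha, hb, hc]) (Finset.card_le_three.trans hm) hB
    simp only [Finset.insert_subset_iff, Finset.singleton_subset_iff] at hQ
    have : ({a, b, c} : Finset C) ⊆ palette Q := by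
      simp only [Finset.insert_subset_iff, Finset.singleton_subset_iff]
      exact ⟨mem_palette.2 ⟨_, _, hQ.1⟩, mem_palette.2 ⟨_, _, hQ.2.1⟩,
        mem_palette.2 ⟨_, _, hQ.2.2⟩⟩
    have := Finset.card_le_card this
    rw [Finset.card_eq_three.2 ⟨a, b, c, hab, hac, hbc, rfl⟩] at this
    exact ⟨Q, hQB, hQm, by omega⟩

theorem exists_superset_card_eq_avoiding [Fintype C] {A F : Finset C} {n : ℕ} (hAF : Disjoint A F)
    (hA : A.card ≤ n) (hF : n + F.card ≤ Fintype.card C) :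
    ∃ Y : Finset C, A ⊆ Y ∧ Y.card = n ∧ ∀ c ∈ F, c ∉ Y := by
  obtain ⟨Y, hAY, hYF, hY⟩ := Finset.exists_subsuperset_card_eq (s := A) (t := Fᶜ) (n := n)
    (fun c hc => Finset.mem_compl.2 (Finset.disjoint_left.1 hAF hc)) hA
    (by rw [Finset.card_compl]; omega)
  exact ⟨Y, hAY, hY, fun c hc h => Finset.mem_compl.1 (hYF h) hc⟩

variable [Fintype C]

theorem IsPrecoloring.sdiff (hH : IsPrecoloring H) (P : Finset (V × V × C)) :
    IsPrecoloring (H \ (P ∪ reversal P)) :=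
  hH.subset Finset.sdiff_subset fun u v c h => by
    simp only [Finset.mem_sdiff, Finset.mem_union, mem_reversal] at h ⊢
    exact ⟨hH.symm _ _ _ h.1, by tauto⟩

theorem IsIsolatedSet.card_sdiff (hB : IsIsolatedSet H B) :
    (H \ (B ∪ reversal B)).card + 2 * B.card = H.card := by
  have := Finset.card_sdiff_add_card_eq_card (Finset.union_subset hB.subset hB.reversal_subset)
  rwa [hB.two_mul_card] at this

/-- Completion when some vertex is not incident to any precolored edge. -/
theorem Completable.of_covered_lt {n : ℕ} (ih : ∀ m < n, AndersenHilton m)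
    (hC : Fintype.card C + 1 = Fintype.card V) (hV : Fintype.card V = 2 * n)
    (hH : IsPrecoloring H) (hcard : H.card = 2 * n) (hs : (covered H).card < 2 * n)
    (hrec : ∀ H' : Finset (V × V × C), IsPrecoloring H' → H'.card = 2 * n →
      ¬ IsExceptional Finset.univ H' → (covered H').card < (covered H).card → Completable H') :
    Completable H := by
  have hV2 : Even (Fintype.card V) := ⟨n, by omega⟩
  by_cases hl : ∀ x u c x' u' c', IsLeaf H x u c → IsLeaf H x' u' c' → u ≠ u' → c = c'
  · exact Completable.of_leaves hC hV2 hH (by omega) hl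
  have hid : ∀ {x u c x' u' c'}, IsLeaf H x u c → IsLeaf H x' u' c' → u ≠ u' → c ≠ c' →
      Completable (identify H x u c x' u' c') := fun hx hx' huu hcc =>
    hrec _ (hH.identify hx hx' huu hcc) ((card_identify hH hx hx' huu hcc).trans hcard)
      (not_isExceptional_identify _ huu) (card_covered_identify_lt hH hx hx' huu hcc)
  push Not at hl
  obtain ⟨x, u, c, x', u', c', hx, hx', huu, hcc⟩ := hl
  obtain ⟨z, hz⟩ : ∃ z, (covered H).card + z = 2 * n := ⟨2 * n - (covered H).card, by omega⟩
  have hz1 : 1 ≤ z := by omega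
  by_cases hz2 : 2 * n < (z + 2) * (z + 1) + 4
  · refine Completable.of_identify hC hV2 hH hx hx' huu hcc hz1 (by omega) ?_
      (hid hx hx' huu hcc)
    obtain ⟨h1, h2, h3, h4, h5⟩ := hx.nbr_ne hH hx' huu hcc
    set F := H.filter fun p => ((p.1 ≠ x ∧ p.1 ≠ x') ∧ p.2.1 ≠ x ∧ p.2.1 ≠ x') ∧
      p.2.2 ≠ c ∧ p.2.2 ≠ c' with hF
    have hsub : ({(x, u, c), (u, x, c), (x', u', c'), (u', x', c')} : Finset (V × V × C)) ⊆
        H \ F := by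
      simp only [Finset.insert_subset_iff, Finset.singleton_subset_iff]
      simp [hF, hx.1, hx'.1, hH.symm _ _ _ hx.1, hH.symm _ _ _ hx'.1]
    have hc4 : ({(x, u, c), (u, x, c), (x', u', c'), (u', x', c')} : Finset (V × V × C)).card
        = 4 := by
      rw [Finset.card_insert_of_notMem, Finset.card_insert_of_notMem,
        Finset.card_insert_of_notMem, Finset.card_singleton]
      · simp [h5.symm]
      · simp [hcc]
      · simp [hcc, h2.symm]
    have h6 := Finset.card_le_card hsub
    have h7 := Finset.card_sdiff_add_card_eq_card (s := F) (t := H) (Finset.filter_subset _ _)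
    omega
  obtain ⟨B, hB, hBc, -⟩ := hH.exists_isolatedSet
  have h4 := four_mul_card_covered_le hH
  have h8 : 8 * z ≤ 2 * n := by
    obtain h | h : z ≤ 2 ∨ 3 ≤ z := by omega
    · interval_cases z <;> omega
    · nlinarith
  have hn5 : 5 ≤ n := by nlinarith
  rcases Nat.even_or_odd' n with ⟨m, hm | hm⟩
  · by_cases hp : (palette H).card + 1 ≤ n
    · by_cases hB2 : (palette B).card = 2
      · obtain ⟨a, b, hab, hpB⟩ := Finset.card_eq_two.1 hB2
        obtain ⟨y, w, hy⟩ := mem_palette.1 (show a ∈ palette B by simp [hpB])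
        obtain ⟨y', w', hy'⟩ := mem_palette.1 (show b ∈ palette B by simp [hpB])
        have hww : w ≠ w' := by
          rintro rfl
          exact hab ((hB.leaf' _ _ _ hy').2 _ _ (hB.leaf' _ _ _ hy).1).2
        refine Completable.of_identify hC hV2 hH (hB.leaf _ _ _ hy) (hB.leaf _ _ _ hy') hww hab
          hz1 (by omega) ?_ (hid (hB.leaf _ _ _ hy) (hB.leaf _ _ _ hy') hww hab)
        have hsub : (H.filter fun p => ((p.1 ≠ y ∧ p.1 ≠ y') ∧ p.2.1 ≠ y ∧ p.2.1 ≠ y') ∧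
            p.2.2 ≠ a ∧ p.2.2 ≠ b) ⊆ H \ (B ∪ reversal B) := by
          rintro ⟨s, t, k⟩ h
          rw [Finset.mem_filter] at h
          refine Finset.mem_sdiff.2 ⟨h.1, fun h' => ?_⟩
          have : k ∈ palette B := by
            rw [← palette_union_reversal]
            exact mem_palette.2 ⟨_, _, h'⟩
          rw [hpB, Finset.mem_insert, Finset.mem_singleton] at this
          tauto
        have h9 := Finset.card_le_card hsub
        have h10 := hB.card_sdiff
        nlinarith
      · obtain ⟨Q, hQB, hQm, hQ2⟩ := exists_subset_card_palette_ne_two (m := m) (by omega)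
          (by omega) hB2
        obtain ⟨Y, hHY, hY, -⟩ := exists_superset_card_eq_avoiding (A := palette H) (F := ∅)
          (n := n - 1) (by simp) (by omega) (by simp; omega)
        refine Completable.of_splits_even (P := ∅) (Q := Q) (z := z) (Y := Y) (D := ∅)
          (ih m (by omega)) hC (by omega) hH
          (by simpa using hB.mono hQB) (by simp) (by omega) (by simp; omega) (by simp; omega)
          (by simp; omega) (by omega) ((palette_mono Finset.sdiff_subset).trans hHY) (by simp)
          (fun S _ _ => ⟨fun _ s => s, by simp⟩) (Or.inr (Or.inl ⟨by simp; omega, hz1⟩))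
          (Or.inr hQ2)
    · obtain ⟨⟨a, b, k⟩, hp0⟩ : B.Nonempty := by rw [← Finset.card_pos]; omega
      obtain ⟨Q, hQB, hQm⟩ := Finset.exists_subset_card_eq (s := B.erase (a, b, k)) (n := m - 1)
        (by rw [Finset.card_erase_of_mem hp0]; omega)
      have hpB : {(a, b, k)} ∪ Q ⊆ B := Finset.union_subset (by simpa using hp0)
        (hQB.trans (Finset.erase_subset _ _))
      have hP1 := hB.mono (Finset.singleton_subset_iff.2 hp0)
      have h5 := hP1.card_sdiff
      have h6 := (hH.sdiff {(a, b, k)}).two_mul_card_palette_le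
      rw [Finset.card_singleton] at h5
      have hk : k ∉ palette (H \ ({(a, b, k)} ∪ reversal {(a, b, k)})) := by
        intro hk
        have : palette H ⊆ palette (H \ ({(a, b, k)} ∪ reversal {(a, b, k)})) := by
          intro l hl
          obtain ⟨s, t, hl⟩ := mem_palette.1 hl
          by_cases h : (s, t, l) ∈ ({(a, b, k)} ∪ reversal {(a, b, k)} : Finset (V × V × C))
          · obtain rfl : l = k := by
              simp only [Finset.mem_union, mem_reversal, Finset.mem_singleton,
                Prod.mk.injEq] at h
              tauto
            exact hk
          · exact mem_palette.2 ⟨s, t, Finset.mem_sdiff.2 ⟨hl, h⟩⟩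
        have := Finset.card_le_card this
        omega
      obtain ⟨Y, hHY, hY, hkY⟩ := exists_superset_card_eq_avoiding
        (A := palette (H \ ({(a, b, k)} ∪ reversal {(a, b, k)}))) (F := {k})
        (n := n - 1) (by simpa using hk) (by omega) (by simp; omega)
      refine Completable.of_splits_even (P := {(a, b, k)}) (Q := Q) (z := z) (Y := Y) (D := {k})
        (ih m (by omega)) hC (by omega) hH (hB.mono hpB)
        (Finset.disjoint_left.2 fun p hp hpQ => ?_) (by omega) (by simp; omega) (by simp; omega)
        (by simp; omega) (by omega) hHY hkY
        (fun S hS hcr => hP1.exists_crossing (by simp) (by omega) hcr) (Or.inl (by simp))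
        (Or.inl (by simp))
      rw [Finset.mem_singleton] at hp
      exact (Finset.mem_erase.1 (hQB hpQ)).1 hp
  · obtain ⟨Q, hQB, hQm⟩ := Finset.exists_subset_card_eq (s := B) (n := m) (by omega)
    have h5 := hH.two_mul_card_palette_le
    obtain ⟨Y, hHY, hY, -⟩ := exists_superset_card_eq_avoiding (A := palette H) (F := ∅)
      (n := n) (by simp) (by omega) (by simp; omega)
    obtain ⟨c₀, hc₀⟩ : ∃ c₀, c₀ ∉ Y := by
      by_contra! hall
      rw [Finset.eq_univ_of_forall hall, Finset.card_univ] at hY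
      omega
    exact Completable.of_splits_odd (P := ∅) (Q := Q) (z := z) (m := m + 1) (Y := Y)
      (ih (m + 1) (by omega)) (by omega) (by omega) hC hV hH (by simpa using hB.mono hQB) (by simp)
      hz (by simp; omega) (by simp; omega) (by simp; omega) hY
      ((palette_mono Finset.sdiff_subset).trans hHY) hc₀ (by simp) (by simp; omega) (by simp)

end

section

variable {V C : Type} [DecidableEq V] [DecidableEq C] {H P Q B : Finset (V × V × C)}

/-- The edges of `B` of color `c`. -/
def colorClass (B : Finset (V × V × C)) (c : C) : Finset (V × V × C) := B.filter fun p => p.2.2 = c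

theorem mem_colorClass {u v : V} {k c : C} :
    (u, v, k) ∈ colorClass B c ↔ (u, v, k) ∈ B ∧ k = c := Finset.mem_filter

theorem colorClass_subset (c : C) : colorClass B c ⊆ B := Finset.filter_subset _ _

theorem disjoint_colorClass {c c' : C} (h : c ≠ c') :
    Disjoint (colorClass B c) (colorClass B c') :=
  Finset.disjoint_left.2 fun _ hp hp' =>
    h ((Finset.mem_filter.1 hp).2.symm.trans (Finset.mem_filter.1 hp').2)

theorem colorClass_nonempty {c : C} (h : c ∈ palette B) : (colorClass B c).Nonempty := by
  obtain ⟨u, v, h⟩ := mem_palette.1 h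
  exact ⟨_, mem_colorClass.2 ⟨h, rfl⟩⟩

theorem sum_card_colorClass (B : Finset (V × V × C)) :
    ∑ c ∈ palette B, (colorClass B c).card = B.card :=
  (Finset.card_eq_sum_card_image (fun p : V × V × C => p.2.2) B).symm

theorem card_palette_le (B : Finset (V × V × C)) : (palette B).card ≤ B.card :=
  Finset.card_image_le

theorem palette_sdiff_subset (hHB : H ⊆ B ∪ reversal B) :
    palette (H \ (P ∪ reversal P)) ⊆ palette (B \ P) := by
  intro c hc
  obtain ⟨u, v, h⟩ := mem_palette.1 hc
  simp only [Finset.mem_sdiff, Finset.mem_union, mem_reversal, not_or] at h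
  have h' := hHB h.1
  rw [Finset.mem_union, mem_reversal] at h'
  rcases h' with h' | h'
  · exact mem_palette.2 ⟨u, v, Finset.mem_sdiff.2 ⟨h', h.2.1⟩⟩
  · exact mem_palette.2 ⟨v, u, Finset.mem_sdiff.2 ⟨h', h.2.2⟩⟩

theorem notMem_palette_sdiff {c : C} (h : colorClass B c ⊆ P) : c ∉ palette (B \ P) := fun hc => by
  obtain ⟨u, v, h'⟩ := mem_palette.1 hc
  rw [Finset.mem_sdiff] at h'
  exact h'.2 (h (mem_colorClass.2 ⟨h'.1, rfl⟩))

variable [Fintype V] [Fintype C]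

theorem isExceptional_of_card_colorClass (hs : (covered H).card = Fintype.card V)
    (hB : IsIsolatedSet H B) (hiso : ∀ p ∈ H, p ∈ isolated H) (hHB : H ⊆ B ∪ reversal B) {c : C}
    (hc : c ∈ palette B) (hcard : (colorClass B c).card + 1 = B.card) :
    IsExceptional Finset.univ H := by
  have h1 := Finset.card_sdiff_add_card_eq_card (colorClass_subset (B := B) c)
  obtain ⟨⟨x, y, c'⟩, hxy⟩ := Finset.card_eq_one.1 (show (B \ colorClass B c).card = 1 by omega)
  have h2 : ∀ u v k, (u, v, k) ∈ B → k = c ∨ (u, v, k) = (x, y, c') := fun u v k h => by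
    by_contra! hk
    have : (u, v, k) ∈ B \ colorClass B c :=
      Finset.mem_sdiff.2 ⟨h, fun h' => hk.1 (mem_colorClass.1 h').2⟩
    rw [hxy, Finset.mem_singleton] at this
    exact hk.2 this
  have h3 : (x, y, c') ∈ B \ colorClass B c := hxy ▸ Finset.mem_singleton_self _
  rw [Finset.mem_sdiff, mem_colorClass] at h3
  obtain ⟨u, v, hu⟩ := mem_palette.1 hc
  refine ⟨fun u _ => mem_covered.1 ((Finset.eq_univ_of_card _ hs).symm ▸ Finset.mem_univ u),
    fun u v k v' k' h h' => ((mem_isolated.1 (hiso _ h')).1.2 _ _ h).1,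
    x, y, c, c', fun h => h3.2 ⟨h3.1, h.symm⟩, hB.subset h3.1, ⟨u, v, hB.subset hu⟩,
    fun u v k h => ?_⟩
  have h' := hHB h
  rw [Finset.mem_union, mem_reversal] at h'
  rcases h' with h' | h'
  · rcases h2 _ _ _ h' with h' | h'
    · exact Or.inl h'
    · simp only [Prod.mk.injEq] at h'
      exact Or.inr (Or.inl ⟨h'.1, h'.2.1⟩)
  · rcases h2 _ _ _ h' with h' | h'
    · exact Or.inl h'
    · simp only [Prod.mk.injEq] at h'
      exact Or.inr (Or.inr ⟨h'.2.1, h'.1⟩)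

/-- Completion when the precolored edges form a perfect matching. -/
theorem Completable.of_covered_eq {n : ℕ} (hn : 2 ≤ n) (ih : ∀ m < n, AndersenHilton m)
    (hC : Fintype.card C + 1 = Fintype.card V) (hV : Fintype.card V = 2 * n)
    (hH : IsPrecoloring H) (hcard : H.card = 2 * n) (hs : (covered H).card = 2 * n)
    (hexc : ¬ IsExceptional Finset.univ H) : Completable H := by
  have h4 := four_mul_card_covered_le hH
  have hiH : isolated H = H :=
    Finset.eq_of_subset_of_card_le (fun ⟨_, _, _⟩ h => (mem_isolated.1 h).1.1) (by omega)
  have hiso : ∀ p ∈ H, p ∈ isolated H := fun p hp => hiH.symm ▸ hp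
  obtain ⟨B, hB, hBc, hBH⟩ := hH.exists_isolatedSet
  have hHB : H ⊆ B ∪ reversal B := fun p hp => Finset.mem_union.2 (hBH p (hiso p hp))
  rw [hiH, hcard] at hBc
  have hBn : B.card = n := by omega
  have hclass : ∀ c ∈ palette B, (colorClass B c).card + 1 ≠ n := fun c hc h =>
    hexc (isExceptional_of_card_colorClass (hs.trans hV.symm) hB hiso hHB hc (h.trans hBn.symm))
  have hle : ∀ P ⊆ B, (palette (H \ (P ∪ reversal P))).card + P.card ≤ n := fun P hP => by
    have h1 := Finset.card_le_card (palette_sdiff_subset (P := P) hHB)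
    have h2 := card_palette_le (B \ P)
    have h3 := Finset.card_sdiff_add_card_eq_card hP
    omega
  have hfree : ∀ P c, colorClass B c ⊆ P → c ∉ palette (H \ (P ∪ reversal P)) :=
    fun P c h hc => notMem_palette_sdiff h (palette_sdiff_subset hHB hc)
  have hQ : ∀ P ⊆ B, ∀ q, P.card + 2 * q = n → ∃ Q, P ∪ Q ⊆ B ∧ Disjoint P Q ∧ Q.card = q := by
    intro P hP q hq
    have h3 := Finset.card_sdiff_add_card_eq_card hP
    obtain ⟨Q, hQB, hQ⟩ := Finset.exists_subset_card_eq (show q ≤ (B \ P).card by omega)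
    exact ⟨Q, Finset.union_subset hP (hQB.trans Finset.sdiff_subset),
      Finset.disjoint_of_subset_right hQB Finset.disjoint_sdiff, hQ⟩
  rcases Nat.even_or_odd' n with ⟨m, hm | hm⟩
  · by_cases hp : (palette B).card ≤ 1
    · obtain ⟨Q, hQB, hPQ, hQm⟩ := hQ ∅ (by simp) m (by simp; omega)
      have hpH : palette H ⊆ palette B := by
        rw [← palette_union_reversal B]
        exact palette_mono hHB
      have h5 := Finset.card_le_card hpH
      have h6 := Finset.card_le_card (palette_mono (show Q ⊆ B by simpa using hQB))
      obtain ⟨Y, hHY, hY, -⟩ := exists_superset_card_eq_avoiding (A := palette H) (F := ∅)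
        (n := n - 1) (by simp) (by omega) (by simp; omega)
      exact Completable.of_splits_even (P := ∅) (Q := Q) (z := 0) (Y := Y) (D := ∅)
        (ih m (by omega)) hC (by omega) hH (hB.mono hQB) hPQ (by omega) (by simp; omega)
        (by simp; omega) (by simp; omega) (by omega)
        ((palette_mono Finset.sdiff_subset).trans hHY) (by simp)
        (fun S _ _ => ⟨fun _ s => s, by simp⟩) (Or.inr (Or.inr (by omega))) (Or.inr (by omega))
    by_cases hev : ∃ c ∈ palette B, Even (colorClass B c).card
    · obtain ⟨c, hc, a, ha⟩ := hev
      have hcB := colorClass_subset (B := B) c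
      have hne := colorClass_nonempty hc
      have hpos := hne.card_pos
      have h5 := Finset.card_le_card hcB
      obtain ⟨Q, hQB, hPQ, hQm⟩ := hQ _ hcB (m - a) (by omega)
      have h6 := hle _ hcB
      obtain ⟨Y, hHY, hY, hcY⟩ := exists_superset_card_eq_avoiding (F := {c}) (n := n - 1)
        (Finset.disjoint_singleton_right.2 (hfree _ c subset_rfl)) (by omega) (by simp; omega)
      exact Completable.of_splits_even (Q := Q) (z := 0) (Y := Y) (D := {c})
        (ih m (by omega)) hC (by omega) hH (hB.mono hQB) hPQ (by omega) (by omega)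
        (by omega) (by omega) (by omega) hHY hcY
        (fun S hS hcr => (hB.mono hcB).exists_crossing (fun u v k h => (mem_colorClass.1 h).2)
          (by omega) hcr) (Or.inl hne) (Or.inl hne)
    · push Not at hev
      obtain ⟨c, hc, c', hc', hcc⟩ := Finset.one_lt_card.1 (show 1 < (palette B).card by omega)
      have hodd := Nat.not_even_iff_odd.1 (hev c hc)
      have hodd' := Nat.not_even_iff_odd.1 (hev c' hc')
      have hPB : colorClass B c ∪ colorClass B c' ⊆ B :=
        Finset.union_subset (colorClass_subset c) (colorClass_subset c')
      have hPc := Finset.card_union_of_disjoint (disjoint_colorClass (B := B) hcc)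
      have hPle := Finset.card_le_card hPB
      have hcn := hclass c hc
      have hcn' := hclass c' hc'
      obtain ⟨a, ha⟩ := hodd
      obtain ⟨a', ha'⟩ := hodd'
      obtain ⟨Q, hQB, hPQ, hQm⟩ := hQ _ hPB (m - a - a' - 1) (by omega)
      have h6 := hle _ hPB
      have hne := (colorClass_nonempty hc).mono (Finset.subset_union_left (s₂ := colorClass B c'))
      obtain ⟨Y, hHY, hY, hcY⟩ := exists_superset_card_eq_avoiding (F := {c, c'}) (n := n - 1)
        (A := palette (H \ (colorClass B c ∪ colorClass B c' ∪
          reversal (colorClass B c ∪ colorClass B c'))))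
        (by
          rw [Finset.disjoint_insert_right, Finset.disjoint_singleton_right]
          exact ⟨hfree _ c Finset.subset_union_left, hfree _ c' Finset.subset_union_right⟩)
        (by omega) (by rw [Finset.card_pair hcc]; omega)
      have hfilter : ∀ d, ((colorClass B c ∪ colorClass B c').filter fun p => p.2.2 = d).card ≤
          (colorClass B d).card := fun d =>
        Finset.card_le_card (Finset.filter_subset_filter _ hPB)
      have hf := hfilter c
      have hf' := hfilter c'
      refine Completable.of_splits_even (Q := Q) (z := 0) (Y := Y) (D := {c, c'})
        (ih m (by omega)) hC (by omega) hH (hB.mono hQB) hPQ (by omega) (by omega)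
        (by omega) (by omega) (by omega) hHY hcY
        (fun S hS hcr => (hB.mono hPB).exists_two_crossing hcc (fun u v k h => ?_)
          (by omega) (by omega) (by omega) (by omega) hcr) (Or.inl hne) (Or.inl hne)
      rw [Finset.mem_union, mem_colorClass, mem_colorClass] at h
      exact h.imp And.right And.right
  · obtain ⟨c, hc, hodd⟩ : ∃ c ∈ palette B, Odd (colorClass B c).card := by
      by_contra! hall
      have := Finset.even_sum _ fun c hc => Nat.not_odd_iff_even.1 (hall c hc)
      rw [sum_card_colorClass, hBn, Nat.even_iff] at this
      omega
    obtain ⟨a, ha⟩ := hodd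
    have hcB := colorClass_subset (B := B) c
    have h5 := Finset.card_le_card hcB
    obtain ⟨Q, hQB, hPQ, hQm⟩ := hQ _ hcB (m - a) (by omega)
    have h6 := hle _ hcB
    obtain ⟨Y, hHY, hY, hcY⟩ := exists_superset_card_eq_avoiding (F := {c}) (n := n)
      (Finset.disjoint_singleton_right.2 (hfree _ c subset_rfl)) (by omega) (by simp; omega)
    have hcY := hcY c (Finset.mem_singleton_self c)
    by_cases h1 : (colorClass B c).card = 1
    · obtain ⟨⟨x, y, k⟩, hP⟩ := Finset.card_eq_one.1 h1
      obtain rfl : k = c :=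
        (mem_colorClass.1 (hP ▸ Finset.mem_singleton_self _ : (x, y, k) ∈ colorClass B c)).2
      rw [hP] at hHY hQB hPQ
      exact Completable.of_splits_odd_single (m := m + 1) (ih _ (by omega)) (by omega) (by omega)
        hC hV hH hcard hiso hs (hB.mono hQB) hPQ (by omega) hY hHY hcY hexc
    · exact Completable.of_splits_odd (m := m + 1) (z := 0) (ih _ (by omega)) (by omega) hn hC hV
        hH (hB.mono hQB) hPQ (by omega) (by omega) (by omega) (by omega) hY hHY hcY
        (fun u v k h => (mem_colorClass.1 h).2) (by omega) h1

end

section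

variable {V C : Type} [DecidableEq V] [DecidableEq C] [Fintype V] [Fintype C]
  {H : Finset (V × V × C)}

theorem exists_card_insert_ne_two {A : Finset C} (h : A.card < Fintype.card C) :
    ∃ l, (insert l A).card ≠ 2 := by
  by_cases h1 : A.card = 1
  · obtain ⟨c, rfl⟩ := Finset.card_eq_one.1 h1
    exact ⟨c, by simp⟩
  · obtain ⟨l, hl⟩ : ∃ l, l ∉ A := by
      by_contra! hall
      rw [Finset.eq_univ_of_forall hall, Finset.card_univ] at h
      exact lt_irrefl _ h
    exact ⟨l, by rw [Finset.card_insert_of_notMem hl]; omega⟩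

/-- A precoloring with few edges can be enlarged without becoming exceptional. -/
theorem IsPrecoloring.exists_superset_card_eq {n : ℕ}
    (hC : Fintype.card C + 1 = 2 * n) (hV : Fintype.card V = 2 * n)
    (hH : IsPrecoloring H) (hcard : H.card ≤ 2 * n) (hexc : ¬ IsExceptional Finset.univ H) :
    ∃ K, H ⊆ K ∧ IsPrecoloring K ∧ K.card = 2 * n ∧ ¬ IsExceptional Finset.univ K := by
  induction hk : 2 * n - H.card using Nat.strong_induction_on generalizing H with
  | _ k ih =>
  subst hk
  obtain h | h := hcard.eq_or_lt
  · exact ⟨H, subset_rfl, hH, h, hexc⟩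
  obtain ⟨q, hq⟩ := hH.even_card
  have hs : (covered H).card ≤ H.card := Finset.card_image_le
  obtain ⟨a, ha, b, hb, hab⟩ := Finset.one_lt_card.1
    (show 1 < ((covered H)ᶜ).card by rw [Finset.card_compl]; omega)
  rw [Finset.mem_compl, mem_covered] at ha hb
  push Not at ha hb
  have hp := hH.two_mul_card_palette_le
  obtain ⟨l, hl⟩ := exists_card_insert_ne_two (show (palette H).card < Fintype.card C by omega)
  have hK := hH.insertEdge (c := l) hab (ha b) (fun w => ha w l) (fun w => hb w l)
  have hKc : (insert (a, b, l) (insert (b, a, l) H)).card = H.card + 2 := by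
    rw [Finset.card_insert_of_notMem, Finset.card_insert_of_notMem (hb a l)]
    simp [ha b l, hab]
  obtain ⟨K, hKK, h1, h2, h3⟩ := ih _ (by omega) hK (by omega) (fun hexc => by
    have h := hexc.card_palette hK
    simp only [palette, Finset.image_insert] at h
    rw [Finset.insert_idem] at h
    exact hl h) rfl
  exact ⟨K, ((Finset.subset_insert _ _).trans (Finset.subset_insert _ _)).trans hKK, h1, h2, h3⟩

theorem Completable.of_card_eq {n : ℕ} (hn : 2 ≤ n) (ih : ∀ m < n, AndersenHilton m)
    (hC : Fintype.card C + 1 = Fintype.card V) (hV : Fintype.card V = 2 * n)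
    (hH : IsPrecoloring H) (hcard : H.card = 2 * n) (hexc : ¬ IsExceptional Finset.univ H) :
    Completable H := by
  induction hk : (covered H).card using Nat.strong_induction_on generalizing H with
  | _ k ih' =>
  subst hk
  obtain h | h := ((Finset.card_le_univ (covered H)).trans_eq hV).eq_or_lt
  · exact Completable.of_covered_eq hn ih hC hV hH hcard h hexc
  · exact Completable.of_covered_lt ih hC hV hH hcard h fun K hK hKc hKe hKs =>
      ih' _ hKs hK hKc hKe rfl

end

theorem andersenHilton (n : ℕ) : AndersenHilton n := by
  induction n using Nat.strong_induction_on with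
  | _ n ih =>
  intro V C _ _ _ _ H hV hC hH hcard hexc
  obtain h | rfl | h : n = 0 ∨ n = 1 ∨ 2 ≤ n := by omega
  · omega
  · obtain ⟨c, hc⟩ := Fintype.card_eq_one_iff.1 (show Fintype.card C = 1 by omega)
    refine ⟨fun _ _ => c, ⟨fun _ _ => rfl, fun u _ v _ w _ huv huw _ => ?_⟩,
      fun _ _ k _ => (hc k).symm⟩
    by_contra hvw
    have := Finset.card_le_univ {u, v, w}
    rw [Finset.card_eq_three.2 ⟨u, v, w, huv, huw, hvw, rfl⟩] at this
    omega
  · obtain ⟨K, hHK, hK, hKc, hKe⟩ := hH.exists_superset_card_eq hC hV hcard hexc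
    obtain ⟨f, hf, hfK⟩ := Completable.of_card_eq h ih (hC.trans hV.symm) hV hK hKc hKe
    exact ⟨f, hf, fun u v c h => hfK u v c (hHK h)⟩

section

variable {N M : ℕ} {φ : Sym2 (Fin N) → Option ℕ}

/-- The precolored edges of `φ`, in both orientations, together with their colors. -/
def orientedEdges (φ : Sym2 (Fin N) → Option ℕ) (M : ℕ) : Finset (Fin N × Fin N × Fin M) :=
  Finset.univ.filter fun p => φ s(p.1, p.2.1) = some (p.2.2 : ℕ)

theorem mem_orientedEdges {u v : Fin N} {c : Fin M} :
    (u, v, c) ∈ orientedEdges φ M ↔ φ s(u, v) = some (c : ℕ) := by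
  simp [orientedEdges]

theorem UsesColors.exists_mem_orientedEdges (hc : UsesColors φ M) {u v : Fin N}
    (h : s(u, v) ∈ Precolored φ) : ∃ c, (u, v, c) ∈ orientedEdges φ M := by
  obtain ⟨a, ha⟩ := Option.ne_none_iff_exists'.1 h
  exact ⟨⟨a, hc _ _ ha⟩, mem_orientedEdges.2 ha⟩

theorem mem_precolored_of_mem {u v : Fin N} {c : Fin M} (h : (u, v, c) ∈ orientedEdges φ M) :
    s(u, v) ∈ Precolored φ := by
  rw [mem_orientedEdges] at h
  simp [Precolored, h]

theorem isPrecoloring_orientedEdges (hφ : IsPartialProperEdgeColoring ⊤ φ) :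
    IsPrecoloring (orientedEdges φ M) := by
  have hne : ∀ u v c, (u, v, c) ∈ orientedEdges φ M → u ≠ v := fun u v c h => by
    simpa using hφ.1 _ (mem_precolored_of_mem h)
  refine ⟨fun u v c h => ?_, hne, fun u v w c h h' => ?_, fun u v c d h h' => ?_⟩
  · rw [mem_orientedEdges] at h ⊢
    rwa [Sym2.eq_swap]
  · by_contra hvw
    refine hφ.2 (e := s(u, v)) (f := s(u, w)) ⟨hφ.1 _ (mem_precolored_of_mem h),
      hφ.1 _ (mem_precolored_of_mem h'), fun h => hvw (Sym2.congr_right.1 h), u, by simp, by simp⟩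
      (mem_precolored_of_mem h) ?_
    rw [mem_orientedEdges.1 h, mem_orientedEdges.1 h']
  · rw [mem_orientedEdges] at h h'
    exact Fin.ext (Option.some_injective _ (h.symm.trans h'))

theorem card_orientedEdges_le : (orientedEdges φ M).card ≤ 2 * (Precolored φ).ncard := by
  have h1 := Finset.card_le_mul_card_image (f := fun p : Fin N × Fin N × Fin M => s(p.1, p.2.1))
    (orientedEdges φ M) 2 fun e he => by
      obtain ⟨⟨u, v, c⟩, hp, rfl⟩ := Finset.mem_image.1 he
      refine (Finset.card_le_card (t := {(u, v, c), (v, u, c)}) ?_).trans Finset.card_le_two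
      rintro ⟨u', v', c'⟩ hp'
      obtain ⟨hp', h⟩ := Finset.mem_filter.1 hp'
      rw [mem_orientedEdges] at hp hp'
      simp only at h
      obtain rfl : c' = c := Fin.ext (Option.some_injective _ (by rw [← hp, ← hp', h]))
      rcases Sym2.eq_iff.1 h with ⟨rfl, rfl⟩ | ⟨rfl, rfl⟩ <;> simp
  refine h1.trans (Nat.mul_le_mul_left 2 ?_)
  rw [← Set.ncard_coe_finset]
  refine Set.ncard_le_ncard ?_ (Set.toFinite _)
  intro e he
  obtain ⟨⟨u, v, c⟩, hp, rfl⟩ := Finset.mem_image.1 (Finset.mem_coe.1 he)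
  exact mem_precolored_of_mem hp

theorem IsExceptional.exists_color_classes {n : ℕ} (hN : N = 2 * n) (hc : UsesColors φ M)
    (hcard : (Precolored φ).ncard ≤ n) (h : IsExceptional Finset.univ (orientedEdges φ M)) :
    IndependentEdges (Precolored φ) ∧ ∃ c c' : ℕ, c ≠ c' ∧
      {e | φ e = some c}.ncard = n - 1 ∧ {e | φ e = some c'}.ncard = 1 ∧
      ∀ e a, φ e = some a → a = c ∨ a = c' := by
  obtain ⟨hcov, hmatch, x, y, c, c', hcc, hxy, -, hall⟩ := h
  have hcol : ∀ e a, φ e = some a → a = (c : ℕ) ∨ e = s(x, y) := by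
    intro e a h
    induction e with
    | _ u v =>
      rcases hall u v ⟨a, hc _ _ h⟩ (mem_orientedEdges.2 h) with h' | h' | h'
      · exact Or.inl (congrArg Fin.val h')
      · exact Or.inr (by rw [h'.1, h'.2])
      · exact Or.inr (by rw [h'.1, h'.2, Sym2.eq_swap])
  rw [mem_orientedEdges] at hxy
  have hval : (c : ℕ) ≠ c' := fun h => hcc (Fin.ext h)
  have hc' : {e | φ e = some (c' : ℕ)} = {s(x, y)} := by
    ext e
    refine ⟨fun h => ((hcol e _ h).resolve_left hval.symm), ?_⟩
    rintro rfl
    exact hxy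
  have hpre : Precolored φ = insert s(x, y) {e | φ e = some (c : ℕ)} := by
    ext e
    refine ⟨fun h => ?_, ?_⟩
    · obtain ⟨a, ha⟩ := Option.ne_none_iff_exists'.1 h
      rcases hcol e a ha with rfl | h'
      · exact Or.inr ha
      · exact Or.inl h'
    · rintro (rfl | h) h'
      · rw [hxy] at h'
        exact Option.some_ne_none _ h'
      · exact Option.some_ne_none _ (h.symm.trans h')
  have hn : (Precolored φ).ncard = {e | φ e = some (c : ℕ)}.ncard + 1 := by
    rw [hpre, Set.ncard_insert_of_notMem _ (Set.toFinite _)]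
    intro h
    exact hval (Option.some_injective _ (h.symm.trans hxy))
  have h2n : 2 * n ≤ (orientedEdges φ M).card := by
    have h1 : (covered (orientedEdges φ M)).card ≤ _ := Finset.card_image_le
    rw [Finset.eq_univ_of_forall fun u => mem_covered.2 (hcov u (Finset.mem_univ u)),
      Finset.card_univ, Fintype.card_fin] at h1
    omega
  have hle := card_orientedEdges_le (φ := φ) (M := M)
  refine ⟨fun e he f hf hef v hve hvf => ?_, c, c', hval, by omega, ?_, fun e a h => ?_⟩
  · obtain ⟨a, rfl⟩ := hve
    obtain ⟨b, rfl⟩ := hvf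
    obtain ⟨k, hk⟩ := hc.exists_mem_orientedEdges he
    obtain ⟨l, hl⟩ := hc.exists_mem_orientedEdges hf
    exact hef (by rw [hmatch _ _ _ _ _ hk hl])
  · rw [hc', Set.ncard_singleton]
  · refine (hcol e a h).imp_right fun h' => ?_
    rw [h', hxy] at h
    exact (Option.some_injective _ h).symm

theorem Completable.extendable (hc : UsesColors φ M) (h : Completable (orientedEdges φ M)) :
    Extendable (⊤ : SimpleGraph (Fin N)) φ M := by
  obtain ⟨f, hf, hfφ⟩ := h
  refine ⟨Sym2.lift ⟨fun u v => (f u v : ℕ), fun u v => congrArg Fin.val (hf.symm u v)⟩, ?_, ?_, ?_⟩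
  · rintro e e' ⟨he, he', hne, v, ⟨a, rfl⟩, b, rfl⟩ h
    simp only [Sym2.lift_mk] at h
    rw [SimpleGraph.mem_edgeSet, SimpleGraph.top_adj] at he he'
    exact hne (by rw [hf.2 v (Finset.mem_univ _) a (Finset.mem_univ _) b (Finset.mem_univ _) he he'
      (Fin.ext h)])
  · intro e _
    induction e with
    | _ u v => exact (f u v).2
  · intro e a h
    induction e with
    | _ u v =>
      exact congrArg Fin.val (hfφ u v ⟨a, hc _ _ h⟩ (mem_orientedEdges.2 h))

end

theorem stmt9 (n : ℕ) (hn : 2 ≤ n) (φ : Sym2 (Fin (2*n)) → Option ℕ)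
    (hφ : IsPartialProperEdgeColoring ⊤ φ) (hc : UsesColors φ (2*n-1))
    (hcard : (Precolored φ).ncard ≤ n)
    (hexc : ¬ (IndependentEdges (Precolored φ) ∧ ∃ c c' : ℕ, c ≠ c' ∧
      {e | φ e = some c}.ncard = n - 1 ∧ {e | φ e = some c'}.ncard = 1 ∧
      ∀ e a, φ e = some a → a = c ∨ a = c')) :
    Extendable (⊤ : SimpleGraph (Fin (2*n))) φ (2*n-1) := by
  refine Completable.extendable hc (andersenHilton n _ _ _ (by simp) (by simp; omega)
    (isPrecoloring_orientedEdges hφ) (card_orientedEdges_le.trans (by omega)) fun h => hexc ?_)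
  exact h.exists_color_classes rfl hc hcard
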